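/- arXiv:1906.11650 — 2 statements merged into one kernel-verified Lean document; each statement's English description precedes it below -/
import Mathlib

section
/- For every prime power q, the Bloch group B(F_q) of the finite field with q elements is cyclic of order (q+1)/2 if q is odd, and cyclic of order q+1 if q is even. -/
open scoped Classical

noncomputable section

variable (F : Type) [Field F]

/-- The group of square classes `G_F = F^× / (F^×)²`. -/
def SqCl (F : Type) [Field F] : Type :=
  Fˣ ⧸ (powMonoidHom 2 : Fˣ →* Fˣ).range

instance : CommGroup (SqCl F) := QuotientGroup.Quotient.commGroup _

/-- The square class of a unit. -/
def sqc : Fˣ →* SqCl F := QuotientGroup.mk' _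

/-- The group ring `R_F = ℤ[F^×/(F^×)²]`. -/
abbrev RF (F : Type) [Field F] : Type := MonoidAlgebra ℤ (SqCl F)

/-- `⟨x⟩ ∈ R_F`, the square class of a unit as an element of the group ring. -/
def cls (x : Fˣ) : RF F := MonoidAlgebra.of ℤ (SqCl F) (sqc F x)

/-- The free `R_F`-module on the set `F^×`. -/
abbrev FreeRP (F : Type) [Field F] : Type := Fˣ →₀ RF F

/-- The generator `[x]` of the free module. -/
def gen (x : Fˣ) : FreeRP F := Finsupp.single x 1

/-- units from nonzero field elements -/
def U (x : F) (h : x ≠ 0) : Fˣ := Units.mk0 x h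

variable {F}

theorem one_sub_ne {x : Fˣ} (hx : (x : F) ≠ 1) : (1 : F) - x ≠ 0 :=
  sub_ne_zero.mpr (Ne.symm hx)

theorem inv_sub_one_ne {x : Fˣ} (hx : (x : F) ≠ 1) : ((x : F)⁻¹ - 1) ≠ 0 :=
  sub_ne_zero.mpr (fun h => hx (by rwa [inv_eq_one] at h))

theorem one_sub_inv_ne {x : Fˣ} (hx : (x : F) ≠ 1) : (1 - (x : F)⁻¹) ≠ 0 :=
  sub_ne_zero.mpr (fun h => hx (by rw [eq_comm, inv_eq_one] at h; exact h.symm ▸ rfl))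

variable (F)

/-- The five term relation `S_{x,y}` as an element of the free module. -/
def FT (x y : Fˣ) (hx : (x : F) ≠ 1) (hy : (y : F) ≠ 1) : FreeRP F :=
  gen F x - gen F y + cls F x • gen F (y * x⁻¹)
    - cls F (U F ((x : F)⁻¹ - 1) (inv_sub_one_ne hx)) •
        gen F (U F ((1 - (x : F)⁻¹) / (1 - (y : F)⁻¹))
          (div_ne_zero (one_sub_inv_ne hx) (one_sub_inv_ne hy)))
    + cls F (U F (1 - (x : F)) (one_sub_ne hx)) •
        gen F (U F ((1 - (x : F)) / (1 - (y : F)))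
          (div_ne_zero (one_sub_ne hx) (one_sub_ne hy)))

/-- The set of five-term relations. -/
def ftRels : Set (FreeRP F) :=
  {w | ∃ (x y : Fˣ) (hx : (x : F) ≠ 1) (hy : (y : F) ≠ 1), w = FT F x y hx hy}

/-- The relations `ψ₁(x) = [x] + ⟨-1⟩[x⁻¹]`. -/
def psiRels : Set (FreeRP F) :=
  {w | ∃ x : Fˣ, w = gen F x + cls F (-1) • gen F x⁻¹}

/-- relations `⟨-1⟩[x] = [x]` -/
def minusRels : Set (FreeRP F) :=
  {w | ∃ x : Fˣ, w = cls F (-1) • gen F x - gen F x}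

/-- relations `[x⁻¹] = -[x]` -/
def invRels : Set (FreeRP F) :=
  {w | ∃ x : Fˣ, w = gen F x⁻¹ + gen F x}

/-- The module `qRP(F) = RP(F)/⟨ψ₁(x) : x ∈ F^×⟩`. -/
def qRP : Type := FreeRP F ⧸ Submodule.span (RF F) (ftRels F ∪ psiRels F)

instance : AddCommGroup (qRP F) := by unfold qRP; infer_instance
instance : Module (RF F) (qRP F) := by unfold qRP; infer_instance

/-- `[x] ∈ qRP(F)` -/
def qrp (x : Fˣ) : qRP F := Submodule.Quotient.mk (gen F x)

/-- The module `RP′(F)`. -/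
def RP' : Type :=
  FreeRP F ⧸ Submodule.span (RF F)
    ({gen F 1} ∪ ftRels F ∪ minusRels F ∪ invRels F)

instance : AddCommGroup (RP' F) := by unfold RP'; infer_instance
instance : Module (RF F) (RP' F) := by unfold RP'; infer_instance

/-- `[x] ∈ RP′(F)` -/
def rp (x : Fˣ) : RP' F := Submodule.Quotient.mk (gen F x)

/-- the submodule of `M` generated by the elements `(⟨a⟩ - χ(a))·m`. -/
def chiSub (χ : SqCl F →* ℤˣ) (M : Type) [AddCommGroup M] [Module (RF F) M] :
    Submodule (RF F) M :=
  Submodule.span (RF F)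
    {w | ∃ (a : Fˣ) (m : M), w = cls F a • m - ((χ (sqc F a) : ℤ)) • m}

/-- `M_χ` -/
def ChiQuot (χ : SqCl F →* ℤˣ) (M : Type) [AddCommGroup M] [Module (RF F) M] : Type :=
  M ⧸ chiSub F χ M

instance (χ : SqCl F →* ℤˣ) (M : Type) [AddCommGroup M] [Module (RF F) M] :
    AddCommGroup (ChiQuot F χ M) := by unfold ChiQuot; infer_instance
instance (χ : SqCl F →* ℤˣ) (M : Type) [AddCommGroup M] [Module (RF F) M] :
    Module (RF F) (ChiQuot F χ M) := by unfold ChiQuot; infer_instance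

/-- image of `m` in `M_χ` -/
def mkChi (χ : SqCl F →* ℤˣ) {M : Type} [AddCommGroup M] [Module (RF F) M] (m : M) :
    ChiQuot F χ M := Submodule.Quotient.mk m

/-- `M[1/2]`, as an `R_F`-module (localization at the powers of `2`). -/
def Loc2 (M : Type) [AddCommGroup M] [Module (RF F) M] : Type :=
  LocalizedModule (Submonoid.powers (2 : RF F)) M

instance (M : Type) [AddCommGroup M] [Module (RF F) M] : AddCommGroup (Loc2 F M) := by
  unfold Loc2; infer_instance
instance (M : Type) [AddCommGroup M] [Module (RF F) M] : Module (RF F) (Loc2 F M) := by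
  unfold Loc2; infer_instance

/-- the canonical map `M → M[1/2]` -/
def toLoc2 {M : Type} [AddCommGroup M] [Module (RF F) M] (m : M) : Loc2 F M :=
  LocalizedModule.mkLinearMap (Submonoid.powers (2 : RF F)) M m


/-- the square class of a field element (junk value `1` at `0`). -/
def sqv (a : F) : SqCl F := if h : a ≠ 0 then sqc F (U F a h) else 1

/-- `[a] ∈ RP′(F)` for a field element `a`, where `[0]` is assigned the value `c₀`. -/
def rpc (c₀ : RP' F) (a : F) : RP' F := if h : a ≠ 0 then rp F (U F a h) else c₀


section PreBloch

variable (k : Type) [Field k]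

/-- The plain five-term relation in the free abelian group on `k^×`. -/
def FTZ (x y : kˣ) (hx : (x : k) ≠ 1) (hy : (y : k) ≠ 1) : kˣ →₀ ℤ :=
  Finsupp.single x 1 - Finsupp.single y 1 + Finsupp.single (y * x⁻¹) 1
    - Finsupp.single (U k ((1 - (x : k)⁻¹) / (1 - (y : k)⁻¹))
        (div_ne_zero (one_sub_inv_ne hx) (one_sub_inv_ne hy))) 1
    + Finsupp.single (U k ((1 - (x : k)) / (1 - (y : k)))
        (div_ne_zero (one_sub_ne hx) (one_sub_ne hy))) 1

/-- The pre-Bloch (scissors congruence) group `P(k)`: generators `[x]`, `x ∈ k^×`,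
relations `[1] = 0` and the five-term relations. -/
def PBloch : Type :=
  (kˣ →₀ ℤ) ⧸ Submodule.span ℤ
    ({Finsupp.single (1 : kˣ) (1 : ℤ)} ∪
      {w | ∃ (x y : kˣ) (hx : (x : k) ≠ 1) (hy : (y : k) ≠ 1), w = FTZ k x y hx hy})

instance : AddCommGroup (PBloch k) := by unfold PBloch; infer_instance

/-- `[x] ∈ P(k)` -/
def pb (x : kˣ) : PBloch k := Submodule.Quotient.mk (Finsupp.single x 1)

/-- `S²_ℤ(k^×) = (k^× ⊗ k^×)/⟨a⊗b + b⊗a⟩`. -/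
def Sq2 : Type :=
  (TensorProduct ℤ (Additive kˣ) (Additive kˣ)) ⧸
    Submodule.span ℤ
      {w | ∃ a b : Additive kˣ, w = a ⊗ₜ[ℤ] b + b ⊗ₜ[ℤ] a}

instance : AddCommGroup (Sq2 k) := by unfold Sq2; infer_instance

/-- `a ∘ b ∈ S²_ℤ(k^×)` -/
def sq2mk (a b : kˣ) : Sq2 k :=
  Submodule.Quotient.mk (Additive.ofMul a ⊗ₜ[ℤ] Additive.ofMul b)

end PreBloch

end

section BW
variable {F : Type} [Field F] {A : Type} [AddCommGroup A]

structure BW (f : F → A) : Prop where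
  z : f 0 = 0
  o : f 1 = 0
  five : ∀ x y : F, x ≠ 0 → x ≠ 1 → y ≠ 0 → y ≠ 1 →
    f x - f y + f (y / x) - f ((1 - x⁻¹) / (1 - y⁻¹)) + f ((1 - x) / (1 - y)) = 0

namespace BW
variable {f : F → A} (h : BW f)
include h

theorem psi_mul0 (u w : F) (hu : u ≠ 0) (hw : w ≠ 0) (hu1 : u ≠ 1) (hw1 : w ≠ 1)
    (huw : u * w ≠ 1) :
    f (u * w) + f (u * w)⁻¹ = (f u + f u⁻¹) + (f w + f w⁻¹) := by
  have d : 1 - u * w ≠ 0 := sub_ne_zero.mpr (Ne.symm huw)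
  have du : 1 - u ≠ 0 := sub_ne_zero.mpr (Ne.symm hu1)
  have dw : 1 - w ≠ 0 := sub_ne_zero.mpr (Ne.symm hw1)
  obtain ⟨x, hx⟩ : ∃ x, x = (1 - u) / (1 - u * w) := ⟨_, rfl⟩
  have x0 : x ≠ 0 := by rw [hx]; exact div_ne_zero du d
  have e1 : 1 - x = u * (1 - w) / (1 - u * w) := by
    rw [hx, one_sub_div d]; congr 1; ring
  have e2 : 1 - w * x = (1 - w) / (1 - u * w) := by
    rw [hx, ← mul_div_assoc, one_sub_div d]; congr 1; ring
  have n1 : 1 - x ≠ 0 := by rw [e1]; exact div_ne_zero (mul_ne_zero hu dw) d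
  have n2 : 1 - w * x ≠ 0 := by rw [e2]; exact div_ne_zero dw d
  have x1 : x ≠ 1 := fun e => n1 (by rw [e, sub_self])
  have y1 : w * x ≠ 1 := fun e => n2 (by rw [e, sub_self])
  have y0 : w * x ≠ 0 := mul_ne_zero hw x0
  have C : (1 - x) / (1 - w * x) = u := by rw [e1, e2]; field_simp
  have W : w * x / x = w := by field_simp
  have W' : x / (w * x) = w⁻¹ := by field_simp
  have C' : (1 - w * x) / (1 - x) = u⁻¹ := by rw [← C, inv_div]
  have i1 : 1 - x⁻¹ = - (1 - x) / x := by field_simp; ring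
  have i2 : 1 - (w * x)⁻¹ = - (1 - w * x) / (w * x) := by field_simp; ring
  have B : (1 - x⁻¹) / (1 - (w * x)⁻¹) = u * w := by
    rw [i1, i2, ← C]; field_simp
  have B' : (1 - (w * x)⁻¹) / (1 - x⁻¹) = (u * w)⁻¹ := by rw [← B, inv_div]
  have r1 := h.five x (w * x) x0 x1 y0 y1
  have r2 := h.five (w * x) x y0 y1 x0 x1
  rw [C, B, W] at r1
  rw [C', B', W'] at r2
  rw [← sub_eq_zero]
  have := congrArg₂ (· + ·) r1 r2
  simp only [add_zero] at this
  rw [← neg_eq_zero, ← this]; abel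

theorem psi_two (h4 : ∀ a b c : F, ∃ u, u ≠ a ∧ u ≠ b ∧ u ≠ c) (w : F) :
    2 • (f w + f w⁻¹) = 0 := by
  by_cases w0 : w = 0
  · simp [w0, h.z]
  by_cases w1 : w = 1
  · simp [w1, h.o]
  obtain ⟨u, u0, u1, uw⟩ := h4 0 1 w⁻¹
  have huw : u * w ≠ 1 := fun e => uw (eq_inv_of_mul_eq_one_left e)
  have a := h.psi_mul0 u w u0 w0 u1 w1 huw
  have b := h.psi_mul0 (u * w) w⁻¹ (mul_ne_zero u0 w0) (inv_ne_zero w0) huw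
    (by simpa using w1) (by rw [mul_assoc, mul_inv_cancel₀ w0, mul_one]; exact u1)
  rw [mul_assoc, mul_inv_cancel₀ w0, mul_one, a, inv_inv] at b
  rw [← add_right_inj (f u + f u⁻¹), add_zero]
  nth_rewrite 2 [b]; abel

theorem psi_mul (h4 : ∀ a b c : F, ∃ u, u ≠ a ∧ u ≠ b ∧ u ≠ c) (u w : F)
    (hu : u ≠ 0) (hw : w ≠ 0) :
    f (u * w) + f (u * w)⁻¹ = (f u + f u⁻¹) + (f w + f w⁻¹) := by
  by_cases u1 : u = 1
  · simp [u1, h.o]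
  by_cases w1 : w = 1
  · simp [w1, h.o]
  by_cases uw : u * w = 1
  · have : w = u⁻¹ := eq_inv_of_mul_eq_one_right uw
    have t := h.psi_two h4 u
    rw [uw, this, inv_inv]
    simp only [inv_one, h.o]
    rw [add_zero, ← t]; abel
  exact h.psi_mul0 u w hu hw u1 w1 uw

theorem psi_sq (h4 : ∀ a b c : F, ∃ u, u ≠ a ∧ u ≠ b ∧ u ≠ c) (u w : F)
    (hu : u ≠ 0) (hw : w ≠ 0) :
    f (w * u ^ 2) + f (w * u ^ 2)⁻¹ = f w + f w⁻¹ := by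
  rw [h.psi_mul h4 w (u ^ 2) hw (pow_ne_zero _ hu), pow_two u, h.psi_mul h4 u u hu hu, ← two_smul ℕ (f u + f u⁻¹),
    h.psi_two h4, add_zero]

theorem cconst (x y : F) (x0 : x ≠ 0) (x1 : x ≠ 1) (y0 : y ≠ 0) (y1 : y ≠ 1) :
    f x + f (1 - x) = f y + f (1 - y) := by
  have n1 : 1 - x ≠ 0 := sub_ne_zero.mpr (Ne.symm x1)
  have n2 : 1 - y ≠ 0 := sub_ne_zero.mpr (Ne.symm y1)
  have r1 := h.five x y x0 x1 y0 y1
  have r2 := h.five (1 - y) (1 - x) n2 (by simpa using y0) n1 (by simpa using x0)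
  have i1 : 1 - x⁻¹ = - (1 - x) / x := by field_simp; ring
  have i2 : 1 - y⁻¹ = - (1 - y) / y := by field_simp; ring
  have i3 : 1 - (1 - x)⁻¹ = - x / (1 - x) := by field_simp; ring
  have i4 : 1 - (1 - y)⁻¹ = - y / (1 - y) := by field_simp; ring
  have B : (1 - (1 - y)⁻¹) / (1 - (1 - x)⁻¹) = (1 - x⁻¹) / (1 - y⁻¹) := by
    rw [i1, i2, i3, i4]; field_simp
  rw [B, sub_sub_cancel, sub_sub_cancel] at r2
  have := congrArg₂ (· - ·) r1 r2
  simp only [sub_self] at this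
  rw [← sub_eq_zero, ← this]; abel

theorem three_c (h4 : ∀ a b c : F, ∃ u, u ≠ a ∧ u ≠ b ∧ u ≠ c) (C : A)
    (hC : ∀ x, x ≠ 0 → x ≠ 1 → f x + f (1 - x) = C) : 3 • C = f (-1) + f (-1)⁻¹ := by
  obtain ⟨x, x0, x1, -⟩ := h4 0 1 1
  have n1 : 1 - x ≠ 0 := sub_ne_zero.mpr (Ne.symm x1)
  have n1' : x - 1 ≠ 0 := sub_ne_zero.mpr x1
  have i1 : 1 - x⁻¹ = - (1 - x) / x := by field_simp; ring
  have n2 : 1 - x⁻¹ ≠ 0 := by rw [i1]; exact div_ne_zero (neg_ne_zero.mpr n1) x0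
  have e1 := hC x x0 x1
  have e2 := hC x⁻¹ (inv_ne_zero x0) (by simpa using x1)
  have e3 := hC (1 - x)⁻¹ (inv_ne_zero n1) (by simpa using x0)
  have i3 : 1 - (1 - x)⁻¹ = (1 - x⁻¹)⁻¹ := by
    rw [i1]; field_simp; ring
  rw [i3] at e3
  have m1 := h.psi_mul h4 (1 - x⁻¹) x n2 x0
  have m2 := h.psi_mul h4 ((1 - x⁻¹) * x) (1 - x) (mul_ne_zero n2 x0) n1
  have e4 : (1 - x⁻¹) * x * (1 - x) = (-1) * (1 - x) ^ 2 := by field_simp; ring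
  have m3 := h.psi_sq h4 (1 - x) (-1) n1 (by simp)
  rw [e4, m3, m1] at m2
  rw [m2]
  have : 3 • C = (f x + f (1 - x)) + (f x⁻¹ + f (1 - x⁻¹)) + (f (1 - x)⁻¹ + f (1 - x⁻¹)⁻¹) := by
    rw [e1, e2, e3]; abel
  rw [this]; abel

theorem tors [Fintype F] (h4 : ∀ a b c : F, ∃ u, u ≠ a ∧ u ≠ b ∧ u ≠ c) (x : F) :
    (Fintype.card F + 1) • f x = 0 := by
  by_cases x0 : x = 0
  · simp [x0, h.z]
  by_cases x1 : x = 1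
  · simp [x1, h.o]
  have n1 : 1 - x ≠ 0 := sub_ne_zero.mpr (Ne.symm x1)
  have n2 : 1 - x⁻¹ ≠ 0 := sub_ne_zero.mpr (fun e => x1 (by rw [← inv_inv x, ← e, inv_one]))
  let E : F → A := fun y =>
    f x - f y + f (y / x) - f ((1 - x⁻¹) / (1 - y⁻¹)) + f ((1 - x) / (1 - y))
  have s1 : ∑ y, f (y / x) = ∑ y, f y :=
    Function.Bijective.sum_comp (e := fun y : F => y / x)
      (Finite.injective_iff_bijective.mp (fun a b hab => by
        simpa [x0] using hab)) f
  have s2 : ∑ y, f ((1 - x⁻¹) / (1 - y⁻¹)) = ∑ y, f y :=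
    Function.Bijective.sum_comp (e := fun y : F => (1 - x⁻¹) / (1 - y⁻¹))
      (Finite.injective_iff_bijective.mp (fun a b hab => by
        simpa [div_eq_mul_inv, n2] using hab)) f
  have s3 : ∑ y, f ((1 - x) / (1 - y)) = ∑ y, f y :=
    Function.Bijective.sum_comp (e := fun y : F => (1 - x) / (1 - y))
      (Finite.injective_iff_bijective.mp (fun a b hab => by
        simpa [div_eq_mul_inv, n1] using hab)) f
  have t : ∑ y, E y = Fintype.card F • f x := by
    simp only [E, Finset.sum_add_distrib, Finset.sum_sub_distrib, s1, s2, s3, Finset.sum_const,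
      Finset.card_univ]
    abel
  have t2 : ∑ y, E y = E 0 + E 1 := by
    rw [← Finset.sum_pair (zero_ne_one (α := F))]
    symm
    apply Finset.sum_subset (Finset.subset_univ _)
    intro y _ hy
    simp only [Finset.mem_insert, Finset.mem_singleton, not_or] at hy
    exact h.five x y x0 x1 hy.1 hy.2
  have c1 := h.cconst x⁻¹ x (inv_ne_zero x0) (by simpa using x1) x0 x1
  have p2 := h.psi_two h4 x
  rw [add_smul, ← t, t2]
  simp only [E, h.z, h.o, inv_zero, inv_one, sub_zero, sub_self, div_one, div_zero, zero_div,
    one_div, one_smul]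
  have : f (1 - x⁻¹) = f x + f (1 - x) - f x⁻¹ := by rw [← c1]; abel
  rw [this]; refine Eq.trans ?_ p2; abel

theorem sqf (h4 : ∀ a b c : F, ∃ u, u ≠ a ∧ u ≠ b ∧ u ≠ c) (C : A)
    (hC : ∀ x, x ≠ 0 → x ≠ 1 → f x + f (1 - x) = C) (x : F) (x0 : x ≠ 0) (x1 : x ≠ 1)
    (x2 : x ≠ -1) : f (x ^ 2) = 2 • f x + 2 • f (-x) - 3 • C := by
  have n1 : 1 - x ≠ 0 := sub_ne_zero.mpr (Ne.symm x1)
  have n2 : 1 + x ≠ 0 := fun e => x2 (by linear_combination e)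
  have n3 : 1 - x ^ 2 ≠ 0 := by
    have : 1 - x ^ 2 = (1 - x) * (1 + x) := by ring
    rw [this]; exact mul_ne_zero n1 n2
  have r := h.five x (x ^ 2) x0 x1 (pow_ne_zero _ x0) (fun e => n3 (by rw [e, sub_self]))
  have a1 : x ^ 2 / x = x := by field_simp
  have a2 : (1 - x) / (1 - x ^ 2) = (1 + x)⁻¹ := by
    have : 1 - x ^ 2 = (1 - x) * (1 + x) := by ring
    rw [this]; field_simp
  have i1 : 1 - x⁻¹ = - (1 - x) / x := by field_simp; ring
  have i2 : 1 - (x ^ 2)⁻¹ = - ((1 - x) * (1 + x)) / x ^ 2 := by field_simp; ring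
  have a3 : (1 - x⁻¹) / (1 - (x ^ 2)⁻¹) = 1 - (1 + x)⁻¹ := by
    rw [i1, i2]; field_simp
    try ring
  rw [a1, a2, a3] at r
  have e1 := hC (1 + x)⁻¹ (inv_ne_zero n2) (by simpa using x0)
  have e2 := hC (1 + x) n2 (by simpa using x0)
  have e3 : 1 - (1 + x) = -x := by ring
  rw [e3] at e2
  have p := h.psi_two h4 (1 + x)
  rw [← eq_sub_iff_add_eq'] at e1 e2
  rw [e1] at r
  rw [← sub_eq_zero, ← neg_eq_zero, ← r]
  have e4 : f (-x) = C - f (1 + x) := e2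
  rw [e4, ← sub_eq_zero, ← neg_eq_zero, ← p]; abel


theorem even_c (h4 : ∀ a b c : F, ∃ u, u ≠ a ∧ u ≠ b ∧ u ≠ c) (two : (2 : F) ≠ 0) (C : A)
    (hC : ∀ x, x ≠ 0 → x ≠ 1 → f x + f (1 - x) = C) : Even C := by
  have e3 := h.three_c h4 C hC
  have key : Even (3 • C) → Even C := fun e => by
    have : C = 3 • C - (C + C) := by abel
    rw [this]; exact e.sub ⟨C, rfl⟩
  apply key
  by_cases hs : IsSquare (-1 : F)
  · obtain ⟨i, hi⟩ := hs
    have i0 : i ≠ 0 := by rintro rfl; simp at hi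
    have := h.psi_sq h4 i 1 i0 one_ne_zero
    rw [one_mul, pow_two, ← hi] at this
    rw [e3, this, inv_one, h.o]; exact ⟨0, by simp⟩
  obtain ⟨u, u0, u1, u2⟩ := h4 0 1 (-1)
  have n1 : u - 1 ≠ 0 := sub_ne_zero.mpr u1
  have n2 : u + 1 ≠ 0 := fun e => u2 (by linear_combination e)
  obtain ⟨s, hs'⟩ : ∃ s, s = (u + u⁻¹) / 2 := ⟨_, rfl⟩
  obtain ⟨t, ht'⟩ : ∃ t, t = (u - u⁻¹) / 2 := ⟨_, rfl⟩
  have st : 1 - (-1 * t ^ 2) = s ^ 2 := by rw [hs', ht']; field_simp; ring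
  have t0 : t ≠ 0 := by
    intro e
    have : (u - 1) * (u + 1) = 2 * u * t := by rw [ht']; field_simp; ring
    rw [e, mul_zero] at this
    exact mul_ne_zero n1 n2 this
  have s0 : s ≠ 0 := by
    intro e
    have : u * u = -1 + 2 * u * s := by rw [hs']; field_simp; ring
    rw [e, mul_zero, add_zero] at this
    exact hs ⟨u, this.symm⟩
  have t20 : t ^ 2 ≠ 0 := pow_ne_zero _ t0
  have x0 : -1 * t ^ 2 ≠ 0 := mul_ne_zero (by simp) t20
  have x1 : -1 * t ^ 2 ≠ 1 := fun e => pow_ne_zero 2 s0 (by rw [← st, e, sub_self])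
  have evsq : ∀ v : F, v ≠ 0 → v ^ 2 ≠ 1 → Even (C - f (v ^ 2)) := by
    intro v v0 v1
    rw [h.sqf h4 C hC v v0 (by rintro rfl; simp at v1) (by rintro rfl; simp at v1)]
    exact ⟨2 • C - f v - f (-v), by abel⟩
  have w1 := hC _ x0 x1
  have w2 := hC _ (inv_ne_zero x0) (fun e => x1 (inv_eq_one.mp e))
  have st2 : 1 - (-1 * t ^ 2)⁻¹ = (s / t) ^ 2 := by
    rw [div_pow, ← st]; field_simp; ring
  rw [st] at w1
  rw [st2] at w2
  have p := h.psi_sq h4 t (-1) t0 (by simp)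
  rw [e3, ← p, eq_sub_of_add_eq w1, eq_sub_of_add_eq w2]
  refine (evsq s s0 ?_).add (evsq (s / t) (div_ne_zero s0 t0) ?_)
  · intro e; rw [← st] at e; exact x0 (by linear_combination -e)
  · intro e; rw [← st2] at e; exact inv_ne_zero x0 (by linear_combination -e)

theorem gen2 [Fintype F] (h4 : ∀ a b c : F, ∃ u, u ≠ a ∧ u ≠ b ∧ u ≠ c) (two : (2 : F) ≠ 0)
    (x0 : F) (s0 : ¬ IsSquare x0) (s1 : ¬ IsSquare (1 - x0)) (x : F) :
    Even (f x) ∨ Even (f x - f x0) := by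
  have nn : ∀ a b : F, ¬ IsSquare a → ¬ IsSquare b → IsSquare (a / b) := by
    intro a b ha hb
    have a0 : a ≠ 0 := by rintro rfl; simp at ha
    have b0 : b ≠ 0 := by rintro rfl; simp at hb
    rw [← quadraticChar_one_iff_isSquare (div_ne_zero a0 b0), div_eq_mul_inv, map_mul]
    rw [← quadraticChar_neg_one_iff_not_isSquare] at ha
    have hb' : ¬ IsSquare b⁻¹ := by rwa [isSquare_inv]
    rw [← quadraticChar_neg_one_iff_not_isSquare] at hb'
    rw [ha, hb']; rfl
  have x00 : x0 ≠ 0 := by rintro rfl; simp at s0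
  have x01 : x0 ≠ 1 := by rintro rfl; simp at s0
  have hC : ∀ x, x ≠ 0 → x ≠ 1 → f x + f (1 - x) = f x0 + f (1 - x0) :=
    fun x a b => h.cconst x x0 a b x00 x01
  have ec := h.even_c h4 two _ hC
  have ev0 : Even (0 : A) := ⟨0, by simp⟩
  have evsq : ∀ v : F, IsSquare v → Even (f v) := by
    rintro _ ⟨v, rfl⟩
    by_cases v0 : v = 0
    · rw [v0, mul_zero, h.z]; exact ev0
    by_cases v1 : v = 1
    · rw [v1, mul_one, h.o]; exact ev0
    by_cases v2 : v = -1
    · rw [v2]; simp only [neg_mul_neg, mul_one, h.o]; exact ev0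
    rw [← pow_two, h.sqf h4 _ hC v v0 v1 v2, two_smul, two_smul, succ_nsmul, two_smul]
    exact ((Even.add ⟨_, rfl⟩ ⟨_, rfl⟩)).sub (Even.add ⟨_, rfl⟩ ec)
  by_cases hx : IsSquare x
  · exact Or.inl (evsq _ hx)
  have x0' : x ≠ 0 := by rintro rfl; simp at hx
  have x1' : x ≠ 1 := by rintro rfl; simp at hx
  by_cases hx1 : IsSquare (1 - x)
  · left
    rw [eq_sub_of_add_eq (hC x x0' x1')]
    exact ec.sub (evsq _ hx1)
  right
  have r := h.five x x0 x0' x1' x00 x01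
  have i1 : 1 - x⁻¹ = - (1 - x) / x := by field_simp; ring
  have i2 : 1 - x0⁻¹ = - (1 - x0) / x0 := by field_simp; ring
  have n2 : 1 - x0 ≠ 0 := sub_ne_zero.mpr (Ne.symm x01)
  have B : (1 - x⁻¹) / (1 - x0⁻¹) = ((1 - x) / (1 - x0)) * (x0 / x) := by
    rw [i1, i2]; field_simp
  have q1 := nn _ _ hx1 s1
  have q2 := nn _ _ s0 hx
  have q3 := q1.mul q2
  rw [B] at r
  have : f x - f x0 = f ((1 - x) / (1 - x0) * (x0 / x)) - f (x0 / x) - f ((1 - x) / (1 - x0)) := by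
    rw [← sub_eq_zero, ← r]; abel
  rw [this]
  exact ((evsq _ q3).sub (evsq _ q2)).sub (evsq _ q1)

end BW

theorem exists_x0 (F : Type) [Field F] [Fintype F] (two : (2 : F) ≠ 0) :
    ∃ x : F, ¬ IsSquare x ∧ ¬ IsSquare (1 - x) := by
  have hc : ringChar F ≠ 2 := by
    intro e
    apply two
    have := ringChar.Nat.cast_ringChar (R := F)
    rw [e] at this; exact_mod_cast this
  obtain ⟨n, hn⟩ := FiniteField.exists_nonsquare hc
  have n0 : n ≠ 0 := by rintro rfl; simp at hn
  have hR : Fintype.card F % 2 = 1 := FiniteField.odd_card_of_char_ne_two hc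
  obtain ⟨a, b, hab⟩ := FiniteField.exists_root_sum_quadratic
    (f := Polynomial.X ^ 2) (g := Polynomial.X ^ 2 - Polynomial.C (n⁻¹))
    (Polynomial.degree_X_pow 2) (Polynomial.degree_X_pow_sub_C (by decide) _) hR
  simp at hab
  have e : n * a ^ 2 + n * b ^ 2 = 1 := by
    have : a ^ 2 + b ^ 2 = n⁻¹ := by linear_combination hab
    rw [← mul_add, this, mul_inv_cancel₀ n0]
  have key : ∀ c d : F, n * c ^ 2 + n * d ^ 2 = 1 → ¬ IsSquare (n * c ^ 2) := by
    rintro c d hcd ⟨r, hr⟩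
    by_cases c0 : c = 0
    · apply hn
      have d0 : d ≠ 0 := by rintro rfl; simp [c0] at hcd
      refine ⟨d⁻¹, ?_⟩
      field_simp
      rw [c0] at hcd; linear_combination hcd
    · apply hn
      refine ⟨r / c, ?_⟩
      field_simp
      rw [pow_two] at hr ⊢
      linear_combination hr
  refine ⟨n * a ^ 2, key a b e, ?_⟩
  have : 1 - n * a ^ 2 = n * b ^ 2 := by linear_combination -e
  rw [this]
  exact key b a (by linear_combination e)

end BW

section pbsec
variable {k : Type} [Field k]

/-- the class of a field element, zero at zero -/
noncomputable def pbf (x : k) : PBloch k := if h : x = 0 then 0 else pb k (Units.mk0 x h)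

theorem pbf_unit (x : kˣ) : pbf (x : k) = pb k x := by
  rw [pbf, dif_neg x.ne_zero]; simp

theorem pbf_BW : BW (pbf : k → PBloch k) where
  z := by simp [pbf]
  o := by
    have : pbf ((1 : kˣ) : k) = pb k 1 := pbf_unit 1
    rw [Units.val_one] at this
    rw [this]
    exact (Submodule.Quotient.mk_eq_zero _).mpr (Submodule.subset_span (Or.inl rfl))
  five x y x0 x1 y0 y1 := by
    have := (Submodule.Quotient.mk_eq_zero (Submodule.span ℤ
      ({Finsupp.single (1 : kˣ) (1 : ℤ)} ∪
      {w | ∃ (x y : kˣ) (hx : (x : k) ≠ 1) (hy : (y : k) ≠ 1), w = FTZ k x y hx hy}))).mpr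
      (Submodule.subset_span (Or.inr ⟨Units.mk0 x x0, Units.mk0 y y0, x1, y1, rfl⟩))
    have hh : ∀ (z : k) (hz : z ≠ 0), pbf z = pb k (Units.mk0 z hz) := fun z hz => by
      rw [pbf, dif_neg hz]
    rw [hh x x0, hh y y0, hh (y / x) (div_ne_zero y0 x0),
      hh ((1 - x⁻¹) / (1 - y⁻¹)) (div_ne_zero (one_sub_inv_ne (x := Units.mk0 x x0) x1)
        (one_sub_inv_ne (x := Units.mk0 y y0) y1)),
      hh ((1 - x) / (1 - y)) (div_ne_zero (one_sub_ne (x := Units.mk0 x x0) x1)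
        (one_sub_ne (x := Units.mk0 y y0) y1))]
    have e : (Units.mk0 (y / x) (div_ne_zero y0 x0)) = Units.mk0 y y0 * (Units.mk0 x x0)⁻¹ := by
      ext; simp [div_eq_mul_inv]
    rw [e]
    exact this

theorem pbf_induction {p : PBloch k → Prop} (hz : p 0) (hg : ∀ x : k, p (pbf x))
    (ha : ∀ a b, p a → p b → p (a + b)) (hn : ∀ a, p a → p (-a)) (y : PBloch k) : p y := by
  have key : ∀ w : kˣ →₀ ℤ, p (Submodule.Quotient.mk w) := by
    intro w
    induction w using Finsupp.induction_linear with
    | zero => exact hz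
    | add f g hf hg => exact ha _ _ hf hg
    | single a n =>
      have e : Finsupp.single a n = n • Finsupp.single a (1 : ℤ) := by simp
      have : ∀ m : ℕ, p (m • pbf (a : k)) := by
        intro m
        induction m with
        | zero => simpa using hz
        | succ m ih => rw [succ_nsmul]; exact ha _ _ ih (hg _)
      have h2 : ∀ n : ℤ, p (n • pbf (a : k)) := by
        intro n
        obtain ⟨m, rfl | rfl⟩ := n.eq_nat_or_neg
        · simpa using this m
        · rw [neg_smul]; apply hn; simpa using this m
      have h3 := h2 n
      rw [pbf_unit] at h3
      rw [e]
      exact h3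
  obtain ⟨w, rfl⟩ := Submodule.Quotient.mk_surjective _ y
  exact key w

theorem pbf_lift {A : Type} [AddCommGroup A] (f : k → A) (ho : f 1 = 0) (hz : f 0 = 0)
    (h5 : ∀ x y : k, x ≠ 0 → x ≠ 1 → y ≠ 0 → y ≠ 1 → x ≠ y →
      f x - f y + f (y / x) - f ((1 - x⁻¹) / (1 - y⁻¹)) + f ((1 - x) / (1 - y)) = 0) :
    ∃ φ : PBloch k →+ A, ∀ x : k, φ (pbf x) = f x := by
  let g : (kˣ →₀ ℤ) →ₗ[ℤ] A := Finsupp.linearCombination ℤ (fun u : kˣ => f (u : k))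
  have hg : ∀ u : kˣ, g (Finsupp.single u 1) = f u := fun u => by simp [g]
  have hle : Submodule.span ℤ ({Finsupp.single (1 : kˣ) (1 : ℤ)} ∪
      {w | ∃ (x y : kˣ) (hx : (x : k) ≠ 1) (hy : (y : k) ≠ 1), w = FTZ k x y hx hy}) ≤
      LinearMap.ker g := by
    rw [Submodule.span_le]
    rintro w (hw | ⟨x, y, hx, hy, rfl⟩)
    · rw [Set.mem_singleton_iff] at hw
      rw [hw, SetLike.mem_coe, LinearMap.mem_ker, hg]; simpa using ho
    · rw [SetLike.mem_coe, LinearMap.mem_ker, FTZ]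
      simp only [map_add, map_sub, hg, Units.val_mul, U, Units.val_mk0, Units.val_inv_eq_inv_val]
      rw [← div_eq_mul_inv]
      by_cases hxy : (x : k) = y
      · rw [hxy, div_self y.ne_zero, div_self (one_sub_inv_ne hy), div_self (one_sub_ne hy)]
        simp [ho]
      · exact h5 x y x.ne_zero hx y.ne_zero hy hxy
  let φ : PBloch k →+ A := (Submodule.liftQ _ g hle).toAddMonoidHom
  refine ⟨φ, fun x => ?_⟩
  by_cases hx : x = 0
  · subst hx; rw [pbf_BW.z, map_zero, hz]
  · rw [pbf, dif_neg hx]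
    have : φ (pb k (Units.mk0 x hx)) = g (Finsupp.single (Units.mk0 x hx) 1) := rfl
    exact this.trans (hg _)

end pbsec

section comb
set_option linter.unusedSectionVars false
variable {N : ℕ} [NeZero N]

/-- carry digit -/
def carry (x y : ZMod N) : ℕ := if N ≤ x.val + y.val then 1 else 0

theorem carry_spec (x y : ZMod N) : x.val + y.val = (x + y).val + carry x y * N := by
  unfold carry
  split_ifs with h
  · rw [one_mul]; exact ZMod.val_add_val_of_le h
  · rw [zero_mul, add_zero, ZMod.val_add_of_lt (not_le.mp h)]

theorem carry_cocycle (x y z : ZMod N) :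
    carry y z + carry x (y + z) = carry (x + y) z + carry x y := by
  have h1 := carry_spec y z
  have h2 := carry_spec x (y + z)
  have h3 := carry_spec (x + y) z
  have h4 := carry_spec x y
  have hN : 0 < N := Nat.pos_of_ne_zero (NeZero.ne N)
  have e : x + (y + z) = x + y + z := by ring
  rw [e] at h2
  apply Nat.eq_of_mul_eq_mul_right hN
  rw [add_mul, add_mul]
  omega

/-- standard cocycle -/
def std (a b c d : ZMod N) : ZMod N := carry (b - a) (c - b) • (d - c)

theorem std_cocycle (a b c d e : ZMod N) :
    std b c d e - std a c d e + std a b d e - std a b c e + std a b c d = 0 := by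
  have h := carry_cocycle (b - a) (c - b) (d - c)
  have h2 := congrArg (fun n : ℕ => (n : ZMod N)) h
  have e1 : c - b + (d - c) = d - b := by ring
  have e2 : b - a + (c - b) = c - a := by ring
  rw [e1, e2] at h2
  push_cast at h2
  unfold std
  simp only [nsmul_eq_mul]
  linear_combination (e - d) * h2

theorem std_trans (t a b c d : ZMod N) : std (a + t) (b + t) (c + t) (d + t) = std a b c d := by
  unfold std; simp only [add_sub_add_right_eq_sub]

theorem std_self (a c d : ZMod N) : std a a c d = 0 := by
  unfold std carry
  have : (c - a).val < N := ZMod.val_lt _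
  simp
  intro h; omega

theorem carry_neg (x y : ZMod N) (hx : x ≠ 0) (hy : y ≠ 0) (hxy : x + y ≠ 0) :
    carry (-x) (-y) + carry x y = 1 := by
  have h1 := carry_spec x y
  have h2 := carry_spec (-x) (-y)
  have e : -x + -y = -(x + y) := by ring
  rw [e] at h2
  have f1 := ZMod.neg_val x
  have f2 := ZMod.neg_val y
  have f3 := ZMod.neg_val (x + y)
  rw [if_neg hx] at f1
  rw [if_neg hy] at f2
  rw [if_neg hxy] at f3
  rw [f1, f2, f3] at h2
  have l1 := x.val_lt
  have l2 := y.val_lt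
  have l3 := (x + y).val_lt
  have hN : 0 < N := Nat.pos_of_ne_zero (NeZero.ne N)
  apply Nat.eq_of_mul_eq_mul_right hN
  rw [add_mul]
  omega

theorem std_neg (a b c d : ZMod N) (h1 : a ≠ b) (h2 : b ≠ c) (h3 : a ≠ c) :
    std (-a) (-b) (-c) (-d) = std a b c d - (d - c) := by
  have h := carry_neg (b - a) (c - b) (sub_ne_zero.mpr h1.symm) (sub_ne_zero.mpr h2.symm)
    (by rw [show b - a + (c - b) = c - a by ring]; exact sub_ne_zero.mpr h3.symm)
  have e1 : -b - -a = -(b - a) := by ring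
  have e2 : -c - -b = -(c - b) := by ring
  have h' := congrArg (fun n : ℕ => (n : ZMod N)) h
  push_cast at h'
  unfold std
  rw [e1, e2]
  simp only [nsmul_eq_mul]
  linear_combination (c - d) * h'

/-- reflection correction -/
def jj (a b c : ZMod N) : ZMod N :=
  if (c - b).val < (b - c).val ∨ ((c - b).val = (b - c).val ∧ (b - a).val < (a - b).val)
  then 0 else b - c

theorem jj_trans (t a b c : ZMod N) : jj (a + t) (b + t) (c + t) = jj a b c := by
  unfold jj; simp only [add_sub_add_right_eq_sub]

theorem jj_neg (a b c : ZMod N) (h1 : a ≠ b) (h2 : b ≠ c) (h3 : a ≠ c) :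
    jj (-a) (-b) (-c) = jj a b c + (c - b) := by
  have key : ¬ ((c - b).val = (b - c).val ∧ (b - a).val = (a - b).val) := by
    rintro ⟨u, v⟩
    have v' := ZMod.val_injective N v
    have f1 := ZMod.neg_val (c - b)
    have f2 := ZMod.neg_val (b - a)
    rw [if_neg (sub_ne_zero.mpr h2.symm), neg_sub] at f1
    rw [if_neg (sub_ne_zero.mpr h1.symm), neg_sub] at f2
    have l1 := (c - b).val_lt
    have l2 := (b - a).val_lt
    have w := ZMod.val_injective N (show (c - b).val = (b - a).val by omega)
    exact h3 (by linear_combination -v' - w)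
  unfold jj
  have e1 : -c - -b = b - c := by ring
  have e2 : -b - -c = c - b := by ring
  have e3 : -b - -a = a - b := by ring
  have e4 : -a - -b = b - a := by ring
  rw [e1, e2, e3, e4]
  by_cases hp : (c - b).val < (b - c).val ∨ ((c - b).val = (b - c).val ∧ (b - a).val < (a - b).val)
  · rw [if_pos hp, if_neg (by omega)]; ring
  · rw [if_neg hp, if_pos (by omega)]; ring

/-- reflection invariant cocycle -/
def stdp (a b c d : ZMod N) : ZMod N :=
  std a b c d + (jj b c d - jj a c d + jj a b d - jj a b c)

theorem stdp_cocycle (a b c d e : ZMod N) :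
    stdp b c d e - stdp a c d e + stdp a b d e - stdp a b c e + stdp a b c d = 0 := by
  unfold stdp
  linear_combination std_cocycle a b c d e

theorem stdp_trans (t a b c d : ZMod N) : stdp (a + t) (b + t) (c + t) (d + t) = stdp a b c d := by
  unfold stdp; simp only [jj_trans, std_trans]

theorem stdp_neg (a b c d : ZMod N) (h1 : a ≠ b) (h2 : b ≠ c) (h3 : a ≠ c)
    (h4 : a ≠ d) (h5 : b ≠ d) (h6 : c ≠ d) :
    stdp (-a) (-b) (-c) (-d) = stdp a b c d := by
  unfold stdp
  rw [std_neg a b c d h1 h2 h3, jj_neg b c d h2 h6 h5, jj_neg a c d h3 h6 h4,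
    jj_neg a b d h1 h5 h4, jj_neg a b c h1 h2 h3]
  ring

theorem sum_zmod_range {A : Type} [AddCommGroup A] (G : ZMod N → A) :
    ∑ m : ZMod N, G m = ∑ m ∈ Finset.range N, G (m : ZMod N) := by
  symm
  refine Finset.sum_bij' (fun m _ => (m : ZMod N)) (fun m _ => m.val) ?_ ?_ ?_ ?_ ?_
  · intros; exact Finset.mem_univ _
  · intro a _; exact Finset.mem_range.mpr a.val_lt
  · intro a ha; exact ZMod.val_cast_of_lt (Finset.mem_range.mp ha)
  · intro a _; exact ZMod.natCast_zmod_val a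
  · intros; rfl

theorem cocycle_std {A : Type} [AddCommGroup A] (g4 : ZMod N → ZMod N → ZMod N → ZMod N → A)
    (ti : ∀ t a b c d, g4 (a + t) (b + t) (c + t) (d + t) = g4 a b c d)
    (cc : ∀ a b c d e, g4 b c d e - g4 a c d e + g4 a b d e - g4 a b c e + g4 a b c d = 0)
    (dg : ∀ a c d, g4 a a c d = 0) :
    ∃ (κ : ZMod N →+ A) (h2 : ZMod N → ZMod N → A), ∀ a b c d,
      g4 a b c d = κ (std a b c d) -
        (h2 (c - b) (d - c) - h2 (c - a) (d - c) + h2 (b - a) (d - b) - h2 (b - a) (c - b)) := by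
  obtain ⟨φ, hφ⟩ : ∃ φ : ZMod N → ZMod N → ZMod N → A,
      ∀ i j k, φ i j k = g4 0 i (i + j) (i + j + k) := ⟨_, fun _ _ _ => rfl⟩
  have hg : ∀ a b c d, g4 a b c d = φ (b - a) (c - b) (d - c) := by
    intro a b c d
    rw [hφ, ← ti a 0 (b - a)]
    congr 1 <;> ring
  have rec1 : ∀ i k l, φ (i + 1) k l = φ i k l + (φ 1 (i + k) l - φ 1 i (k + l) + φ 1 i k) := by
    intro i k l
    have := cc 0 1 (1 + i) (1 + i + k) (1 + i + k + l)
    rw [hg 1, hg 0, hg 0, hg 0, hg 0] at this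
    rw [show 1 + i - 1 = i by ring, show 1 + i + k - (1 + i) = k by ring,
      show 1 + i + k + l - (1 + i + k) = l by ring, show 1 + i - 0 = i + 1 by ring,
      show (1 : ZMod N) - 0 = 1 by ring, show 1 + i + k - 1 = i + k by ring,
      show 1 + i + k + l - (1 + i) = k + l by ring] at this
    rw [← sub_eq_zero, ← neg_eq_zero, ← this]; abel
  have phi0 : ∀ k l, φ 0 k l = 0 := by
    intro k l; rw [hφ]; exact dg _ _ _
  obtain ⟨Φ, hΦ⟩ : ∃ Φ : ℕ → ZMod N → A,
      ∀ n k, Φ n k = ∑ m ∈ Finset.range n, φ 1 (m : ZMod N) k := ⟨_, fun _ _ => rfl⟩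
  obtain ⟨κ, hκ⟩ : ∃ κ : ZMod N → A, ∀ l, κ l = ∑ m : ZMod N, φ 1 m l := ⟨_, fun _ => rfl⟩
  have main : ∀ (n k' : ℕ) (k l : ZMod N), (k' : ZMod N) = k →
      φ (n : ZMod N) k l = Φ (k' + n) l - Φ k' l - Φ n (k + l) + Φ n k := by
    intro n k' k l hk
    induction n with
    | zero => simp [hΦ, phi0]
    | succ n ih =>
      have a1 : Φ (k' + (n + 1)) l = Φ (k' + n) l + φ 1 ((n : ZMod N) + k) l := by
        rw [hΦ, hΦ, ← add_assoc, Finset.sum_range_succ, Nat.cast_add, hk, add_comm k]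
      have a2 : ∀ l, Φ (n + 1) l = Φ n l + φ 1 (n : ZMod N) l := by
        intro l; rw [hΦ, hΦ, Finset.sum_range_succ]
      rw [Nat.cast_succ, rec1, ih, a1, a2, a2]; abel
  have per : ∀ n l, Φ (n + N) l = Φ n l + κ l := by
    intro n l
    rw [hΦ, hΦ, Finset.sum_range_add, hκ, sum_zmod_range]
    congr 1
    rw [← sum_zmod_range (fun m => φ 1 m l), ← Equiv.sum_comp (Equiv.addLeft (n : ZMod N)), sum_zmod_range]
    simp
  have kadd : ∀ k l, κ (k + l) = κ k + κ l := by
    intro k l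
    have m := main N k.val k l (ZMod.natCast_zmod_val k)
    have z : ∀ k, Φ N k = κ k := by intro k; have := per 0 k; simpa [hΦ] using this
    rw [ZMod.natCast_self, phi0, per, z, z] at m
    rw [← sub_eq_zero, ← neg_eq_zero, m]; abel
  refine ⟨AddMonoidHom.mk' κ kadd, fun x y => Φ x.val y, ?_⟩
  intro a b c d
  have m := main (b - a).val (c - b).val (c - b) (d - c) (ZMod.natCast_zmod_val _)
  rw [ZMod.natCast_zmod_val, ← hg] at m
  have cs := carry_spec (b - a) (c - b)
  rw [show b - a + (c - b) = c - a by ring] at cs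
  have e : ∀ n : ℕ, n ≤ 1 → (c - b).val + (b - a).val = (c - a).val + n * N →
      Φ ((c - b).val + (b - a).val) (d - c) = Φ (c - a).val (d - c) + n • κ (d - c) := by
    intro n hn h
    rw [h]
    interval_cases n
    · simp
    · rw [one_mul, per, one_smul]
  have hc1 : carry (b - a) (c - b) ≤ 1 := by unfold carry; split_ifs <;> omega
  rw [e _ hc1 (by rw [add_comm]; exact cs), show c - b + (d - c) = d - b by ring] at m
  rw [m, std, map_nsmul, AddMonoidHom.mk'_apply]
  abel

/-- the closed sum -/
def wsum (σ : ZMod N → ZMod N) : ZMod N :=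
  ∑ m, std (σ 0) (σ 1) (σ (1 + m)) (σ (1 + m + 1))

theorem wsum_avg (σ : ZMod N → ZMod N) : ∑ s : ZMod N, wsum (fun i => σ (i - s)) = 0 := by
  have h1 : ∀ s, wsum (fun i => σ (i - s)) =
      ∑ j, carry (σ (1 - s) - σ (-s)) (σ j - σ (1 - s)) • (σ (j + 1) - σ j) := by
    intro s
    unfold wsum
    rw [← Equiv.sum_comp (Equiv.addRight (1 - s)) (fun j => carry (σ (1 - s) - σ (-s)) (σ j - σ (1 - s)) • (σ (j + 1) - σ j))]
    apply Finset.sum_congr rfl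
    intro m _
    simp only [Equiv.coe_addRight, std]
    rw [show (1 : ZMod N) + m - s = m + (1 - s) by ring,
      show (1 : ZMod N) + m + 1 - s = m + (1 - s) + 1 by ring, zero_sub]
  simp only [h1]
  rw [Finset.sum_comm]
  have hN : 0 < N := Nat.pos_of_ne_zero (NeZero.ne N)
  have h2 : ∀ j, (∑ s, carry (σ (1 - s) - σ (-s)) (σ j - σ (1 - s))) * N =
      ∑ s, (σ (1 - s) - σ (-s)).val := by
    intro j
    have e : ∑ s, (σ j - σ (1 - s)).val = ∑ s, (σ j - σ (-s)).val := by
      rw [← Equiv.sum_comp (Equiv.addRight (1 : ZMod N))]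
      apply Finset.sum_congr rfl
      intro s _
      simp only [Equiv.coe_addRight]
      rw [show (1 : ZMod N) - (s + 1) = -s by ring]
    have e2 : ∑ s, ((σ (1 - s) - σ (-s)).val + (σ j - σ (1 - s)).val) =
        ∑ s, ((σ j - σ (-s)).val + carry (σ (1 - s) - σ (-s)) (σ j - σ (1 - s)) * N) := by
      apply Finset.sum_congr rfl
      intro s _
      have := carry_spec (σ (1 - s) - σ (-s)) (σ j - σ (1 - s))
      rwa [show σ (1 - s) - σ (-s) + (σ j - σ (1 - s)) = σ j - σ (-s) by ring] at this
    rw [Finset.sum_add_distrib, Finset.sum_add_distrib, e, ← Finset.sum_mul] at e2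
    omega
  have h3 : ∀ j, ∑ s, carry (σ (1 - s) - σ (-s)) (σ j - σ (1 - s)) =
      ∑ s, carry (σ (1 - s) - σ (-s)) (σ 0 - σ (1 - s)) := fun j =>
    Nat.eq_of_mul_eq_mul_right hN ((h2 j).trans (h2 0).symm)
  simp only [← Finset.sum_smul, h3]
  rw [← Finset.smul_sum, Finset.sum_sub_distrib]
  have := Equiv.sum_comp (Equiv.addRight (1 : ZMod N)) σ
  simp only [Equiv.coe_addRight] at this
  rw [this, sub_self, smul_zero]

theorem wsum_id (hN : 2 ≤ N) (c : ZMod N) : wsum (fun i => i + c) = 1 := by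
  have : Fact (1 < N) := ⟨hN⟩
  unfold wsum
  simp only [std_trans]
  have : ∀ m : ZMod N, std 0 1 (1 + m) (1 + m + 1) = if m = -1 then 1 else 0 := by
    intro m
    unfold std carry
    rw [sub_zero, show 1 + m - 1 = m by ring, show 1 + m + 1 - (1 + m) = 1 by ring, ZMod.val_one]
    have h1 := m.val_lt
    have h2 : m = -1 ↔ N ≤ 1 + m.val := by
      rw [← (ZMod.val_injective N).eq_iff, ZMod.neg_val, if_neg one_ne_zero, ZMod.val_one]
      omega
    simp only [h2]
    split_ifs <;> simp
  simp [this]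

theorem wsum_neg (hN : 2 ≤ N) (c : ZMod N) : wsum (fun i => -i + c) = 1 := by
  have : Fact (1 < N) := ⟨hN⟩
  unfold wsum
  simp only [std_trans]
  have : ∀ m : ZMod N, std (-0) (-1) (-(1 + m)) (-(1 + m + 1)) = if m = 0 then 0 else -1 := by
    intro m
    unfold std carry
    rw [show (-1 : ZMod N) - -0 = -1 by ring, show -(1 + m) - -1 = -m by ring,
      show -(1 + m + 1) - -(1 + m) = -1 by ring, ZMod.neg_val 1, if_neg one_ne_zero, ZMod.val_one,
      ZMod.neg_val]
    have h1 := m.val_lt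
    by_cases hm : m = 0
    · simp [hm]; omega
    · simp only [hm, if_false]
      rw [if_pos (by omega), one_smul]
  simp only [this]
  rw [Finset.sum_ite]
  simp [Finset.filter_ne']
  rw [Nat.cast_sub (by omega)]; simp

end comb

set_option linter.unusedSimpArgs false
set_option linter.unusedVariables false

section corrsec
variable {I A : Type} [AddCommGroup A]

/-- correction term on degenerate tuples -/
noncomputable def corr (D : A) (i j k l : I) : A :=
  if i = l ∧ i ≠ j ∧ i ≠ k ∧ j ≠ k then D
  else if i = k ∧ i ≠ j ∧ i ≠ l ∧ j ≠ l then -D else 0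

theorem corr_cocycle (D : A) (D3 : D + D + D = 0) (f : I → I → I → I → A)
    (h01 : ∀ a c d, f a a c d = 0) (h02 : ∀ a b d, f a b a d = 0) (h03 : ∀ a b c, f a b c a = 0)
    (h12 : ∀ a b d, f a b b d = 0) (h13 : ∀ a b c, f a b c b = 0) (h23 : ∀ a b c, f a b c c = 0)
    (s1 : ∀ a b c d, f b a c d = - f a b c d) (s3 : ∀ a b c d, f a b d c = - f a b c d)
    (s2 : ∀ a b c d, a ≠ b → a ≠ c → a ≠ d → b ≠ c → b ≠ d → c ≠ d →
      f a c b d = - D - f a b c d)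
    (hc : ∀ a b c d e, a ≠ b → a ≠ c → a ≠ d → a ≠ e → b ≠ c → b ≠ d → b ≠ e → c ≠ d → c ≠ e →
      d ≠ e → f b c d e - f a c d e + f a b d e - f a b c e + f a b c d = 0)
    (a b c d e : I) :
    (f b c d e + corr D b c d e) - (f a c d e + corr D a c d e) + (f a b d e + corr D a b d e)
      - (f a b c e + corr D a b c e) + (f a b c d + corr D a b c d) = 0 := by
  by_cases q01 : a = b
  · subst q01; simp [corr, h01]
  by_cases q12 : b = c
  · subst q12; simp [corr, h12, h01]; grind
  by_cases q23 : c = d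
  · subst q23; simp [corr, h12, h23]; grind
  by_cases q34 : d = e
  · subst q34; simp [corr, h23]; grind
  have p01 := Ne.symm q01
  have p12 := Ne.symm q12
  have p23 := Ne.symm q23
  have p34 := Ne.symm q34
  by_cases q02 : a = c
  · subst q02
    rw [s1 a b d e]
    by_cases q13 : b = d
    · subst q13
      by_cases q04 : a = e
      · subst q04; simp [corr, h01, h02, *]
      have p04 := Ne.symm q04
      simp [corr, h01, h02, h12, q01, q04, p04, p01, q12, p12, q34, p34]
    have p13 := Ne.symm q13
    by_cases q04 : a = e
    · subst q04
      simp [corr, h01, h02, q01, p01, q13, p13, q23, p23]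
    have p04 := Ne.symm q04
    by_cases q14 : b = e
    · subst q14
      simp [corr, h01, h02, h13, q01, p01, q13, p13, q23, p23, q34, p34]
    have p14 := Ne.symm q14
    simp [corr, h01, h02, q01, p01, q13, p13, q23, p23, q34, p34, q04, p04, q14, p14]
  have p02 := Ne.symm q02
  by_cases q13 : b = d
  · subst q13
    by_cases q03 : a = e
    · subst q03; simp [corr, h02, h12, h13, h03, q01, p01, q12, p12, q02, p02]
      linear_combination (norm := module) -D3
    have p03 := Ne.symm q03
    by_cases q04 : c = e
    · subst q04; simp [corr, h02, h12, h13, h03, h23, q01, p01, q12, p12, q02, p02]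
    have p04 := Ne.symm q04
    rw [s2 a b c e q01 q02 q03 q12 q34 q04]
    simp [corr, h02, h12, h13, q01, p01, q12, p12, q02, p02, q03, p03, q04, p04, q34, p34]
  have p13 := Ne.symm q13
  by_cases q24 : c = e
  · subst q24
    by_cases q03 : a = d
    · subst q03
      simp [corr, h02, h12, h13, h03, h23, q01, p01, q12, p12, q02, p02]
    have p03 := Ne.symm q03
    rw [s3 a b c d]
    simp [corr, h13, h23, q01, p01, q12, p12, q02, p02, q03, p03, q13, p13, q23, p23]
  have p24 := Ne.symm q24
  by_cases q03 : a = d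
  · subst q03
    by_cases q14 : b = e
    · subst q14; simp [corr, h02, h03, h12, h13, q01, p01, q12, p12, q02, p02]
      linear_combination (norm := module) D3
    have p14 := Ne.symm q14
    rw [s2 b a c e p01 q12 q14 q02 q34 q24, s1 a b c e]
    simp [corr, h02, h03, q01, p01, q12, p12, q02, p02, q24, p24, q34, p34, q14, p14]
  have p03 := Ne.symm q03
  by_cases q14 : b = e
  · subst q14
    rw [s3 a c b d, s2 a b c d q01 q02 q03 q12 q13 q23]
    simp [corr, h03, h13, q01, p01, q12, p12, q02, p02, q24, p24, q34, p34, q03, p03, q13, p13, q23, p23]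
  have p14 := Ne.symm q14
  by_cases q04 : a = e
  · subst q04
    rw [s3 b c a d, s2 b a c d p01 q12 q13 q02 q03 q23, s1 a b c d]
    simp [corr, h03, q01, p01, q12, p12, q02, p02, q24, p24, q34, p34, q03, p03, q13, p13, q23, p23]
  have p04 := Ne.symm q04
  have := hc a b c d e q01 q02 q03 q04 q12 q13 q14 q23 q24 q34
  simpa [corr, q01, q02, q03, q04, q12, q13, q14, q23, q24, q34] using this
end corrsec

structure Stp (F K : Type) [Field F] [Field K] [Algebra F K] (N : ℕ) where
  e : K
  X : K →ₗ[F] F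
  Y : K →ₗ[F] F
  coord : ∀ u, u = X u • e + Y u • (1 : K)
  Xe : X e = 1
  Ye : Y e = 0
  X1 : X 1 = 0
  Y1 : Y 1 = 1
  bar : K →ₐ[F] K
  bar_bar : ∀ u, bar (bar u) = u
  bar_fix : ∀ u, bar u = u → X u = 0
  th : K → ZMod N
  th_mul : ∀ u v, u ≠ 0 → v ≠ 0 → th (u * v) = th u + th v
  th_bar : ∀ u, u ≠ 0 → th (bar u) = - th u
  th_surj : ∀ i, ∃ u, u ≠ 0 ∧ th u = i
  th_w : ∀ u v, u ≠ 0 → v ≠ 0 → (th u = th v ↔ X u * Y v - Y u * X v = 0)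

namespace Stp
variable {F K : Type} [Field F] [Field K] [Algebra F K] {N : ℕ} (S : Stp F K N)

def w (u v : K) : F := S.X u * S.Y v - S.Y u * S.X v
def lc (a b u : K) : K := S.X u • a + S.Y u • b
def cr (a b c d : K) : F := S.w a d * S.w b c / (S.w a c * S.w b d)

theorem ext {u v : K} (h1 : S.X u = S.X v) (h2 : S.Y u = S.Y v) : u = v := by
  rw [S.coord u, S.coord v, h1, h2]

theorem w_lc (a b u v : K) : S.w (S.lc a b u) (S.lc a b v) = S.w a b * S.w u v := by
  simp [w, lc]; ring

theorem w_smul_left (t : F) (u v : K) : S.w (t • u) v = t * S.w u v := by simp [w]; ring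
theorem w_smul_right (t : F) (u v : K) : S.w u (t • v) = t * S.w u v := by simp [w]; ring
theorem w_self (u : K) : S.w u u = 0 := by simp [w]; ring
theorem w_swap (u v : K) : S.w v u = - S.w u v := by simp [w]; ring
theorem w_swap_ne {u v : K} (h : S.w u v ≠ 0) : S.w v u ≠ 0 := by rw [S.w_swap]; simpa using h
theorem ne_left {u v : K} (h : S.w u v ≠ 0) : u ≠ 0 := by rintro rfl; simp [w] at h
theorem ne_right {u v : K} (h : S.w u v ≠ 0) : v ≠ 0 := by rintro rfl; simp [w] at h
theorem plucker (a b c d : K) :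
    S.w a b * S.w c d - S.w a c * S.w b d + S.w a d * S.w b c = 0 := by simp [w]; ring
theorem th_w' {u v : K} (hu : u ≠ 0) (hv : v ≠ 0) : S.th u = S.th v ↔ S.w u v = 0 :=
  S.th_w u v hu hv

theorem th_smul (t : F) (ht : t ≠ 0) (u : K) (hu : u ≠ 0) : S.th (t • u) = S.th u := by
  rw [S.th_w' (smul_ne_zero ht hu) hu, w_smul_left, w_self, mul_zero]

theorem lc_e (a b : K) : S.lc a b S.e = a := by simp [lc, S.Xe, S.Ye]
theorem lc_1 (a b : K) : S.lc a b 1 = b := by simp [lc, S.X1, S.Y1]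
theorem lc_add (a b u v : K) : S.lc a b (u + v) = S.lc a b u + S.lc a b v := by
  simp [lc, add_smul]; abel
theorem lc_smul (a b : K) (t : F) (u : K) : S.lc a b (t • u) = t • S.lc a b u := by
  simp [lc, smul_add, smul_smul]

theorem cramer (a b c : K) (h : S.w a b ≠ 0) :
    c = (S.w c b / S.w a b) • a + (S.w a c / S.w a b) • b := by
  apply S.ext <;> simp <;> field_simp <;> simp [w] <;> ring

theorem exists_smul {u v : K} (hu : u ≠ 0) (hv : v ≠ 0) (h : S.th u = S.th v) :
    ∃ t : F, t ≠ 0 ∧ u = t • v := by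
  rw [S.th_w' hu hv] at h
  have hw : S.X u * S.Y v - S.Y u * S.X v = 0 := h
  have key : ∃ t : F, u = t • v := by
    by_cases hx : S.X v = 0
    · have hy : S.Y v ≠ 0 := by
        intro hy; apply hv; rw [S.coord v, hx, hy]; simp
      have hxu : S.X u = 0 := by
        rw [hx] at hw; simpa [hy] using hw
      refine ⟨S.Y u / S.Y v, S.ext ?_ ?_⟩
      · simp [hx, hxu]
      · simp [hy]
    · refine ⟨S.X u / S.X v, S.ext ?_ ?_⟩
      · simp [hx]
      · simp; field_simp; linear_combination -hw
  obtain ⟨t, ht⟩ := key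
  refine ⟨t, ?_, ht⟩
  rintro rfl
  exact hu (by simpa using ht)

theorem cr_lc (a b u0 u1 u2 u3 : K) (h : S.w a b ≠ 0) :
    S.cr (S.lc a b u0) (S.lc a b u1) (S.lc a b u2) (S.lc a b u3) = S.cr u0 u1 u2 u3 := by
  simp only [cr, w_lc]
  rw [show S.w a b * S.w u0 u3 * (S.w a b * S.w u1 u2) =
      (S.w a b * S.w a b) * (S.w u0 u3 * S.w u1 u2) by ring,
    show S.w a b * S.w u0 u2 * (S.w a b * S.w u1 u3) =
      (S.w a b * S.w a b) * (S.w u0 u2 * S.w u1 u3) by ring,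
    mul_div_mul_left _ _ (mul_ne_zero h h)]

theorem cr_smul (t0 t1 t2 t3 : F) (h0 : t0 ≠ 0) (h1 : t1 ≠ 0) (h2 : t2 ≠ 0) (h3 : t3 ≠ 0)
    (u0 u1 u2 u3 : K) :
    S.cr (t0 • u0) (t1 • u1) (t2 • u2) (t3 • u3) = S.cr u0 u1 u2 u3 := by
  simp only [cr, w_smul_left, w_smul_right]
  rw [show t3 * (t0 * S.w u0 u3) * (t2 * (t1 * S.w u1 u2)) =
      (t0 * t1 * t2 * t3) * (S.w u0 u3 * S.w u1 u2) by ring,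
    show t2 * (t0 * S.w u0 u2) * (t3 * (t1 * S.w u1 u3)) =
      (t0 * t1 * t2 * t3) * (S.w u0 u2 * S.w u1 u3) by ring,
    mul_div_mul_left _ _ (mul_ne_zero (mul_ne_zero (mul_ne_zero h0 h1) h2) h3)]

theorem one_sub_cr (a b c d : K) (h1 : S.w a c ≠ 0) (h2 : S.w b d ≠ 0) :
    1 - S.cr a b c d = S.w a b * S.w c d / (S.w a c * S.w b d) := by
  rw [cr]; field_simp; linear_combination - S.plucker a b c d

theorem cr_std (x : F) : S.cr S.e 1 (S.e + 1) (S.e + x • (1 : K)) = x := by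
  simp [cr, w, S.Xe, S.Ye, S.X1, S.Y1]

theorem cr_five (a b c d e : K) (ab : S.w a b ≠ 0) (ac : S.w a c ≠ 0) (ad : S.w a d ≠ 0)
    (ae : S.w a e ≠ 0) (bc : S.w b c ≠ 0) (bd : S.w b d ≠ 0) (be : S.w b e ≠ 0)
    (cd : S.w c d ≠ 0) (ce : S.w c e ≠ 0) :
    S.cr a b c e / S.cr a b c d = S.cr a b d e ∧
    (1 - (S.cr a b c d)⁻¹) / (1 - (S.cr a b c e)⁻¹) = S.cr a c d e ∧
    (1 - S.cr a b c d) / (1 - S.cr a b c e) = S.cr b c d e := by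
  have i : ∀ x : F, x ≠ 0 → 1 - x⁻¹ = - (1 - x) / x := fun x hx => by field_simp; ring
  have n1 : S.cr a b c d ≠ 0 := by rw [cr]; positivity
  have n2 : S.cr a b c e ≠ 0 := by rw [cr]; positivity
  refine ⟨?_, ?_, ?_⟩
  · simp only [cr]; field_simp
  · rw [i _ n1, i _ n2, one_sub_cr _ _ _ _ _ ac bd, one_sub_cr _ _ _ _ _ ac be]
    simp only [cr]; field_simp
  · rw [one_sub_cr _ _ _ _ _ ac bd, one_sub_cr _ _ _ _ _ ac be]
    simp only [cr]; field_simp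

/-- normal form of a nondegenerate quadruple -/
theorem normal4 (u0 u1 u2 u3 : K) (h01 : S.w u0 u1 ≠ 0) (h02 : S.w u0 u2 ≠ 0)
    (h12 : S.w u1 u2 ≠ 0) (h13 : S.w u1 u3 ≠ 0) :
    ∃ (a b : K) (t0 t1 t3 : F), S.w a b ≠ 0 ∧ t0 ≠ 0 ∧ t1 ≠ 0 ∧ t3 ≠ 0 ∧
      u0 = t0 • S.lc a b S.e ∧ u1 = t1 • S.lc a b 1 ∧ u2 = S.lc a b (S.e + 1) ∧
      u3 = t3 • S.lc a b (S.e + S.cr u0 u1 u2 u3 • (1 : K)) := by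
  have e2 := S.cramer u0 u1 u2 h01
  have e3 := S.cramer u0 u1 u3 h01
  have h21 : S.w u2 u1 = - S.w u1 u2 := S.w_swap _ _
  have h31 : S.w u3 u1 = - S.w u1 u3 := S.w_swap _ _
  rw [h21] at e2
  rw [h31] at e3
  refine ⟨(-S.w u1 u2 / S.w u0 u1) • u0, (S.w u0 u2 / S.w u0 u1) • u1,
    (-S.w u1 u2 / S.w u0 u1)⁻¹, (S.w u0 u2 / S.w u0 u1)⁻¹, S.w u1 u3 / S.w u1 u2,
    ?_, ?_, ?_, ?_, ?_, ?_, ?_, ?_⟩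
  · rw [w_smul_left, w_smul_right]
    refine mul_ne_zero (div_ne_zero (neg_ne_zero.mpr h12) h01) (mul_ne_zero (div_ne_zero h02 h01) h01)
  · exact inv_ne_zero (div_ne_zero (neg_ne_zero.mpr h12) h01)
  · exact inv_ne_zero (div_ne_zero h02 h01)
  · exact div_ne_zero h13 h12
  · rw [lc_e, smul_smul, inv_mul_cancel₀ (div_ne_zero (neg_ne_zero.mpr h12) h01), one_smul]
  · rw [lc_1, smul_smul, inv_mul_cancel₀ (div_ne_zero h02 h01), one_smul]
  · rw [lc_add, lc_e, lc_1]; exact e2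
  · rw [lc_add, lc_smul, lc_e, lc_1, smul_add, smul_smul, smul_smul, smul_smul]
    conv_lhs => rw [e3]
    congr 2
    · field_simp
    · rw [cr]; field_simp

end Stp

namespace Stp
variable {F K : Type} [Field F] [Field K] [Algebra F K] {N : ℕ} (S : Stp F K N)
variable {A : Type} [AddCommGroup A]

/-- pairwise independence of four vectors -/
structure ND (a b c d : K) : Prop where
  ab : S.w a b ≠ 0
  ac : S.w a c ≠ 0
  ad : S.w a d ≠ 0
  bc : S.w b c ≠ 0
  bd : S.w b d ≠ 0
  cd : S.w c d ≠ 0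

theorem nd_std (x : F) (x0 : x ≠ 0) (x1 : x ≠ 1) : S.ND S.e 1 (S.e + 1) (S.e + x • (1 : K)) := by
  constructor <;> simp [w, S.Xe, S.Ye, S.X1, S.Y1, x0, sub_eq_zero, x1]

theorem gen_lift (f4 : K → K → K → K → A)
    (inv : ∀ a b u0 u1 u2 u3, S.w a b ≠ 0 → S.ND u0 u1 u2 u3 →
      f4 (S.lc a b u0) (S.lc a b u1) (S.lc a b u2) (S.lc a b u3) = f4 u0 u1 u2 u3)
    (sc : ∀ (t0 t1 t3 : F) u0 u1 u2 u3, t0 ≠ 0 → t1 ≠ 0 → t3 ≠ 0 → S.ND u0 u1 u2 u3 →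
      f4 (t0 • u0) (t1 • u1) u2 (t3 • u3) = f4 u0 u1 u2 u3)
    (coc : ∀ a b c d e, S.ND a b c d → S.ND a b c e → S.ND a b d e → S.ND a c d e → S.ND b c d e →
      f4 b c d e - f4 a c d e + f4 a b d e - f4 a b c e + f4 a b c d = 0) :
    ∃ φ : PBloch F →+ A, ∀ a b c d, S.ND a b c d → φ (pbf (S.cr a b c d)) = f4 a b c d := by
  obtain ⟨f, hf⟩ : ∃ f : F → A, f = fun x => if x = 0 ∨ x = 1 then 0 else
    f4 S.e 1 (S.e + 1) (S.e + x • (1 : K)) := ⟨_, rfl⟩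
  have key : ∀ a b c d, S.ND a b c d → f (S.cr a b c d) = f4 a b c d := by
    intro u0 u1 u2 u3 h
    have c0 : S.cr u0 u1 u2 u3 ≠ 0 :=
      div_ne_zero (mul_ne_zero h.ad h.bc) (mul_ne_zero h.ac h.bd)
    have c1 : S.cr u0 u1 u2 u3 ≠ 1 := by
      intro e
      have := S.one_sub_cr u0 u1 u2 u3 h.ac h.bd
      rw [e, sub_self] at this
      exact div_ne_zero (mul_ne_zero h.ab h.cd) (mul_ne_zero h.ac h.bd) this.symm
    obtain ⟨a, b, t0, t1, t3, hw, z0, z1, z3, e0, e1, e2, e3⟩ :=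
      S.normal4 u0 u1 u2 u3 h.ab h.ac h.bc h.bd
    have n := S.nd_std _ c0 c1
    have n' : S.ND (S.lc a b S.e) (S.lc a b 1) (S.lc a b (S.e + 1))
        (S.lc a b (S.e + S.cr u0 u1 u2 u3 • (1 : K))) := by
      constructor <;> rw [w_lc] <;> apply mul_ne_zero hw
      exacts [n.ab, n.ac, n.ad, n.bc, n.bd, n.cd]
    rw [hf]; simp only [c0, c1, or_self, if_false]
    rw [← inv a b _ _ _ _ hw n, ← sc t0 t1 t3 _ _ _ _ z0 z1 z3 n', ← e0, ← e1, ← e2, ← e3]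
  obtain ⟨φ, hφ⟩ := pbf_lift (k := F) f (by simp [hf]) (by simp [hf]) (by
    intro x y x0 x1 y0 y1 xy
    have n1 := S.nd_std x x0 x1
    have n2 := S.nd_std y y0 y1
    have hd : S.w (S.e + x • (1 : K)) (S.e + y • (1 : K)) ≠ 0 := by
      simp [w, S.Xe, S.Ye, S.X1, S.Y1, sub_eq_zero, Ne.symm xy]
    have h0 := S.cr_five S.e 1 (S.e + 1) (S.e + x • (1 : K)) (S.e + y • (1 : K)) n1.ab n1.ac
      n1.ad n2.ad n1.bc n1.bd n2.bd n1.cd n2.cd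
    rw [cr_std, cr_std] at h0
    obtain ⟨r1, r2, r3⟩ := h0
    have m3 : S.ND S.e 1 (S.e + x • (1 : K)) (S.e + y • (1 : K)) :=
      ⟨n1.ab, n1.ad, n2.ad, n1.bd, n2.bd, hd⟩
    have m4 : S.ND S.e (S.e + 1) (S.e + x • (1 : K)) (S.e + y • (1 : K)) :=
      ⟨n1.ac, n1.ad, n2.ad, n1.cd, n2.cd, hd⟩
    have m5 : S.ND 1 (S.e + 1) (S.e + x • (1 : K)) (S.e + y • (1 : K)) :=
      ⟨n1.bc, n1.bd, n2.bd, n1.cd, n2.cd, hd⟩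
    have k := coc _ _ _ _ _ n1 n2 m3 m4 m5
    rw [r1, r2, r3, key _ _ _ _ m3, key _ _ _ _ m4, key _ _ _ _ m5]
    have k1 := key _ _ _ _ n1
    have k2 := key _ _ _ _ n2
    rw [cr_std] at k1 k2
    rw [k1, k2, ← k]; abel)
  exact ⟨φ, fun a b c d h => by rw [hφ, key a b c d h]⟩

/-- the model of the upper half plane -/
def H : Type := {τ : K // S.X τ ≠ 0}

noncomputable instance [Fintype K] : Fintype S.H := by unfold H; infer_instance

variable {S}
noncomputable def L (τ : S.H) (u : K) : ZMod N := S.th (S.lc τ.1 1 u)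

theorem w_tau (τ : S.H) (u v : K) : S.w (S.lc τ.1 1 u) (S.lc τ.1 1 v) = S.X τ.1 * S.w u v := by
  rw [w_lc]; congr 1; simp [w, S.X1, S.Y1]

theorem lc_tau_ne (τ : S.H) {u : K} (hu : u ≠ 0) : S.lc τ.1 1 u ≠ 0 := by
  intro h
  apply hu
  have h1 := congrArg S.X h
  have h2 := congrArg S.Y h
  simp [lc, S.X1, S.Y1, τ.2] at h1 h2
  rw [S.coord u, h1]; rw [h1] at h2; simp at h2; simp [h2]

theorem L_smul (τ : S.H) (t : F) (ht : t ≠ 0) {u : K} (hu : u ≠ 0) : L τ (t • u) = L τ u := by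
  rw [L, lc_smul, S.th_smul t ht _ (lc_tau_ne τ hu), L]

theorem L_ne (τ : S.H) {u v : K} (h : S.w u v ≠ 0) : L τ u ≠ L τ v := by
  rw [L, L, Ne, S.th_w' (lc_tau_ne τ (S.ne_left h)) (lc_tau_ne τ (S.ne_right h)), w_tau]
  exact mul_ne_zero τ.2 h

theorem L_congr (τ : S.H) {u v : K} (hu : u ≠ 0) (hv : v ≠ 0) (h : S.th u = S.th v) :
    L τ u = L τ v := by
  obtain ⟨t, ht, rfl⟩ := S.exists_smul hu hv h
  exact L_smul τ t ht hv

noncomputable def E (a b : K) (h : S.w a b ≠ 0) (τ : S.H) : S.H :=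
  ⟨S.lc τ.1 1 a / S.lc τ.1 1 b, by
    have hb := lc_tau_ne τ (S.ne_right h)
    intro h0
    have h1 := S.coord (S.lc τ.1 1 a / S.lc τ.1 1 b)
    rw [h0, zero_smul, zero_add, div_eq_iff hb, smul_mul_assoc, one_mul, ← lc_smul] at h1
    have h2 := w_tau τ a b
    rw [h1, w_tau, w_smul_left, w_self] at h2
    have := mul_ne_zero τ.2 h
    rw [← h2] at this; simp at this⟩

theorem E_mul (a b : K) (h : S.w a b ≠ 0) (τ : S.H) (u : K) :
    S.lc τ.1 1 (S.lc a b u) = S.lc τ.1 1 b * S.lc (E a b h τ).1 1 u := by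
  have hb := lc_tau_ne τ (S.ne_right h)
  have h1 : S.lc τ.1 1 (S.lc a b u) = S.X u • S.lc τ.1 1 a + S.Y u • S.lc τ.1 1 b := by
    conv_lhs => rw [show S.lc a b u = S.X u • a + S.Y u • b from rfl]
    rw [lc_add, lc_smul, lc_smul]
  have h2 : S.lc (E a b h τ).1 1 u = S.X u • (S.lc τ.1 1 a / S.lc τ.1 1 b) + S.Y u • (1 : K) := rfl
  rw [h1, h2, mul_add, mul_smul_comm, mul_smul_comm, mul_one, mul_div_cancel₀ _ hb]

theorem L_E (a b : K) (h : S.w a b ≠ 0) (τ : S.H) (u : K) (hu : u ≠ 0) :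
    L τ (S.lc a b u) = L (E a b h τ) u + L τ b := by
  rw [L, E_mul a b h, S.th_mul _ _ (lc_tau_ne τ (S.ne_right h)) (lc_tau_ne _ hu), add_comm]; rfl

theorem E_inj (a b : K) (h : S.w a b ≠ 0) : Function.Injective (E a b h) := by
  intro τ σ hh
  have h1 : S.lc τ.1 1 a / S.lc τ.1 1 b = S.lc σ.1 1 a / S.lc σ.1 1 b := congrArg Subtype.val hh
  rw [div_eq_div_iff (lc_tau_ne τ (S.ne_right h)) (lc_tau_ne σ (S.ne_right h))] at h1
  have h2 : algebraMap F K (S.w a b) * (τ.1 - σ.1) = 0 := by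
    simp only [lc, w, Algebra.smul_def, map_sub, map_mul] at h1 ⊢
    linear_combination h1
  have h3 : algebraMap F K (S.w a b) ≠ 0 := by simpa using h
  exact Subtype.ext (sub_eq_zero.mp ((mul_eq_zero.mp h2).resolve_left h3))

theorem E_bij [Fintype K] (a b : K) (h : S.w a b ≠ 0) : Function.Bijective (E a b h) :=
  Finite.injective_iff_bijective.mp (E_inj a b h)

def barH (τ : S.H) : S.H := ⟨S.bar τ.1, by
  intro h
  apply τ.2
  have h1 := S.coord (S.bar τ.1)
  rw [h, zero_smul, zero_add] at h1
  have h2 : S.bar (S.bar τ.1) = S.bar τ.1 := by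
    conv_lhs => rw [h1]
    rw [map_smul, map_one]; exact h1.symm
  rw [S.bar_bar] at h2
  exact S.bar_fix _ h2.symm⟩

theorem barH_barH (τ : S.H) : barH (barH τ) = τ := Subtype.ext (S.bar_bar _)
theorem barH_ne (τ : S.H) : barH τ ≠ τ := fun h => τ.2 (S.bar_fix _ (congrArg Subtype.val h))

theorem lc_bar (τ : S.H) (u : K) : S.lc (barH τ).1 1 u = S.bar (S.lc τ.1 1 u) := by
  simp [lc, barH]

theorem L_bar (τ : S.H) (u : K) (hu : u ≠ 0) : L (barH τ) u = - L τ u := by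
  rw [L, lc_bar, S.th_bar _ (lc_tau_ne τ hu)]; rfl

theorem E_bar (a b : K) (h : S.w a b ≠ 0) (τ : S.H) : E a b h (barH τ) = barH (E a b h τ) := by
  apply Subtype.ext
  change S.lc (barH τ).1 1 a / S.lc (barH τ).1 1 b = S.bar (S.lc τ.1 1 a / S.lc τ.1 1 b)
  rw [lc_bar, lc_bar, map_div₀]

end Stp

namespace Stp
variable {F K : Type} [Field F] [Field K] [Algebra F K] {N : ℕ} (S : Stp F K N)
variable {A : Type} [AddCommGroup A]

theorem ND.ne {S : Stp F K N} {a b c d : K} (h : S.ND a b c d) :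
    a ≠ 0 ∧ b ≠ 0 ∧ c ≠ 0 ∧ d ≠ 0 :=
  ⟨S.ne_left h.ab, S.ne_left h.bc, S.ne_left h.cd, S.ne_right h.cd⟩

def barSetoid : Setoid S.H where
  r τ σ := σ = τ ∨ σ = barH τ
  iseqv := by
    refine ⟨fun τ => Or.inl rfl, ?_, ?_⟩
    · rintro τ σ (rfl | rfl)
      · exact Or.inl rfl
      · right; rw [barH_barH]
    · rintro τ σ ρ (rfl | rfl) (rfl | rfl)
      · exact Or.inl rfl
      · exact Or.inr rfl
      · exact Or.inr rfl
      · left; rw [barH_barH]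

def Hq : Type := Quotient S.barSetoid

variable [Fintype K]

noncomputable instance : Fintype S.Hq := by unfold Hq; exact Quotient.fintype _

variable {S}
noncomputable def half (k : S.H → A) : A := ∑ q : S.Hq, k (Quotient.out q)

theorem out_bar (τ : S.H) : Quotient.out (Quotient.mk S.barSetoid τ) = τ ∨
    Quotient.out (Quotient.mk S.barSetoid τ) = barH τ := by
  have : S.barSetoid τ (Quotient.out (Quotient.mk S.barSetoid τ)) :=
    S.barSetoid.symm (Quotient.mk_out τ)
  exact this

theorem k_out (k : S.H → A) (hk : ∀ τ, k (barH τ) = k τ) (τ : S.H) :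
    k (Quotient.out (Quotient.mk S.barSetoid τ)) = k τ := by
  rcases out_bar τ with h | h
  · rw [h]
  · rw [h, hk]

theorem half_E (k : S.H → A) (hk : ∀ τ, k (barH τ) = k τ) (a b : K) (h : S.w a b ≠ 0) :
    half (fun τ => k (E a b h τ)) = half k := by
  let Eq' : S.Hq → S.Hq := Quotient.map (sa := S.barSetoid) (sb := S.barSetoid) (E a b h) (by
    rintro τ σ (rfl | rfl)
    · exact Or.inl rfl
    · exact Or.inr (E_bar a b h τ))
  have inj : Function.Injective Eq' := by
    intro q r
    induction q using Quotient.inductionOn with | _ τ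
    induction r using Quotient.inductionOn with | _ σ
    intro hh
    have : S.barSetoid (E a b h τ) (E a b h σ) := Quotient.exact hh
    rcases this with h1 | h1
    · rw [E_inj a b h h1]
    · rw [← E_bar] at h1
      exact Quotient.sound (Or.inr (E_inj a b h h1))
  have bij : Function.Bijective Eq' := Finite.injective_iff_bijective.mp inj
  unfold half
  rw [← Function.Bijective.sum_comp bij (fun q : S.Hq => k (Quotient.out q))]
  apply Finset.sum_congr rfl
  intro q _
  induction q using Quotient.inductionOn with | _ τ
  have := k_out k hk (E a b h τ)
  refine Eq.trans ?_ this.symm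
  exact k_out (fun τ => k (E a b h τ)) (fun τ => by rw [E_bar, hk]) τ

theorem half_two (k : S.H → A) (hk : ∀ τ, k (barH τ) = k τ) : ∑ τ, k τ = half k + half k := by
  rw [← Finset.sum_fiberwise (s := Finset.univ) (g := fun τ : S.H => (Quotient.mk S.barSetoid τ : S.Hq))]
  unfold half
  rw [← Finset.sum_add_distrib]
  apply Finset.sum_congr rfl
  intro q _
  have : (Finset.univ.filter fun τ : S.H => (Quotient.mk S.barSetoid τ : S.Hq) = q) =
      {Quotient.out q, barH (Quotient.out q)} := by
    ext τ
    simp only [Finset.mem_filter, Finset.mem_univ, true_and, Finset.mem_insert,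
      Finset.mem_singleton]
    constructor
    · rintro rfl
      rcases out_bar τ with h | h
      · rw [h]; exact Or.inl rfl
      · rw [h, barH_barH]; exact Or.inr rfl
    · rintro (h | h)
      · rw [h]; exact Quotient.out_eq q
      · rw [h]
        refine Eq.trans ?_ (Quotient.out_eq q)
        exact Quotient.sound (Or.inr (barH_barH _).symm)
  rw [this, Finset.sum_pair (Ne.symm (barH_ne _)), hk]

variable (S)
/-- sum over the half plane -/
noncomputable def S4 (h : ZMod N → ZMod N → ZMod N → ZMod N → A) (a b c d : K) : A :=
  ∑ τ : S.H, h (L τ a) (L τ b) (L τ c) (L τ d)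

theorem S4_lc (h : ZMod N → ZMod N → ZMod N → ZMod N → A)
    (ti : ∀ t a b c d, h (a + t) (b + t) (c + t) (d + t) = h a b c d)
    (a b : K) (hw : S.w a b ≠ 0) (u0 u1 u2 u3 : K) (h0 : u0 ≠ 0) (h1 : u1 ≠ 0) (h2 : u2 ≠ 0)
    (h3 : u3 ≠ 0) :
    S.S4 h (S.lc a b u0) (S.lc a b u1) (S.lc a b u2) (S.lc a b u3) = S.S4 h u0 u1 u2 u3 := by
  unfold S4
  rw [← Function.Bijective.sum_comp (E_bij a b hw)
    (fun τ : S.H => h (L τ u0) (L τ u1) (L τ u2) (L τ u3))]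
  apply Finset.sum_congr rfl
  intro τ _
  rw [L_E a b hw τ u0 h0, L_E a b hw τ u1 h1, L_E a b hw τ u2 h2, L_E a b hw τ u3 h3, ti]

theorem S4_sc (h : ZMod N → ZMod N → ZMod N → ZMod N → A)
    (t0 t1 t3 : F) (u0 u1 u2 u3 : K) (z0 : t0 ≠ 0) (z1 : t1 ≠ 0) (z3 : t3 ≠ 0)
    (h0 : u0 ≠ 0) (h1 : u1 ≠ 0) (h3 : u3 ≠ 0) :
    S.S4 h (t0 • u0) (t1 • u1) u2 (t3 • u3) = S.S4 h u0 u1 u2 u3 := by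
  unfold S4
  apply Finset.sum_congr rfl
  intro τ _
  rw [L_smul τ t0 z0 h0, L_smul τ t1 z1 h1, L_smul τ t3 z3 h3]

theorem S3_const (h : ZMod N → ZMod N → ZMod N → A)
    (ti : ∀ t a b c, h (a + t) (b + t) (c + t) = h a b c) :
    ∃ M : A, ∀ a b c, S.w a b ≠ 0 → S.w a c ≠ 0 → S.w b c ≠ 0 →
      ∑ τ : S.H, h (L τ a) (L τ b) (L τ c) = M := by
  refine ⟨S.S4 (fun i j k _ => h i j k) S.e 1 (S.e + 1) (S.e + 1), ?_⟩
  intro u0 u1 u2 h01 h02 h12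
  obtain ⟨a, b, t0, t1, t3, hw, z0, z1, z3, e0, e1, e2, e3⟩ :=
    S.normal4 u0 u1 u2 u2 h01 h02 h12 h12
  have ne : S.e ≠ 0 := by intro h; have := S.Xe; rw [h] at this; simp at this
  have n2 : S.e + 1 ≠ 0 := by
    intro h; have := congrArg S.X h; simp [S.Xe, S.X1] at this
  have hl : ∀ u, u ≠ 0 → S.lc a b u ≠ 0 := by
    intro u hu h
    have h2 := S.cramer a b 0 hw
    have h3 : S.w (S.lc a b u) a = 0 := by rw [h]; simp [w]
    have h4 : S.w (S.lc a b u) b = 0 := by rw [h]; simp [w]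
    have h5 : S.X u * S.w a b = 0 := by rw [← h4]; simp [w, lc]; ring
    have h6 : S.Y u * S.w a b = 0 := by
      have : S.Y u * S.w a b = - S.w (S.lc a b u) a := by simp [w, lc]; ring
      rw [this, h3, neg_zero]
    apply hu
    rw [S.coord u, (mul_eq_zero.mp h5).resolve_right hw, (mul_eq_zero.mp h6).resolve_right hw]
    simp
  have k1 := S.S4_lc (fun i j k _ => h i j k) (fun t a b c d => ti t a b c) a b hw S.e 1
    (S.e + 1) (S.e + 1) ne one_ne_zero n2 n2
  have k2 := S.S4_sc (fun i j k _ => h i j k) t0 t1 1 (S.lc a b S.e) (S.lc a b 1)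
    (S.lc a b (S.e + 1)) (S.lc a b (S.e + 1)) z0 z1 one_ne_zero (hl _ ne) (hl _ one_ne_zero) (hl _ n2)
  rw [← k1, ← k2, ← e0, ← e1, ← e2]
  rfl

theorem nd_lc {a b : K} (hw : S.w a b ≠ 0) {u0 u1 u2 u3 : K} (n : S.ND u0 u1 u2 u3) :
    S.ND (S.lc a b u0) (S.lc a b u1) (S.lc a b u2) (S.lc a b u3) := by
  constructor <;> rw [w_lc] <;> apply mul_ne_zero hw
  exacts [n.ab, n.ac, n.ad, n.bc, n.bd, n.cd]

variable [NeZero N]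

theorem exists_Phi : ∃ Φ : PBloch F →+ ZMod N, ∀ a b c d, S.ND a b c d →
    Φ (pbf (S.cr a b c d)) = S.S4 std a b c d := by
  apply S.gen_lift
  · intro a b u0 u1 u2 u3 hw n
    exact S.S4_lc std std_trans a b hw _ _ _ _ n.ne.1 n.ne.2.1 n.ne.2.2.1 n.ne.2.2.2
  · intro t0 t1 t3 u0 u1 u2 u3 z0 z1 z3 n
    exact S.S4_sc std _ _ _ _ _ _ _ z0 z1 z3 n.ne.1 n.ne.2.1 n.ne.2.2.2
  · intro a b c d e _ _ _ _ _
    unfold S4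
    rw [← Finset.sum_sub_distrib, ← Finset.sum_add_distrib, ← Finset.sum_sub_distrib,
      ← Finset.sum_add_distrib]
    exact Finset.sum_eq_zero fun τ _ => std_cocycle _ _ _ _ _

noncomputable def kp (a b c d : K) (τ : S.H) : ZMod N := stdp (L τ a) (L τ b) (L τ c) (L τ d)

theorem kp_bar {a b c d : K} (n : S.ND a b c d) (τ : S.H) :
    S.kp a b c d (barH τ) = S.kp a b c d τ := by
  unfold kp
  rw [L_bar τ a n.ne.1, L_bar τ b n.ne.2.1, L_bar τ c n.ne.2.2.1, L_bar τ d n.ne.2.2.2,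
    stdp_neg _ _ _ _ (L_ne τ n.ab) (L_ne τ n.bc) (L_ne τ n.ac) (L_ne τ n.ad) (L_ne τ n.bd)
      (L_ne τ n.cd)]

theorem exists_Psi : ∃ Φ : PBloch F →+ ZMod N, ∀ a b c d, S.ND a b c d →
    Φ (pbf (S.cr a b c d)) = half (S.kp a b c d) := by
  apply S.gen_lift (f4 := fun a b c d => half (S.kp a b c d))
  · intro a b u0 u1 u2 u3 hw n
    rw [← half_E (S.kp u0 u1 u2 u3) (S.kp_bar n) a b hw]
    unfold half
    apply Finset.sum_congr rfl
    intro q _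
    unfold kp
    rw [L_E a b hw _ u0 n.ne.1, L_E a b hw _ u1 n.ne.2.1, L_E a b hw _ u2 n.ne.2.2.1,
      L_E a b hw _ u3 n.ne.2.2.2, stdp_trans]
  · intro t0 t1 t3 u0 u1 u2 u3 z0 z1 z3 n
    unfold half
    apply Finset.sum_congr rfl
    intro q _
    unfold kp
    rw [L_smul _ t0 z0 n.ne.1, L_smul _ t1 z1 n.ne.2.1, L_smul _ t3 z3 n.ne.2.2.2]
  · intro a b c d e _ _ _ _ _
    unfold half
    rw [← Finset.sum_sub_distrib, ← Finset.sum_add_distrib, ← Finset.sum_sub_distrib,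
      ← Finset.sum_add_distrib]
    exact Finset.sum_eq_zero fun τ _ => stdp_cocycle _ _ _ _ _

theorem Phi_Psi {a b c d : K} (n : S.ND a b c d) :
    S.S4 std a b c d = half (S.kp a b c d) + half (S.kp a b c d) := by
  rw [← half_two _ (S.kp_bar n)]
  obtain ⟨M, hM⟩ := S.S3_const (fun a b c : ZMod N => jj a b c) jj_trans
  unfold kp stdp S4
  simp only [Finset.sum_add_distrib, Finset.sum_sub_distrib]
  rw [hM _ _ _ n.bc n.bd n.cd, hM _ _ _ n.ac n.ad n.cd, hM _ _ _ n.ab n.ad n.bd,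
    hM _ _ _ n.ab n.ac n.bc]
  ring

end Stp

theorem orbit_sum {X A : Type} [Fintype X] [AddCommGroup A] (E : Equiv.Perm X) (N : ℕ)
    (hN0 : 0 < N) (hN : E ^ N = 1) (W : X → A) (B : X → Prop) (hB : ∀ x, B (E x) ↔ B x)
    (h1 : ∀ x, ¬ B x → ∀ s, 0 < s → s < N → (E ^ s) x ≠ x)
    (h2 : ∀ x, ¬ B x → ∑ s ∈ Finset.range N, W ((E ^ s) x) = 0) :
    ∑ x, W x = ∑ x ∈ Finset.univ.filter B, W x := by
  have key : ∀ n : ℕ, ∀ T : Finset X, T.card = n → (∀ x, E x ∈ T ↔ x ∈ T) → (∀ x ∈ T, ¬ B x) →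
      ∑ x ∈ T, W x = 0 := by
    intro n
    induction n using Nat.strong_induction_on with
    | _ n ih =>
      intro T hT hE hTB
      rcases T.eq_empty_or_nonempty with rfl | ⟨x, hx⟩
      · simp
      have hpow : ∀ s : ℕ, (E ^ s) x ∈ T := by
        intro s
        induction s with
        | zero => simpa using hx
        | succ s ihs => rw [pow_succ', Equiv.Perm.mul_apply, hE]; exact ihs
      obtain ⟨O, hO⟩ : ∃ O : Finset X, O = (Finset.range N).image (fun s => (E ^ s) x) := ⟨_, rfl⟩
      have hmem : ∀ y, y ∈ O ↔ E.SameCycle x y := by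
        intro y
        rw [hO, Finset.mem_image]
        constructor
        · rintro ⟨s, -, rfl⟩; exact ⟨s, by simp⟩
        · intro hs
          obtain ⟨s, hs⟩ := hs.exists_nat_pow_eq
          refine ⟨s % N, Finset.mem_range.mpr (Nat.mod_lt _ hN0), ?_⟩
          rw [← pow_eq_pow_mod s hN, hs]
      have hsub : O ⊆ T := by
        intro y hy
        rw [hO, Finset.mem_image] at hy
        obtain ⟨s, -, rfl⟩ := hy
        exact hpow s
      have hxO : x ∈ O := (hmem x).mpr (Equiv.Perm.SameCycle.refl E x)
      have hOs : ∑ y ∈ O, W y = 0 := by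
        rw [hO, Finset.sum_image]
        · exact h2 x (hTB x hx)
        · intro s hs t ht hst
          have aux : ∀ s t : ℕ, s < t → t < N → (E ^ s) x = (E ^ t) x → False := by
            intro s t hst htN he
            apply h1 x (hTB x hx) (t - s) (by omega) (by omega)
            apply (E ^ s).injective
            rw [← Equiv.Perm.mul_apply, ← pow_add, Nat.add_sub_cancel' hst.le, he]
          simp only [Finset.coe_range, Set.mem_Iio] at hs ht
          rcases lt_trichotomy s t with h | h | h
          · exact (aux s t h ht hst).elim
          · exact h
          · exact (aux t s h hs hst.symm).elim
      rw [← Finset.sum_sdiff hsub, hOs, add_zero]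
      refine ih (T \ O).card ?_ _ rfl ?_ ?_
      · rw [← hT]
        exact Finset.card_lt_card ⟨Finset.sdiff_subset, fun h =>
          (Finset.mem_sdiff.mp (h hx)).2 hxO⟩
      · intro y
        rw [Finset.mem_sdiff, Finset.mem_sdiff, hE, hmem, hmem, Equiv.Perm.sameCycle_apply_right]
      · intro y hy; exact hTB y (Finset.mem_sdiff.mp hy).1
  rw [← Finset.sum_filter_add_sum_filter_not Finset.univ B W]
  rw [key _ (Finset.univ.filter fun x => ¬ B x) rfl (by intro x; simp [hB]) (by simp), add_zero]

namespace Stp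
variable {F K : Type} [Field F] [Field K] [Algebra F K] {N : ℕ} (S : Stp F K N)

theorem e_ne : S.e ≠ 0 := by intro h; have := S.Xe; rw [h] at this; simp at this

theorem mul_eq_lc (k u : K) : k * u = S.lc (k * S.e) k u := by
  rw [lc]; conv_lhs => rw [S.coord u]
  rw [mul_add, mul_smul_comm, mul_smul_comm, mul_one]

theorem w_mul_ne (k : K) (hk : k ≠ 0) : S.w (k * S.e) k ≠ 0 := by
  rw [Ne, ← S.th_w' (mul_ne_zero hk S.e_ne) hk, S.th_mul _ _ hk S.e_ne]
  intro h
  have h1 : S.th S.e = 0 := by simpa using h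
  have h2 : S.th (1 : K) = 0 := by
    have := S.th_mul 1 1 one_ne_zero one_ne_zero
    simpa using this
  have := (S.th_w' S.e_ne one_ne_zero).mp (h1.trans h2.symm)
  simp [w, S.Xe, S.Ye, S.X1, S.Y1] at this

theorem th_one : S.th 1 = 0 := by
  have := S.th_mul 1 1 one_ne_zero one_ne_zero
  simpa using this

variable {S}
/-- the action of multiplication by `k` -/
noncomputable def Em (k : K) (hk : k ≠ 0) (τ : S.H) : S.H := E (k * S.e) k (S.w_mul_ne k hk) τ

theorem Em_mul (k : K) (hk : k ≠ 0) (τ : S.H) (u : K) :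
    S.lc τ.1 1 (k * u) = S.lc τ.1 1 k * S.lc (Em k hk τ).1 1 u := by
  conv_lhs => rw [S.mul_eq_lc k u]
  exact E_mul _ _ (S.w_mul_ne k hk) τ u

theorem Em_Em (k l : K) (hk : k ≠ 0) (hl : l ≠ 0) (τ : S.H) :
    Em l hl (Em k hk τ) = Em (k * l) (mul_ne_zero hk hl) τ := by
  apply Subtype.ext
  change S.lc (Em k hk τ).1 1 (l * S.e) / S.lc (Em k hk τ).1 1 l =
    S.lc τ.1 1 (k * l * S.e) / S.lc τ.1 1 (k * l)
  rw [mul_assoc, Em_mul k hk, Em_mul k hk, mul_div_mul_left _ _ (lc_tau_ne τ hk)]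

theorem L_Em (k : K) (hk : k ≠ 0) (τ : S.H) (u : K) (hu : u ≠ 0) :
    L (Em k hk τ) u = L τ (k * u) - L τ k := by
  have := L_E (k * S.e) k (S.w_mul_ne k hk) τ u hu
  rw [← S.mul_eq_lc] at this
  rw [this]; simp [Em]

theorem Em_scal (k : K) (hk : k ≠ 0) (h : S.th k = 0) (τ : S.H) : Em k hk τ = τ := by
  obtain ⟨t, ht, rfl⟩ := S.exists_smul hk one_ne_zero (h.trans S.th_one.symm)
  apply Subtype.ext
  change S.lc τ.1 1 (t • 1 * S.e) / S.lc τ.1 1 (t • 1) = τ.1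
  rw [smul_mul_assoc, one_mul, lc_smul, lc_smul, lc_e, lc_1]
  have : algebraMap F K t ≠ 0 := by simpa using ht
  rw [Algebra.smul_def, Algebra.smul_def]; field_simp

variable (S)
def eH : S.H := ⟨S.e, by rw [S.Xe]; exact one_ne_zero⟩
variable {S}

theorem lc_eH (u : K) : S.lc S.eH.1 1 u = u := (S.coord u).symm

theorem quad_of_fix (k : K) (hk : k ≠ 0) (h : S.th k ≠ 0) (τ : S.H) (hf : Em k hk τ = τ) :
    τ.1 * τ.1 = S.X (S.e * S.e) • τ.1 + S.Y (S.e * S.e) • (1 : K) := by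
  have h1 : S.lc τ.1 1 (k * S.e) / S.lc τ.1 1 k = τ.1 := congrArg Subtype.val hf
  rw [div_eq_iff (lc_tau_ne τ hk)] at h1
  have hX : S.X k ≠ 0 := by
    intro hx
    apply h
    rw [← S.th_one, S.th_w' hk one_ne_zero]
    simp [w, hx, S.X1]
  have h2 : S.lc τ.1 1 (k * S.e) = S.X k • (S.X (S.e * S.e) • τ.1 + S.Y (S.e * S.e) • (1 : K))
      + S.Y k • τ.1 := by
    have : k * S.e = S.X k • (S.e * S.e) + S.Y k • S.e := by
      conv_lhs => rw [S.coord k]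
      rw [add_mul, smul_mul_assoc, smul_mul_assoc, one_mul]
    rw [this, lc_add, lc_smul, lc_smul, lc_e]; rfl
  rw [h2] at h1
  have h3 : τ.1 * S.lc τ.1 1 k = S.X k • (τ.1 * τ.1) + S.Y k • τ.1 := by
    rw [lc, mul_add, mul_smul_comm, mul_smul_comm, mul_one]
  rw [h3, add_left_inj] at h1
  exact (smul_right_injective K hX h1).symm

theorem fix_of (k : K) (hk : k ≠ 0) (h : S.th k ≠ 0) (τ : S.H) (hf : Em k hk τ = τ) :
    τ = S.eH ∨ τ = barH S.eH := by
  have h1 := quad_of_fix k hk h τ hf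
  have h2 : S.e * S.e = S.X (S.e * S.e) • S.e + S.Y (S.e * S.e) • (1 : K) := S.coord _
  have h3 : S.bar S.e * S.bar S.e = S.X (S.e * S.e) • S.bar S.e + S.Y (S.e * S.e) • (1 : K) := by
    have := congrArg S.bar h2
    rw [map_mul, map_add, map_smul, map_smul, map_one] at this
    exact this
  have h4 : S.bar S.e - S.e ≠ 0 := by
    intro h0
    have := S.bar_fix _ (sub_eq_zero.mp h0)
    rw [S.Xe] at this; exact one_ne_zero this
  rw [Algebra.smul_def, Algebra.smul_def] at h1 h2 h3
  have h5 : S.bar S.e + S.e = algebraMap F K (S.X (S.e * S.e)) := by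
    apply mul_left_cancel₀ h4
    linear_combination h3 - h2
  have h6 : (τ.1 - S.e) * (τ.1 - S.bar S.e) = 0 := by
    linear_combination h1 - h2 + (S.e - τ.1) * h5
  rcases mul_eq_zero.mp h6 with h | h
  · left; exact Subtype.ext (sub_eq_zero.mp h)
  · right; exact Subtype.ext (sub_eq_zero.mp h)

theorem Em_eH (k : K) (hk : k ≠ 0) : Em k hk S.eH = S.eH := by
  apply Subtype.ext
  change S.lc S.eH.1 1 (k * S.e) / S.lc S.eH.1 1 k = S.e
  rw [lc_eH, lc_eH, mul_div_cancel_left₀ _ hk]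

variable [Fintype K] [NeZero N] {A : Type} [AddCommGroup A]

theorem sum_H (γ : K) (hγ : γ ≠ 0) (hth : S.th γ = 1) (W : S.H → A)
    (hW : ∀ τ : S.H, ∑ s ∈ Finset.range N, W (Em (γ ^ s) (pow_ne_zero _ hγ) τ) = 0) :
    ∑ τ, W τ = W S.eH + W (barH S.eH) := by
  let P : Equiv.Perm S.H := Equiv.ofBijective (Em γ hγ) (E_bij _ _ (S.w_mul_ne γ hγ))
  have hP : ∀ τ, P τ = Em γ hγ τ := fun τ => rfl
  have hPs : ∀ (s : ℕ) τ, (P ^ s) τ = Em (γ ^ s) (pow_ne_zero _ hγ) τ := by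
    intro s
    induction s with
    | zero =>
      intro τ
      rw [Em_scal _ _ (by rw [pow_zero]; exact S.th_one)]; rfl
    | succ s ih =>
      intro τ
      rw [pow_succ', Equiv.Perm.mul_apply, ih, hP, Em_Em]
      congr 1
      exact (pow_succ _ _).symm
  have hths : ∀ s : ℕ, S.th (γ ^ s) = s := by
    intro s
    induction s with
    | zero => simpa using S.th_one
    | succ s ih => rw [pow_succ, S.th_mul _ _ (pow_ne_zero _ hγ) hγ, ih, hth]; push_cast; rfl
  have hbar : ∀ k hk, Em k hk (barH S.eH) = barH S.eH := by
    intro k hk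
    rw [Em, E_bar]; congr 1; exact Em_eH k hk
  have hB : ∀ τ : S.H, (P τ = S.eH ∨ P τ = barH S.eH) ↔ (τ = S.eH ∨ τ = barH S.eH) := by
    intro τ
    have e1 : P S.eH = S.eH := Em_eH γ hγ
    have e2 : P (barH S.eH) = barH S.eH := hbar γ hγ
    constructor
    · rintro (h | h)
      · left; exact P.injective (h.trans e1.symm)
      · right; exact P.injective (h.trans e2.symm)
    · rintro (rfl | rfl)
      · exact Or.inl e1
      · exact Or.inr e2
  have := orbit_sum P N (Nat.pos_of_ne_zero (NeZero.ne N)) (by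
      ext τ : 1
      rw [hPs, Em_scal _ _ (by rw [hths]; simp)]; rfl) W (fun τ => τ = S.eH ∨ τ = barH S.eH) hB
    (by
      intro τ hτ s s0 sN h
      rw [hPs] at h
      apply hτ
      refine fix_of _ _ ?_ τ h
      rw [hths, Ne, ZMod.natCast_eq_zero_iff]
      intro hd
      exact absurd (Nat.le_of_dvd s0 hd) (by omega))
    (by
      intro τ _
      simp only [hPs]; exact hW τ)
  rw [this]
  rw [← Finset.sum_pair (Ne.symm (barH_ne S.eH))]
  refine Finset.sum_congr ?_ (fun _ _ => rfl)
  ext; simp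

end Stp

namespace Stp
variable {F K : Type} [Field F] [Field K] [Algebra F K] {N : ℕ} (S : Stp F K N)
variable [Fintype K] [NeZero N]

theorem wsum_trans (σ : ZMod N → ZMod N) (c : ZMod N) :
    wsum (fun i => σ i + c) = wsum σ := by
  unfold wsum; simp only [std_trans]

theorem carry_neg_self (x : ZMod N) (hx : x ≠ 0) : carry x (-x) = 1 := by
  have h := carry_spec x (-x)
  rw [add_neg_cancel, ZMod.val_zero, zero_add] at h
  by_contra hc
  have : carry x (-x) = 0 := by
    unfold carry at hc ⊢; split_ifs at hc ⊢ <;> simp_all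
  rw [this] at h
  have h2 : x.val = 0 := by omega
  exact hx ((ZMod.val_eq_zero x).mp h2)

/-- chosen representatives -/
noncomputable def pt (i : ZMod N) : K := Classical.choose (S.th_surj i)
theorem pt_ne (i : ZMod N) : S.pt i ≠ 0 := (Classical.choose_spec (S.th_surj i)).1
theorem th_pt (i : ZMod N) : S.th (S.pt i) = i := (Classical.choose_spec (S.th_surj i)).2
theorem w_pt {i j : ZMod N} (h : i ≠ j) : S.w (S.pt i) (S.pt j) ≠ 0 := by
  rw [Ne, ← S.th_w' (S.pt_ne i) (S.pt_ne j), th_pt, th_pt]; exact h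

theorem sum_wsum (hN : 2 ≤ N) : ∑ τ : S.H, wsum (fun i => L τ (S.pt i)) = 2 := by
  obtain ⟨γ, hγ, hth⟩ := S.th_surj 1
  have hths : ∀ s : ℕ, S.th (γ ^ s) = s := by
    intro s
    induction s with
    | zero => simpa using S.th_one
    | succ s ih => rw [pow_succ, S.th_mul _ _ (pow_ne_zero _ hγ) hγ, ih, hth]; push_cast; rfl
  rw [sum_H γ hγ hth]
  · have e1 : ∀ i, L S.eH (S.pt i) = i := by
      intro i; rw [L, lc_eH, th_pt]
    have e2 : ∀ i, L (barH S.eH) (S.pt i) = -i := by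
      intro i; rw [L_bar _ _ (S.pt_ne i), e1]
    simp only [e1, e2]
    have h1 := wsum_id hN (0 : ZMod N)
    have h2 := wsum_neg hN (0 : ZMod N)
    simp only [add_zero] at h1 h2
    rw [h1, h2]; norm_num
  · intro τ
    have h1 : ∀ s : ℕ, wsum (fun i => L (Em (γ ^ s) (pow_ne_zero _ hγ) τ) (S.pt i)) =
        wsum (fun i => L τ (S.pt (i + (s : ZMod N)))) := by
      intro s
      rw [← wsum_trans (fun i => L τ (S.pt (i + (s : ZMod N)))) (- L τ (γ ^ s))]
      congr 1
      ext i
      rw [L_Em _ _ _ _ (S.pt_ne i), ← sub_eq_add_neg]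
      congr 1
      apply L_congr τ (mul_ne_zero (pow_ne_zero _ hγ) (S.pt_ne i)) (S.pt_ne _)
      rw [S.th_mul _ _ (pow_ne_zero _ hγ) (S.pt_ne i), hths, th_pt, th_pt, add_comm]
    rw [Finset.sum_congr rfl (fun s _ => h1 s)]
    rw [← sum_zmod_range (fun s : ZMod N => wsum (fun i => L τ (S.pt (i + s))))]
    rw [← wsum_avg (fun i => L τ (S.pt i))]
    rw [← Equiv.sum_comp (Equiv.neg (ZMod N))]
    simp [sub_eq_add_neg]

theorem card_H : ((Fintype.card S.H : ℕ) : ZMod N) = 2 := by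
  obtain ⟨γ, hγ, hth⟩ := S.th_surj 1
  have := sum_H (S := S) γ hγ hth (fun _ => (1 : ZMod N)) (by intro τ; simp)
  simp at this
  rw [this]; norm_num

theorem S4_abab (a b : K) (c : K) (hab : S.w a b ≠ 0) (hac : S.w a c ≠ 0) (hbc : S.w b c ≠ 0) :
    S.S4 std a b a b = 0 := by
  obtain ⟨M, hM⟩ := S.S3_const (fun a b c : ZMod N => b - a) (by intros; ring)
  have h1 := hM a b c hab hac hbc
  have h2 := hM b c a hbc (S.w_swap_ne hab) (S.w_swap_ne hac)
  have h3 := hM a c b hac hab (S.w_swap_ne hbc)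
  have h4 : M = 0 := by
    have : ∑ τ : S.H, (L τ c - L τ a) = ∑ τ : S.H, (L τ b - L τ a) + ∑ τ : S.H, (L τ c - L τ b) := by
      rw [← Finset.sum_add_distrib]; apply Finset.sum_congr rfl; intros; ring
    rw [h1, h2, h3] at this
    linear_combination -this
  rw [← h4, ← h1]
  unfold S4
  apply Finset.sum_congr rfl
  intro τ _
  have := L_ne τ hab
  have h5 := carry_neg_self (L τ b - L τ a) (sub_ne_zero.mpr this.symm)
  rw [neg_sub] at h5
  rw [std, h5, one_smul]

theorem S4_abca (a b c d : K) (n : S.ND a b c d) :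
    S.S4 std a b c a = S.S4 std a b c d - S.S4 std b c a d := by
  have h : S.S4 std b c a d - S.S4 std a c a d + S.S4 std a b a d - S.S4 std a b c d
      + S.S4 std a b c a = 0 := by
    unfold S4
    rw [← Finset.sum_sub_distrib, ← Finset.sum_add_distrib, ← Finset.sum_sub_distrib,
      ← Finset.sum_add_distrib]
    exact Finset.sum_eq_zero fun τ _ => std_cocycle _ _ _ _ _
  obtain ⟨M, hM⟩ := S.S3_const (fun a b c : ZMod N => std a b a c)
    (fun t a b c => std_trans t a b a c)
  have h1 : S.S4 std a c a d = M := hM a c d n.ac n.ad n.cd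
  have h2 : S.S4 std a b a d = M := hM a b d n.ab n.ad n.bd
  rw [h1, h2] at h
  linear_combination h

theorem exists_two (hN : 4 ≤ N) (Φ : PBloch F →+ ZMod N) (hΦ : ∀ a b c d, S.ND a b c d →
    Φ (pbf (S.cr a b c d)) = S.S4 std a b c d) : ∃ c, Φ c = 2 := by
  have : (2 : ZMod N) ∈ Φ.range := by
    rw [← S.sum_wsum (by omega)]
    unfold wsum
    rw [Finset.sum_comm]
    apply sum_mem
    intro m _
    have ne : ∀ k : ℕ, 0 < k → k < 4 → (k : ZMod N) ≠ 0 := by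
      intro k k0 k4
      rw [Ne, ZMod.natCast_eq_zero_iff]
      intro hd; exact absurd (Nat.le_of_dvd k0 hd) (by omega)
    have ne1 : (1 : ZMod N) ≠ 0 := by simpa using ne 1 (by norm_num) (by norm_num)
    have ne2 : (2 : ZMod N) ≠ 0 := by simpa using ne 2 (by norm_num) (by norm_num)
    have ne3 : (3 : ZMod N) ≠ 0 := by simpa using ne 3 (by norm_num) (by norm_num)
    change S.S4 std (S.pt 0) (S.pt 1) (S.pt (1 + m)) (S.pt (1 + m + 1)) ∈ _
    have nd : ∀ i j k l : ZMod N, i ≠ j → i ≠ k → i ≠ l → j ≠ k → j ≠ l → k ≠ l →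
        S.ND (S.pt i) (S.pt j) (S.pt k) (S.pt l) := fun i j k l h1 h2 h3 h4 h5 h6 =>
      ⟨S.w_pt h1, S.w_pt h2, S.w_pt h3, S.w_pt h4, S.w_pt h5, S.w_pt h6⟩
    by_cases m0 : m = 0
    · subst m0
      have : S.S4 std (S.pt 0) (S.pt 1) (S.pt (1 + 0)) (S.pt (1 + 0 + 1)) = 0 := by
        unfold S4
        apply Finset.sum_eq_zero
        intro τ _
        rw [add_zero]; unfold std carry
        have : (L τ (S.pt 1) - L τ (S.pt 0)).val < N := ZMod.val_lt _
        simp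
        intro h; omega
      rw [this]; exact zero_mem _
    by_cases m1 : m = -1
    · subst m1
      have e1 : (1 : ZMod N) + -1 = 0 := by ring
      rw [e1, zero_add, S.S4_abab _ _ (S.pt 2) (S.w_pt ne1.symm) (S.w_pt ne2.symm)
        (S.w_pt (fun h => ne1 (by linear_combination -h)))]
      exact zero_mem _
    by_cases m2 : m = -2
    · subst m2
      have e1 : (1 : ZMod N) + -2 = -1 := by ring
      rw [e1, neg_add_cancel]
      have n1 : (0 : ZMod N) ≠ 1 := ne1.symm
      have n2 : (0 : ZMod N) ≠ -1 := fun h => ne1 (by linear_combination h)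
      have n3 : (0 : ZMod N) ≠ 2 := ne2.symm
      have n4 : (1 : ZMod N) ≠ -1 := fun h => ne2 (by linear_combination h)
      have n5 : (1 : ZMod N) ≠ 2 := fun h => ne1 (by linear_combination -h)
      have n6 : (-1 : ZMod N) ≠ 2 := fun h => ne3 (by linear_combination -h)
      have nn := nd 0 1 (-1) 2 n1 n2 n3 n4 n5 n6
      have nn' := nd 1 (-1) 0 2 n4 n1.symm n5 n2.symm n6 n3
      rw [S.S4_abca _ _ _ (S.pt 2) nn, ← hΦ _ _ _ _ nn, ← hΦ _ _ _ _ nn', ← map_sub]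
      exact ⟨_, rfl⟩
    rw [← hΦ]
    · exact ⟨_, rfl⟩
    apply nd
    · exact ne1.symm
    · exact fun h => m1 (by linear_combination -h)
    · exact fun h => m2 (by linear_combination -h)
    · exact fun h => m0 (by linear_combination -h)
    · exact fun h => m1 (by linear_combination -h)
    · exact fun h => ne1 (by linear_combination -h)
  exact this
end Stp

namespace Stp
variable {F K : Type} [Field F] [Field K] [Algebra F K] {N : ℕ} (S : Stp F K N)
variable [Fintype K] [NeZero N]

theorem cr_ne0 {a b c d : K} (h : S.ND a b c d) : S.cr a b c d ≠ 0 :=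
  div_ne_zero (mul_ne_zero h.ad h.bc) (mul_ne_zero h.ac h.bd)

theorem cr_ne1 {a b c d : K} (h : S.ND a b c d) : S.cr a b c d ≠ 1 := by
  intro e
  have := S.one_sub_cr a b c d h.ac h.bd
  rw [e, sub_self] at this
  exact div_ne_zero (mul_ne_zero h.ab h.cd) (mul_ne_zero h.ac h.bd) this.symm

theorem upper (h4 : ∀ a b c : F, ∃ u, u ≠ a ∧ u ≠ b ∧ u ≠ c)
    (Φ : PBloch F →+ ZMod N) (hΦ : ∀ a b c d, S.ND a b c d →
    Φ (pbf (S.cr a b c d)) = S.S4 std a b c d) :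
    ∃ κ : ZMod N →+ PBloch F, ∀ y, Fintype.card S.H • 2 • y = κ (Φ y) := by
  have hB : BW (pbf : F → PBloch F) := pbf_BW
  obtain ⟨z, z0, z1, -⟩ := h4 0 1 1
  obtain ⟨C, hCe⟩ : ∃ C : PBloch F, C = pbf z + pbf (1 - z) := ⟨_, rfl⟩
  have hC : ∀ x : F, x ≠ 0 → x ≠ 1 → pbf x + pbf (1 - x) = C := fun x x0 x1 => by
    rw [hCe]; exact hB.cconst x z x0 x1 z0 z1
  have D3 : 2 • C + 2 • C + 2 • C = 0 := by
    have := hB.psi_two h4 (-1)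
    rw [← hB.three_c h4 C hC] at this
    rw [← this]; abel
  have inv2 : ∀ x : F, ((2 : ℕ) • pbf x⁻¹ : PBloch F) = - ((2 : ℕ) • pbf x : PBloch F) := fun x => by
    have := hB.psi_two h4 x
    rw [smul_add] at this
    exact eq_neg_of_add_eq_zero_right this
  obtain ⟨f, hf⟩ : ∃ f : ZMod N → ZMod N → ZMod N → ZMod N → PBloch F, f = fun i j k l =>
    2 • pbf (S.cr (S.pt i) (S.pt j) (S.pt k) (S.pt l)) := ⟨_, rfl⟩
  have o1 : pbf (1 : F) = 0 := hB.o
  have o0 : pbf (0 : F) = 0 := hB.z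
  have dd : ∀ x : F, pbf (x / x) = 0 := fun x => by
    by_cases hx : x = 0
    · simp [hx, o0]
    · rw [div_self hx, o1]
  have nd : ∀ i j k l : ZMod N, i ≠ j → i ≠ k → i ≠ l → j ≠ k → j ≠ l → k ≠ l →
      S.ND (S.pt i) (S.pt j) (S.pt k) (S.pt l) := fun i j k l h1 h2 h3 h4 h5 h6 =>
    ⟨S.w_pt h1, S.w_pt h2, S.w_pt h3, S.w_pt h4, S.w_pt h5, S.w_pt h6⟩
  have h01 : ∀ a c d, f a a c d = 0 := fun a c d => by
    rw [hf]; simp only [cr]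
    rw [mul_comm (S.w (S.pt a) (S.pt c)), dd, smul_zero]
  have h02 : ∀ a b d, f a b a d = 0 := fun a b d => by simp [hf, cr, S.w_self, o0]
  have h03 : ∀ a b c, f a b c a = 0 := fun a b d => by simp [hf, cr, S.w_self, o0]
  have h12 : ∀ a b d, f a b b d = 0 := fun a b d => by simp [hf, cr, S.w_self, o0]
  have h13 : ∀ a b c, f a b c b = 0 := fun a b d => by simp [hf, cr, S.w_self, o0]
  have h23 : ∀ a b c, f a b c c = 0 := fun a b c => by
    rw [hf]; simp only [cr]; rw [dd, smul_zero]
  have s1 : ∀ a b c d, f b a c d = - f a b c d := fun a b c d => by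
    rw [hf]; simp only
    rw [← inv2]; congr 2
    rw [cr, cr, inv_div, mul_comm]; congr 1; rw [mul_comm]
  have s3 : ∀ a b c d, f a b d c = - f a b c d := fun a b c d => by
    rw [hf]; simp only
    rw [← inv2]; congr 2
    rw [cr, cr, inv_div]
  have s2 : ∀ a b c d, a ≠ b → a ≠ c → a ≠ d → b ≠ c → b ≠ d → c ≠ d →
      f a c b d = - (2 • C) - f a b c d := by
    intro a b c d ab ac ad bc bd cd
    have n := nd a b c d ab ac ad bc bd cd
    rw [hf]; simp only
    obtain ⟨x, hx⟩ : ∃ x, x = S.cr (S.pt a) (S.pt b) (S.pt c) (S.pt d) := ⟨_, rfl⟩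
    have x0 : x ≠ 0 := hx ▸ S.cr_ne0 n
    have x1 : x ≠ 1 := hx ▸ S.cr_ne1 n
    have e : S.cr (S.pt a) (S.pt c) (S.pt b) (S.pt d) = (1 - x⁻¹)⁻¹ := by
      have i : 1 - x⁻¹ = - (1 - x) / x := by field_simp; ring
      rw [i, hx, S.one_sub_cr _ _ _ _ n.ac n.bd, cr, cr, S.w_swap (S.pt b) (S.pt c)]
      have := n.ab; have := n.ac; have := n.ad; have := n.bc; have := n.bd; have := n.cd
      field_simp
    rw [e, ← hx, inv2]
    have k := hC x⁻¹ (inv_ne_zero x0) (by simpa using x1)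
    rw [← k, smul_add, inv2]; abel
  have hc : ∀ a b c d e, a ≠ b → a ≠ c → a ≠ d → a ≠ e → b ≠ c → b ≠ d → b ≠ e → c ≠ d → c ≠ e →
      d ≠ e → f b c d e - f a c d e + f a b d e - f a b c e + f a b c d = 0 := by
    intro a b c d e ab ac ad ae bc bd be cd ce de
    have n1 := nd a b c d ab ac ad bc bd cd
    have n2 := nd a b c e ab ac ae bc be ce
    obtain ⟨r1, r2, r3⟩ := S.cr_five (S.pt a) (S.pt b) (S.pt c) (S.pt d) (S.pt e) n1.ab n1.ac
      n1.ad n2.ad n1.bc n1.bd n2.bd n1.cd n2.cd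
    have k := hB.five _ _ (S.cr_ne0 n1) (S.cr_ne1 n1) (S.cr_ne0 n2) (S.cr_ne1 n2)
    rw [r1, r2, r3] at k
    rw [hf]; simp only
    rw [← smul_zero (2 : ℕ), ← k]; abel
  have cc := corr_cocycle (2 • C) D3 f h01 h02 h03 h12 h13 h23 s1 s3 s2 hc
  have fcong : ∀ i j k l u0 u1 u2 u3, u0 ≠ 0 → u1 ≠ 0 → u2 ≠ 0 → u3 ≠ 0 → S.th u0 = i →
      S.th u1 = j → S.th u2 = k → S.th u3 = l → f i j k l = 2 • pbf (S.cr u0 u1 u2 u3) := by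
    intro i j k l u0 u1 u2 u3 z0 z1 z2 z3 e0 e1 e2 e3
    obtain ⟨t0, q0, g0⟩ := S.exists_smul (S.pt_ne i) z0 ((S.th_pt i).trans e0.symm)
    obtain ⟨t1, q1, g1⟩ := S.exists_smul (S.pt_ne j) z1 ((S.th_pt j).trans e1.symm)
    obtain ⟨t2, q2, g2⟩ := S.exists_smul (S.pt_ne k) z2 ((S.th_pt k).trans e2.symm)
    obtain ⟨t3, q3, g3⟩ := S.exists_smul (S.pt_ne l) z3 ((S.th_pt l).trans e3.symm)
    rw [hf]; simp only
    rw [g0, g1, g2, g3, S.cr_smul _ _ _ _ q0 q1 q2 q3]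
  have ti : ∀ t a b c d, f (a + t) (b + t) (c + t) (d + t) + corr (2 • C) (a + t) (b + t) (c + t) (d + t)
      = f a b c d + corr (2 • C) a b c d := by
    intro t a b c d
    have e1 : corr (2 • C) (a + t) (b + t) (c + t) (d + t) = corr (2 • C) a b c d := by
      simp only [corr, add_left_inj, ne_eq]; congr
    have hm : ∀ i, S.lc (S.pt t * S.e) (S.pt t) (S.pt i) ≠ 0 := fun i => by
      rw [← S.mul_eq_lc]; exact mul_ne_zero (S.pt_ne t) (S.pt_ne i)
    have ht : ∀ i, S.th (S.lc (S.pt t * S.e) (S.pt t) (S.pt i)) = i + t := fun i => by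
      rw [← S.mul_eq_lc, S.th_mul _ _ (S.pt_ne t) (S.pt_ne i), S.th_pt, S.th_pt, add_comm]
    rw [e1, fcong _ _ _ _ _ _ _ _ (hm a) (hm b) (hm c) (hm d) (ht a) (ht b) (ht c) (ht d),
      S.cr_lc _ _ _ _ _ _ (S.w_mul_ne _ (S.pt_ne t)), hf]
  obtain ⟨κ, h2, hκ⟩ := cocycle_std (fun a b c d => f a b c d + corr (2 • C) a b c d) ti cc
    (by intro a c d; simp [h01, corr])
  refine ⟨κ, ?_⟩
  have main : ∀ a b c d, S.ND a b c d →
      Fintype.card S.H • 2 • pbf (S.cr a b c d) = κ (Φ (pbf (S.cr a b c d))) := by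
    intro a b c d n
    obtain ⟨M, hM⟩ := S.S3_const (fun a b c : ZMod N => h2 (b - a) (c - b)) (by intros; simp)
    have t1 : ∀ τ : S.H, 2 • pbf (S.cr a b c d) =
        κ (std (L τ a) (L τ b) (L τ c) (L τ d)) - (h2 (L τ c - L τ b) (L τ d - L τ c) -
          h2 (L τ c - L τ a) (L τ d - L τ c) + h2 (L τ b - L τ a) (L τ d - L τ b)
          - h2 (L τ b - L τ a) (L τ c - L τ b)) := by
      intro τ
      rw [← hκ]
      have e1 : corr (2 • C) (L τ a) (L τ b) (L τ c) (L τ d) = 0 := by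
        simp [corr, L_ne τ n.ad, L_ne τ n.ac]
      have hw : S.w τ.1 1 ≠ 0 := by
        have := τ.2; simpa [w, S.X1, S.Y1] using this
      rw [e1, add_zero, fcong (L τ a) (L τ b) (L τ c) (L τ d) (S.lc τ.1 1 a) (S.lc τ.1 1 b)
        (S.lc τ.1 1 c) (S.lc τ.1 1 d) (lc_tau_ne τ n.ne.1) (lc_tau_ne τ n.ne.2.1)
        (lc_tau_ne τ n.ne.2.2.1) (lc_tau_ne τ n.ne.2.2.2) rfl rfl rfl rfl, S.cr_lc _ _ _ _ _ _ hw]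
    have t2 : ∑ τ : S.H, 2 • pbf (S.cr a b c d) = κ (Φ (pbf (S.cr a b c d))) := by
      rw [Finset.sum_congr rfl (fun τ _ => t1 τ), hΦ a b c d n]
      unfold S4
      rw [map_sum]
      simp only [Finset.sum_add_distrib, Finset.sum_sub_distrib]
      rw [hM _ _ _ n.bc n.bd n.cd, hM _ _ _ n.ac n.ad n.cd, hM _ _ _ n.ab n.ad n.bd,
        hM _ _ _ n.ab n.ac n.bc]
      abel
    rw [← t2, Finset.sum_const, Finset.card_univ]
  intro y
  induction y using pbf_induction with
  | hz => simp
  | hg x =>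
    by_cases x0 : x = 0
    · rw [x0, o0]; simp
    by_cases x1 : x = 1
    · rw [x1, o1]; simp
    have := main _ _ _ _ (S.nd_std x x0 x1)
    rwa [S.cr_std] at this
  | ha a b h1 h2 => rw [map_add, map_add, ← h1, ← h2, smul_add, smul_add]
  | hn a h1 => rw [map_neg, map_neg, ← h1, smul_neg, smul_neg]

theorem summary (S : Stp F K N) (h4 : ∀ a b c : F, ∃ u, u ≠ a ∧ u ≠ b ∧ u ≠ c) (hN : 4 ≤ N)
    (tor : ∀ y : PBloch F, N • y = 0) :
    ∃ (Φ Ψ : PBloch F →+ ZMod N), (∀ y, Φ y = Ψ y + Ψ y) ∧ (∃ c, Φ c = 2) ∧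
      (∀ y, Φ y = 0 → 4 • y = 0) := by
  obtain ⟨Φ, hΦ⟩ := S.exists_Phi
  obtain ⟨Ψ, hΨ⟩ := S.exists_Psi
  refine ⟨Φ, Ψ, ?_, S.exists_two hN Φ hΦ, ?_⟩
  · intro y
    induction y using pbf_induction with
    | hz => simp
    | hg x =>
      by_cases x0 : x = 0
      · rw [x0, pbf_BW.z]; simp
      by_cases x1 : x = 1
      · rw [x1, pbf_BW.o]; simp
      have n := S.nd_std x x0 x1
      have h1 := hΦ _ _ _ _ n
      have h2 := hΨ _ _ _ _ n
      rw [S.cr_std] at h1 h2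
      rw [h1, h2, S.Phi_Psi n]
    | ha a b h1 h2 => rw [map_add, map_add, h1, h2]; abel
    | hn a h1 => rw [map_neg, map_neg, h1]; abel
  · intro y hy
    obtain ⟨κ, hκ⟩ := S.upper h4 Φ hΦ
    have h1 := hκ y
    rw [hy, map_zero, smul_smul] at h1
    have h2 : ((Fintype.card S.H : ℕ) : ZMod N) = ((2 : ℕ) : ZMod N) := by
      rw [S.card_H]; norm_num
    rw [ZMod.natCast_eq_natCast_iff] at h2
    obtain ⟨k, hk⟩ := (Nat.modEq_iff_dvd.mp h2)
    have h3 : ((4 : ℤ)) • y = 0 := by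
      have e : (4 : ℤ) = ((Fintype.card S.H * 2 : ℕ) : ℤ) + (2 * k) * (N : ℤ) := by
        push_cast at hk ⊢; linarith
      rw [e, add_smul, mul_smul, natCast_zsmul, natCast_zsmul, tor, h1]; simp
    exact_mod_cast h3

end Stp

theorem stp_of {F K : Type} [Field F] [Field K] [Algebra F K] [Fintype F] [Fintype K]
    (hK : Fintype.card K = Fintype.card F ^ 2) : Nonempty (Stp F K (Fintype.card F + 1)) := by
  set q := Fintype.card F with hq
  have hq2 : 2 ≤ q := Fintype.one_lt_card
  have hfr : Module.finrank F K = 2 := by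
    have h := Module.card_eq_pow_finrank (K := F) (V := K)
    rw [hK] at h
    exact (Nat.pow_right_injective hq2 h).symm
  let bar := FiniteField.frobeniusAlgHom F K
  have hbar : ∀ u : K, bar u = u ^ q := fun u => rfl
  have barbar : ∀ u : K, bar (bar u) = u := by
    intro u
    rw [hbar, hbar, ← pow_mul, ← sq, ← hK, FiniteField.pow_card]
  have hex : ∃ e : K, bar e ≠ e := by
    by_contra! hcon
    have hne : (Polynomial.X ^ q - Polynomial.X : Polynomial K) ≠ 0 :=
      FiniteField.X_pow_card_sub_X_ne_zero K hq2
    have hd := FiniteField.X_pow_card_sub_X_natDegree_eq K hq2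
    have h1 : (Finset.univ : Finset K).card ≤ q := by
      rw [← hd]
      apply Polynomial.card_le_degree_of_subset_roots
      intro x _
      rw [Polynomial.mem_roots hne]
      simp [← hbar, hcon x]
    rw [Finset.card_univ, hK] at h1
    nlinarith
  obtain ⟨e, he⟩ := hex
  have hli : LinearIndependent F ![e, (1 : K)] := by
    rw [LinearIndependent.pair_iff]
    intro s t hst
    have h2 := congrArg bar hst
    simp only [map_add, map_smul, map_one, map_zero] at h2
    have h3 : s • (bar e - e) = 0 := by
      rw [smul_sub, sub_eq_zero]
      exact add_right_cancel (h2.trans hst.symm)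
    rcases smul_eq_zero.1 h3 with h | h
    · refine ⟨h, ?_⟩
      rw [h, zero_smul, zero_add] at hst
      rcases smul_eq_zero.1 hst with h' | h'
      · exact h'
      · exact absurd h' one_ne_zero
    · exact absurd (sub_eq_zero.1 h) he
  let B := basisOfLinearIndependentOfCardEqFinrank hli (by simp [hfr])
  have B0 : B 0 = e := by simp [B]
  have B1 : B 1 = 1 := by simp [B]
  have coord : ∀ u, u = B.coord 0 u • e + B.coord 1 u • (1 : K) := by
    intro u
    conv_lhs => rw [← B.sum_repr u]
    rw [Fin.sum_univ_two, B0, B1]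
    rfl
  have bcoord : ∀ u, bar u = B.coord 0 u • bar e + B.coord 1 u • (1 : K) := by
    intro u
    conv_lhs => rw [coord u]
    simp only [map_add, map_smul, map_one]
  have hwid : ∀ u v, u * bar v - bar u * v =
      (B.coord 0 u * B.coord 1 v - B.coord 1 u * B.coord 0 v) • (e - bar e) := by
    intro u v
    have cu := coord u
    have cv := coord v
    have du := bcoord u
    have dv := bcoord v
    rw [Algebra.smul_def, Algebra.smul_def] at cu cv du dv
    rw [Algebra.smul_def, map_sub, map_mul, map_mul]
    generalize algebraMap F K (B.coord 0 u) = a at *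
    generalize algebraMap F K (B.coord 1 u) = b at *
    generalize algebraMap F K (B.coord 0 v) = c at *
    generalize algebraMap F K (B.coord 1 v) = d at *
    rw [du, dv, cu, cv]
    ring
  obtain ⟨g, hg⟩ := IsCyclic.exists_generator (α := Kˣ)
  have hord : orderOf g = (q - 1) * (q + 1) := by
    rw [orderOf_eq_card_of_forall_mem_zpowers hg, Nat.card_eq_fintype_card, Fintype.card_units, hK]
    obtain ⟨m, hm⟩ : ∃ m, q = m + 1 := ⟨q - 1, by omega⟩
    rw [hm, Nat.add_sub_cancel]
    have : (m + 1) ^ 2 = m * (m + 1 + 1) + 1 := by ring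
    omega
  have hlog : ∀ u : K, u ≠ 0 → ∃ i : ℕ, (g : K) ^ i = u := by
    intro u hu
    have h1 := (mem_powers_iff_mem_zpowers).2 (hg (Units.mk0 u hu))
    obtain ⟨i, hi⟩ := h1
    refine ⟨i, ?_⟩
    have := congrArg Units.val hi
    simpa using this
  let lg : K → ℕ := fun u => if hu : u ≠ 0 then (hlog u hu).choose else 0
  have lgs : ∀ u, u ≠ 0 → (g : K) ^ lg u = u := by
    intro u hu
    simp only [lg, dif_pos hu]
    exact (hlog u hu).choose_spec
  have gpow : ∀ i j : ℕ, (g : K) ^ i = (g : K) ^ j ↔ i ≡ j [MOD (q - 1) * (q + 1)] := by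
    intro i j
    rw [← hord, ← pow_eq_pow_iff_modEq, ← Units.val_pow_eq_pow_val, ← Units.val_pow_eq_pow_val,
      Units.val_inj]
  have ths : ∀ u i, u ≠ 0 → (g : K) ^ i = u → ((lg u : ℕ) : ZMod (q + 1)) = (i : ℕ) := by
    intro u i hu hi
    have h1 := (gpow _ _).1 ((lgs u hu).trans hi.symm)
    rw [ZMod.natCast_eq_natCast_iff]
    exact h1.of_mul_left _
  have g0 : (g : K) ≠ 0 := g.ne_zero
  refine ⟨⟨e, B.coord 0, B.coord 1, coord, ?_, ?_, ?_, ?_, bar, barbar, ?_,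
    fun u => ((lg u : ℕ) : ZMod (q + 1)), ?_, ?_, ?_, ?_⟩⟩
  · simp [← B0]
  · simp [← B0]
  · rw [← B1]; simp
  · rw [← B1]; simp
  · intro u hu
    have h1 := bcoord u
    rw [hu] at h1
    have h2 : B.coord 0 u • (e - bar e) = 0 := by
      rw [smul_sub, sub_eq_zero]
      exact add_right_cancel ((coord u).symm.trans h1)
    rcases smul_eq_zero.1 h2 with h | h
    · exact h
    · exact absurd (sub_eq_zero.1 h).symm he
  · intro u v hu hv
    rw [ths (u * v) (lg u + lg v) (mul_ne_zero hu hv) (by rw [pow_add, lgs u hu, lgs v hv])]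
    push_cast; rfl
  · intro u hu
    show ((lg (bar u) : ℕ) : ZMod (q + 1)) = - ((lg u : ℕ) : ZMod (q + 1))
    rw [ths (bar u) (lg u * q) (by rw [hbar]; exact pow_ne_zero _ hu)
      (by rw [pow_mul, lgs u hu, hbar])]
    have : ((q + 1 : ℕ) : ZMod (q + 1)) = 0 := ZMod.natCast_self _
    push_cast at this ⊢
    linear_combination ((lg u : ℕ) : ZMod (q + 1)) * this
  · intro i
    refine ⟨(g : K) ^ i.val, pow_ne_zero _ g0, ?_⟩
    show ((lg ((g : K) ^ i.val) : ℕ) : ZMod (q + 1)) = i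
    rw [ths _ i.val (pow_ne_zero _ g0) rfl, ZMod.natCast_zmod_val]
  · intro u v hu hv
    show ((lg u : ℕ) : ZMod (q + 1)) = ((lg v : ℕ) : ZMod (q + 1)) ↔ _
    have h1 : (B.coord 0 u * B.coord 1 v - B.coord 1 u * B.coord 0 v = 0) ↔
        u * bar v = bar u * v := by
      rw [← sub_eq_zero (a := u * bar v), hwid, smul_eq_zero]
      constructor
      · exact fun h => Or.inl h
      · rintro (h | h)
        · exact h
        · exact absurd (sub_eq_zero.1 h).symm he
    rw [h1, ZMod.natCast_eq_natCast_iff]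
    have h2 : u * bar v = bar u * v ↔ u ^ (q - 1) = v ^ (q - 1) := by
      have e1 : ∀ x : K, x ^ q = x * x ^ (q - 1) := fun x => by
        rw [← pow_succ']; congr 1; omega
      rw [hbar, hbar, e1 u, e1 v]
      constructor
      · intro h
        have : (u * v) * v ^ (q - 1) = (u * v) * u ^ (q - 1) := by linear_combination h
        exact (mul_left_cancel₀ (mul_ne_zero hu hv) this).symm
      · intro h
        rw [h]; ring
    rw [h2]
    conv_rhs => rw [← lgs u hu, ← lgs v hv]
    rw [← pow_mul, ← pow_mul, gpow, mul_comm (lg u), mul_comm (lg v)]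
    constructor
    · intro h; exact h.mul_left' _
    · intro h; exact Nat.ModEq.mul_left_cancel' (by omega) h

theorem exists_stp (F : Type) [Field F] [Fintype F] : ∃ (K : Type) (_ : Field K) (_ : Algebra F K)
    (_ : Fintype K), Nonempty (Stp F K (Fintype.card F + 1)) := by
  obtain ⟨p, hp⟩ := CharP.exists F
  haveI : Fact p.Prime := ⟨CharP.char_is_prime F p⟩
  letI : Fintype (FiniteField.Extension F p 2) := Fintype.ofFinite _
  refine ⟨FiniteField.Extension F p 2, inferInstance, inferInstance, inferInstance, stp_of ?_⟩
  rw [← Nat.card_eq_fintype_card, FiniteField.natCard_extension, Nat.card_eq_fintype_card]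

theorem h4_of (F : Type) [Field F] [Fintype F] (h : 4 ≤ Fintype.card F) :
    ∀ a b c : F, ∃ u, u ≠ a ∧ u ≠ b ∧ u ≠ c := by
  intro a b c
  have h1 : ({a, b, c} : Finset F).card < (Finset.univ : Finset F).card :=
    lt_of_le_of_lt Finset.card_le_three (by rw [Finset.card_univ]; omega)
  obtain ⟨u, _, hu⟩ := Finset.exists_mem_notMem_of_card_lt_card h1
  simp only [Finset.mem_insert, Finset.mem_singleton, not_or] at hu
  exact ⟨u, hu⟩

theorem sq2_ind {F : Type} [Field F] (m : ℕ)
    (h : ∀ a b : Fˣ, m • sq2mk F a b = 0) (s : Sq2 F) : m • s = 0 := by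
  obtain ⟨t, rfl⟩ := Submodule.Quotient.mk_surjective _ s
  induction t using TensorProduct.induction_on with
  | zero => exact smul_zero _
  | tmul a b => exact h a.toMul b.toMul
  | add x y hx hy =>
    exact (smul_add m (Submodule.Quotient.mk x : Sq2 F) (Submodule.Quotient.mk y : Sq2 F)).trans
      ((congrArg₂ (fun a b : Sq2 F => a + b) hx hy).trans (add_zero (0 : Sq2 F)))

theorem tens_comm {A : Type} [AddCommGroup A] (x : A) (i j : ℤ) :
    ((i • x) ⊗ₜ[ℤ] (j • x) : TensorProduct ℤ A A) = (j • x) ⊗ₜ[ℤ] (i • x) := by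
  rw [TensorProduct.smul_tmul, TensorProduct.smul_tmul, smul_smul, smul_smul, mul_comm]

theorem sq2_two {F : Type} [Field F] [Fintype F] (s : Sq2 F) : 2 • s = 0 := by
  refine sq2_ind 2 (fun a b => ?_) s
  obtain ⟨g, hg⟩ := IsCyclic.exists_generator (α := Fˣ)
  obtain ⟨i, hi⟩ := Subgroup.mem_zpowers_iff.1 (hg a)
  obtain ⟨j, hj⟩ := Subgroup.mem_zpowers_iff.1 (hg b)
  have hsymm : (Additive.ofMul a ⊗ₜ[ℤ] Additive.ofMul b : TensorProduct ℤ (Additive Fˣ) (Additive Fˣ))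
      = Additive.ofMul b ⊗ₜ[ℤ] Additive.ofMul a := by
    rw [← hi, ← hj, ofMul_zpow, ofMul_zpow]
    exact tens_comm _ i j
  rw [two_nsmul]
  show (Submodule.Quotient.mk (Additive.ofMul a ⊗ₜ[ℤ] Additive.ofMul b +
    Additive.ofMul a ⊗ₜ[ℤ] Additive.ofMul b) : Sq2 F) = 0
  refine (Submodule.Quotient.mk_eq_zero _).2 (Submodule.subset_span ⟨Additive.ofMul a, Additive.ofMul b, ?_⟩)
  conv_lhs => rhs; rw [hsymm]

theorem sq2_card {F : Type} [Field F] [Fintype F] (s : Sq2 F) : (Fintype.card F - 1) • s = 0 := by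
  refine sq2_ind _ (fun a b => ?_) s
  have : (Fintype.card F - 1) • (Additive.ofMul a ⊗ₜ[ℤ] Additive.ofMul b :
      TensorProduct ℤ (Additive Fˣ) (Additive Fˣ)) = 0 := by
    rw [TensorProduct.smul_tmul', ← ofMul_pow, ← Fintype.card_units, pow_card_eq_one]
    simp
  show (Submodule.Quotient.mk ((Fintype.card F - 1) • (Additive.ofMul a ⊗ₜ[ℤ] Additive.ofMul b)) :
    Sq2 F) = 0
  rw [this]; rfl

theorem exists_L (F : Type) [Field F] [Fintype F] (two : (2 : F) ≠ 0) :
    ∃ L : Sq2 F →+ ZMod 2, ∀ a b : Fˣ, ¬ IsSquare (a : F) → ¬ IsSquare (b : F) →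
      L (sq2mk F a b) = 1 := by
  have hch : ringChar F ≠ 2 := by
    intro h
    apply two
    have := ringChar.Nat.cast_ringChar (R := F)
    rw [h] at this
    exact_mod_cast this
  let f : Fˣ → ZMod 2 := fun a => if quadraticChar F (a : F) = 1 then 0 else 1
  have fm : ∀ a b, f (a * b) = f a + f b := by
    intro a b
    simp only [f, Units.val_mul, map_mul]
    rcases quadraticChar_dichotomy a.ne_zero with h1 | h1 <;>
      rcases quadraticChar_dichotomy b.ne_zero with h2 | h2 <;> rw [h1, h2] <;> decide
  let l : Additive Fˣ →+ ZMod 2 := AddMonoidHom.mk' (fun a => f a.toMul) (fun a b => fm _ _)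
  let M : Additive Fˣ →ₗ[ℤ] Additive Fˣ →ₗ[ℤ] ZMod 2 :=
    LinearMap.mk₂ ℤ (fun a b => l a * l b) (by intros; rw [map_add, add_mul])
      (by intro c a b; rw [map_zsmul, smul_mul_assoc])
      (by intros; rw [map_add, mul_add])
      (by intro c a b; rw [map_zsmul, mul_smul_comm])
  let T := (TensorProduct.lift M).toAddMonoidHom.toIntLinearMap
  have hT : Submodule.span ℤ
      {w | ∃ a b : Additive Fˣ, w = a ⊗ₜ[ℤ] b + b ⊗ₜ[ℤ] a} ≤ LinearMap.ker T := by
    rw [Submodule.span_le]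
    rintro w ⟨a, b, rfl⟩
    show T _ = 0
    rw [map_add]
    show l a * l b + l b * l a = 0
    rw [mul_comm (l b), CharTwo.add_self_eq_zero]
  refine ⟨(Submodule.liftQ _ T hT).toAddMonoidHom, ?_⟩
  intro a b ha hb
  show l (Additive.ofMul a) * l (Additive.ofMul b) = 1
  have hf : ∀ a : Fˣ, ¬ IsSquare (a : F) → l (Additive.ofMul a) = 1 := by
    intro a ha
    show f a = 1
    simp only [f]
    rw [if_neg]
    rwa [quadraticChar_one_iff_isSquare a.ne_zero]
  rw [hf a ha, hf b hb, mul_one]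

theorem asm_even {P : Type} [AddCommGroup P] {N : ℕ} [NeZero N] (hN : Odd N)
    (tor : ∀ y : P, N • y = 0) (Φ Ψ : P →+ ZMod N) (h1 : ∀ y, Φ y = Ψ y + Ψ y)
    (h2 : ∃ c, Φ c = 2) (h3 : ∀ y, Φ y = 0 → 4 • y = 0) : Function.Bijective Ψ := by
  constructor
  · rw [injective_iff_map_eq_zero]
    intro y hy
    have h4 := h3 y (by rw [h1, hy, add_zero])
    have hd : addOrderOf y ∣ Nat.gcd 4 N :=
      Nat.dvd_gcd (addOrderOf_dvd_of_nsmul_eq_zero h4) (addOrderOf_dvd_of_nsmul_eq_zero (tor y))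
    have hc : Nat.Coprime 4 N := by
      have : Nat.Coprime (2 ^ 2) N := Nat.Coprime.pow_left 2 (Nat.coprime_two_left.2 hN)
      exact this
    rw [hc] at hd
    exact AddMonoid.addOrderOf_eq_one_iff.1 (Nat.dvd_one.1 hd)
  · obtain ⟨c, hc⟩ := h2
    rw [h1] at hc
    have hc1 : Ψ c = 1 := by
      obtain ⟨m, hm⟩ := hN
      have h0 : ((2 * m + 1 : ℕ) : ZMod N) = 0 := by rw [← hm]; exact ZMod.natCast_self _
      push_cast at h0
      linear_combination (-(m : ZMod N)) * hc + (Ψ c - 1) * h0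
    intro i
    refine ⟨i.val • c, ?_⟩
    rw [map_nsmul, hc1]
    simp

theorem asm_gen {P : Type} [AddCommGroup P] (g : P)
    (hg : ∀ y : P, ∃ (n : ℤ) (z : P), y = n • g + (2 : ℤ) • z) (k : ℕ) (y : P) :
    ∃ (n : ℤ) (z : P), y = n • g + ((2 : ℤ) ^ k) • z := by
  induction k with
  | zero => exact ⟨0, y, by simp⟩
  | succ k ih =>
    obtain ⟨n, z, h⟩ := ih
    obtain ⟨m, z', h'⟩ := hg z
    refine ⟨n + 2 ^ k * m, z', ?_⟩
    rw [h, h', smul_add, smul_smul, smul_smul, add_smul, pow_succ, add_assoc]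

theorem asm_odd_inj {P : Type} [AddCommGroup P] {N : ℕ} [NeZero N] (hN : Even N)
    (tor : ∀ y : P, N • y = 0) (Φ Ψ : P →+ ZMod N) (h1 : ∀ y, Φ y = Ψ y + Ψ y)
    (h2 : ∃ c, Φ c = 2) (h3 : ∀ y, Φ y = 0 → 4 • y = 0) (g : P)
    (hg : ∀ y : P, ∃ (n : ℤ) (z : P), y = n • g + (2 : ℤ) • z) (z : P) (hz : Ψ (2 • z) = 0) :
    2 • z = 0 := by
  have hΦ : Φ z = 0 := by rw [h1, ← map_add, ← two_nsmul, hz]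
  have hz4 := h3 z hΦ
  by_cases h4 : 4 ∣ N
  · obtain ⟨e, M, hM, hNM⟩ := Nat.exists_eq_two_pow_mul_odd (NeZero.ne N)
    obtain ⟨n, w, hw⟩ := asm_gen g hg e (2 • z)
    obtain ⟨t, ht⟩ := ZMod.intCast_surjective (Ψ g)
    have tor' : ∀ y : P, (N : ℤ) • y = 0 := fun y => by rw [natCast_zsmul]; exact tor y
    have hNz : (N : ℤ) = 2 ^ e * M := by rw [hNM]; push_cast; rfl
    have hMy : (M : ℤ) • (2 • z) = (M * n : ℤ) • g := by
      rw [hw, smul_add, smul_smul, smul_smul, mul_comm (M : ℤ) (2 ^ e), ← hNz, tor', add_zero]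
    have hodd : Odd t := by
      obtain ⟨c, hc⟩ := h2
      obtain ⟨m, v, hv⟩ := hg c
      obtain ⟨s, hs⟩ := ZMod.intCast_surjective (Ψ v)
      have e1 : ((2 * (m * t + 2 * s) - 2 : ℤ) : ZMod N) = 0 := by
        rw [h1, hv, map_add, map_zsmul, map_zsmul, ← ht, ← hs] at hc
        simp only [zsmul_eq_mul] at hc
        push_cast at hc ⊢
        linear_combination hc
      rw [ZMod.intCast_zmod_eq_zero_iff_dvd] at e1
      have e2 : (4 : ℤ) ∣ 2 * (m * t + 2 * s) - 2 := dvd_trans (by exact_mod_cast h4) e1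
      by_contra hne
      rw [Int.not_odd_iff_even] at hne
      obtain ⟨r, rfl⟩ := hne
      obtain ⟨d, hd⟩ := e2
      have : 2 * (2 * (m * r) + 2 * s) - 2 = 4 * d := by rw [← hd]; ring
      omega
    have hdv : (N : ℤ) ∣ M * n * t := by
      rw [← ZMod.intCast_zmod_eq_zero_iff_dvd]
      have := congrArg Ψ hMy
      rw [map_zsmul, hz, map_zsmul, ← ht, smul_zero, zsmul_eq_mul] at this
      push_cast at this ⊢
      exact this.symm
    have hdn : (2 : ℤ) ^ e ∣ n := by
      have hM0 : (M : ℤ) ≠ 0 := by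
        have := hM.pos
        exact_mod_cast this.ne'
      have h5 : (2 : ℤ) ^ e ∣ n * t := by
        rw [hNz, mul_comm, mul_assoc] at hdv
        exact (mul_dvd_mul_iff_left hM0).1 hdv
      have h6 : IsCoprime ((2 : ℤ) ^ e) t := IsCoprime.pow_left (Int.isCoprime_two_left.2 hodd)
      exact h6.dvd_of_dvd_mul_right h5
    have hMz : M • (2 • z) = 0 := by
      obtain ⟨d, rfl⟩ := hdn
      rw [← natCast_zsmul (2 • z) M, hMy, show (M * (2 ^ e * d) : ℤ) = d * N by rw [hNz]; ring, mul_smul,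
        tor', smul_zero]
    have h22 : 2 • (2 • z) = 0 := by rw [smul_smul]; exact hz4
    have hd : addOrderOf (2 • z) ∣ Nat.gcd 2 M :=
      Nat.dvd_gcd (addOrderOf_dvd_of_nsmul_eq_zero h22) (addOrderOf_dvd_of_nsmul_eq_zero hMz)
    rw [Nat.coprime_two_left.2 hM] at hd
    exact AddMonoid.addOrderOf_eq_one_iff.1 (Nat.dvd_one.1 hd)
  · have hd : addOrderOf z ∣ Nat.gcd 4 N :=
      Nat.dvd_gcd (addOrderOf_dvd_of_nsmul_eq_zero hz4) (addOrderOf_dvd_of_nsmul_eq_zero (tor z))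
    have h5 : Nat.gcd 4 N ∣ 2 := by
      obtain ⟨m, hm⟩ := hN
      have hm2 : N = 2 * m := by omega
      have hmo : Odd m := by
        rw [← Nat.not_even_iff_odd]
        rintro ⟨r, hr⟩
        exact h4 ⟨r, by omega⟩
      rw [hm2, show 4 = 2 * 2 from rfl, Nat.gcd_mul_left, Nat.coprime_two_left.2 hmo]
    exact addOrderOf_dvd_iff_nsmul_eq_zero.1 (hd.trans h5)

theorem asm_odd {P : Type} [AddCommGroup P] {N : ℕ} [NeZero N] (hN : Even N)
    (tor : ∀ y : P, N • y = 0) (Φ Ψ : P →+ ZMod N) (h1 : ∀ y, Φ y = Ψ y + Ψ y)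
    (h2 : ∃ c, Φ c = 2) (h3 : ∀ y, Φ y = 0 → 4 • y = 0) (g : P)
    (hg : ∀ y : P, ∃ (n : ℤ) (z : P), y = n • g + (2 : ℤ) • z) (B : AddSubgroup P)
    (hB : ∀ y, y ∈ B ↔ ∃ z, y = 2 • z) : Nonempty (B ≃+ ZMod (N / 2)) := by
  let j : B →+ ZMod N := Ψ.comp B.subtype
  have hj : Function.Injective j := by
    rw [injective_iff_map_eq_zero]
    rintro ⟨y, hy⟩ h
    obtain ⟨z, rfl⟩ := (hB y).1 hy
    exact Subtype.ext (asm_odd_inj hN tor Φ Ψ h1 h2 h3 g hg z h)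
  have hr : j.range = AddSubgroup.zmultiples (2 : ZMod N) := by
    ext i
    rw [AddMonoidHom.mem_range, AddSubgroup.mem_zmultiples_iff]
    constructor
    · rintro ⟨⟨y, hy⟩, rfl⟩
      obtain ⟨z, rfl⟩ := (hB y).1 hy
      obtain ⟨t, ht⟩ := ZMod.intCast_surjective (Ψ z)
      refine ⟨t, ?_⟩
      show t • (2 : ZMod N) = Ψ (2 • z)
      rw [map_nsmul, ← ht, zsmul_eq_mul, nsmul_eq_mul]
      push_cast; ring
    · rintro ⟨t, rfl⟩
      obtain ⟨c, hc⟩ := h2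
      refine ⟨⟨2 • (t • c), (hB _).2 ⟨_, rfl⟩⟩, ?_⟩
      show Ψ (2 • (t • c)) = _
      rw [two_nsmul, map_add, ← h1, map_zsmul, hc]
  have e1 : B ≃+ AddSubgroup.zmultiples (2 : ZMod N) :=
    (AddMonoidHom.ofInjective hj).trans (AddEquiv.addSubgroupCongr hr)
  have hcard : Nat.card (AddSubgroup.zmultiples (2 : ZMod N)) = N / 2 := by
    rw [Nat.card_zmultiples]
    have := ZMod.addOrderOf_coe 2 (NeZero.ne N)
    rw [Nat.gcd_eq_right hN.two_dvd] at this
    exact_mod_cast this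
  have e2 := zmodAddCyclicAddEquiv
    (inferInstance : IsAddCyclic (AddSubgroup.zmultiples (2 : ZMod N)))
  rw [hcard] at e2
  exact ⟨e1.trans e2.symm⟩

theorem main_thm (F : Type) [Field F] [Fintype F] (h4 : 4 ≤ Fintype.card F)
    (lam : PBloch F →ₗ[ℤ] Sq2 F)
    (hlam : ∀ (x : Fˣ) (hx : (x : F) ≠ 1),
      lam (pb _ x) = sq2mk _ (U _ (1 - (x : F)) (one_sub_ne hx)) x) :
    Nonempty (↥(LinearMap.ker lam) ≃+
      ZMod (if Odd (Fintype.card F) then (Fintype.card F + 1) / 2 else Fintype.card F + 1)) := by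
  have hh := h4_of F h4
  have tor : ∀ y : PBloch F, (Fintype.card F + 1) • y = 0 := by
    intro y
    induction y using pbf_induction with
    | hz => exact smul_zero _
    | hg x => exact BW.tors pbf_BW hh x
    | ha a b h1 h2 => rw [smul_add, h1, h2, add_zero]
    | hn a h1 => rw [smul_neg, h1, neg_zero]
  obtain ⟨K, _, _, _, ⟨S⟩⟩ := exists_stp F
  obtain ⟨Φ, Ψ, h1, h2, h3⟩ := S.summary hh (by omega) tor
  by_cases hodd : Odd (Fintype.card F)
  · rw [if_pos hodd]
    have two : (2 : F) ≠ 0 := by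
      intro h
      have hch : ringChar F = 2 := by
        have hd : ringChar F ∣ 2 := ringChar.dvd (by exact_mod_cast h)
        rcases (Nat.dvd_prime Nat.prime_two).1 hd with h | h
        · exact absurd h (CharP.ringChar_ne_one)
        · exact h
      have := FiniteField.even_card_iff_char_two.1 hch
      rw [Nat.odd_iff] at hodd
      omega
    obtain ⟨x0, hx0, hx1⟩ := exists_x0 F two
    have x00 : x0 ≠ 0 := by rintro rfl; exact hx0 ⟨0, by simp⟩
    have x01 : x0 ≠ 1 := by rintro rfl; exact hx0 ⟨1, by simp⟩
    have hg : ∀ y : PBloch F, ∃ (n : ℤ) (z : PBloch F), y = n • pbf x0 + (2 : ℤ) • z := by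
      intro y
      induction y using pbf_induction with
      | hz => exact ⟨0, 0, by simp⟩
      | hg x =>
        rcases BW.gen2 pbf_BW hh two x0 hx0 hx1 x with ⟨r, hr⟩ | ⟨r, hr⟩
        · exact ⟨0, r, by rw [hr, zero_smul, zero_add, two_zsmul]⟩
        · exact ⟨1, r, by rw [one_smul, two_zsmul, ← hr]; abel⟩
      | ha a b h1 h2 =>
        obtain ⟨n, z, rfl⟩ := h1
        obtain ⟨m, w, rfl⟩ := h2
        exact ⟨n + m, z + w, by rw [add_smul, smul_add]; abel⟩
      | hn a h1 =>
        obtain ⟨n, z, rfl⟩ := h1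
        exact ⟨-n, -z, by rw [neg_smul, smul_neg]; abel⟩
    obtain ⟨L, hL⟩ := exists_L F two
    have hl0 : L (lam (pbf x0)) = 1 := by
      have : pbf x0 = pb F (Units.mk0 x0 x00) := pbf_unit (Units.mk0 x0 x00)
      rw [this, hlam _ x01]
      exact hL _ _ hx1 hx0
    have hB : ∀ y, y ∈ (LinearMap.ker lam).toAddSubgroup ↔ ∃ z, y = 2 • z := by
      intro y
      show lam y = 0 ↔ _
      constructor
      · intro hy
        obtain ⟨n, z, rfl⟩ := hg y
        have e1 : ((n : ℤ) : ZMod 2) = 0 := by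
          have := congrArg L hy
          rw [map_add, map_smul, map_smul, map_add, map_zsmul, map_zsmul, hl0, map_zero,
            two_zsmul, CharTwo.add_self_eq_zero, add_zero, zsmul_eq_mul, mul_one] at this
          exact this
        rw [ZMod.intCast_zmod_eq_zero_iff_dvd] at e1
        obtain ⟨m, rfl⟩ := e1
        refine ⟨m • pbf x0 + z, ?_⟩
        push_cast
        rw [smul_add, two_zsmul, mul_smul, two_zsmul, two_nsmul, two_nsmul]
      · rintro ⟨z, rfl⟩
        rw [map_nsmul, sq2_two]
    exact asm_odd hodd.add_one tor Φ Ψ h1 h2 h3 (pbf x0) hg (LinearMap.ker lam).toAddSubgroup hB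
  · rw [if_neg hodd]
    have hev : Even (Fintype.card F) := Nat.not_odd_iff_even.1 hodd
    have hbij := asm_even hev.add_one tor Φ Ψ h1 h2 h3
    have hz : ∀ s : Sq2 F, s = 0 := by
      intro s
      have hd : addOrderOf s ∣ Nat.gcd 2 (Fintype.card F - 1) :=
        Nat.dvd_gcd (addOrderOf_dvd_of_nsmul_eq_zero (sq2_two s))
          (addOrderOf_dvd_of_nsmul_eq_zero (sq2_card s))
      have ho : Odd (Fintype.card F - 1) := by
        obtain ⟨m, hm⟩ := hev
        exact ⟨m - 1, by omega⟩
      rw [Nat.coprime_two_left.2 ho] at hd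
      exact AddMonoid.addOrderOf_eq_one_iff.1 (Nat.dvd_one.1 hd)
    let j : ↥(LinearMap.ker lam) →+ ZMod (Fintype.card F + 1) :=
      Ψ.comp (LinearMap.ker lam).toAddSubgroup.subtype
    refine ⟨AddEquiv.ofBijective j ⟨?_, ?_⟩⟩
    · intro a b hab
      exact Subtype.ext (hbij.1 hab)
    · intro i
      obtain ⟨y, hy⟩ := hbij.2 i
      exact ⟨⟨y, hz _⟩, hy⟩

/-- For every prime power `q = p^n`, the Bloch group `B(F_q)` — the
kernel of `λ : P(F_q) → S²(F_q^×)`, `[x] ↦ (1-x)∘x` — is cyclic of order `(q+1)/2` if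
`q` is odd, and of order `q+1` if `q` is even.  The conventional cases: `B(F₂)` is
cyclic of order 3, and `B(F₃)` is the subgroup of `P(F₃) = ℤ/4` generated by `2·[-1]`. -/
theorem statement2 (p n : ℕ) [Fact p.Prime] (hn : 0 < n) :
    (p ^ n = 2 → Nonempty ((ZMod 3) ≃+ ZMod (2 + 1))) ∧
    (p ^ n = 3 →
      Nonempty (↥(AddSubgroup.zmultiples ((2 : ZMod 4))) ≃+ ZMod ((3 + 1) / 2))) ∧
    (4 ≤ p ^ n →
      ∀ lam : PBloch (GaloisField p n) →ₗ[ℤ] Sq2 (GaloisField p n),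
        (∀ (x : (GaloisField p n)ˣ) (hx : ((x : GaloisField p n)) ≠ 1),
          lam (pb _ x) =
            sq2mk _ (U _ (1 - (x : GaloisField p n)) (one_sub_ne hx)) x) →
        Nonempty (↥(LinearMap.ker lam) ≃+
          ZMod (if Odd (p ^ n) then (p ^ n + 1) / 2 else p ^ n + 1))) := by
  refine ⟨fun _ => ⟨AddEquiv.refl _⟩, fun _ => ?_, ?_⟩
  · have hcard : Nat.card (AddSubgroup.zmultiples (2 : ZMod 4)) = (3 + 1) / 2 := by
      rw [Nat.card_zmultiples]
      have := ZMod.addOrderOf_coe 2 (n := 4) (by norm_num)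
      exact_mod_cast this
    have e2 := zmodAddCyclicAddEquiv
      (inferInstance : IsAddCyclic (AddSubgroup.zmultiples (2 : ZMod 4)))
    rw [hcard] at e2
    exact ⟨e2.symm⟩
  · intro h4 lam hlam
    let _ : Fintype (GaloisField p n) := Fintype.ofFinite _
    have hc : Fintype.card (GaloisField p n) = p ^ n := by
      rw [← Nat.card_eq_fintype_card, GaloisField.card p n hn.ne']
    have := main_thm (GaloisField p n) (by rw [hc]; exact h4) lam hlam
    rw [hc] at this
    exact this
end

section
/- Let F be a field with at least 4 elements. Then in qRP(F): (i) 3·C_F = 0, and (ii) for every x ∈ F^×∖{1}, ⟨⟨x⟩⟩·C_F = ⟨x−1⟩·⟨⟨−x⟩⟩·[x]. -/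
open scoped Classical

structure QAx {F R M : Type} [Field F] [CommRing R] [AddCommGroup M] [Module R M]
    (e : F → R) (b : F → M) (c : M) : Prop where
  zero : e 0 = 0
  one : e 1 = 1
  mul : ∀ x y, e (x * y) = e x * e y
  sq : ∀ x, x ≠ 0 → e x * e x = 1
  inv : ∀ x, e x⁻¹ = e x
  five : ∀ x y, x ≠ 0 → x ≠ 1 → y ≠ 0 → y ≠ 1 →
    b x - b y + e x • b (y * x⁻¹) - e (x⁻¹ - 1) • b ((1 - x⁻¹) / (1 - y⁻¹))
      + e (1 - x) • b ((1 - x) / (1 - y)) = 0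
  psi : ∀ x, x ≠ 0 → b x + e (-1) • b x⁻¹ = 0
  cc : ∀ x, x ≠ 0 → x ≠ 1 → c = b x + e (-1) • b (1 - x)

namespace QAx

variable {F R M : Type} [Field F] [CommRing R] [AddCommGroup M] [Module R M]
    {e : F → R} {b : F → M} {c : M}

def P (e : F → R) (b : F → M) (x : F) : M := (e (x - 1) * (e (-x) - 1)) • b x

theorem neg (h : QAx e b c) (x : F) : e (-x) = e (-1) * e x := by
  rw [← h.mul]; simp

theorem div (h : QAx e b c) (x y : F) : e (x / y) = e x * e y := by
  rw [div_eq_mul_inv, h.mul, h.inv]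

theorem ee (h : QAx e b c) : e (-1) * e (-1) = 1 := h.sq _ (by simp)

theorem e_c (h : QAx e b c) {x : F} (h0 : x ≠ 0) (h1 : x ≠ 1) : e (-1) • c = c := by
  have k1 := h.cc x h0 h1
  have k2 := h.cc (1 - x) (sub_ne_zero.mpr h1.symm) (by simpa using h0)
  rw [sub_sub_cancel] at k2
  linear_combination (norm := module) e (-1) • k1 - k2 + h.ee • b (1 - x)

theorem b_sub (h : QAx e b c) {x : F} (h0 : x ≠ 0) (h1 : x ≠ 1) :
    b (1 - x) = c - e (-1) • b x := by
  have k1 := h.cc x h0 h1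
  have k := h.e_c h0 h1
  linear_combination (norm := module) k - e (-1) • k1 - h.ee • b (1 - x)

theorem b_inv (h : QAx e b c) {x : F} (h0 : x ≠ 0) : b x⁻¹ = - (e (-1) • b x) := by
  have k1 := h.psi x h0
  linear_combination (norm := module) e (-1) • k1 - h.ee • b x⁻¹

theorem b_rot (h : QAx e b c) {x : F} (h0 : x ≠ 0) (h1 : x ≠ 1) :
    b (1 - x⁻¹) = c + b x := by
  rw [h.b_sub (inv_ne_zero h0) (by simpa using h1), h.b_inv h0]
  linear_combination (norm := module) h.ee • b x

theorem three_c (h : QAx e b c) {x : F} (h0 : x ≠ 0) (h1 : x ≠ 1) : (3 : R) • c = 0 := by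
  have hx : x - 1 ≠ 0 := sub_ne_zero.mpr h1
  have hx' : 1 - x ≠ 0 := sub_ne_zero.mpr h1.symm
  have k1 := h.b_rot h0 h1
  have e1 : 1 - x⁻¹ = (x - 1) / x := by field_simp
  have k2 := h.b_rot (x := 1 - x⁻¹) (by rw [e1]; positivity) (by simpa using h0)
  have e2 : 1 - (1 - x⁻¹)⁻¹ = (1 - x)⁻¹ := by rw [e1]; field_simp; ring
  have k3 := h.b_rot (x := (1 - x)⁻¹) (inv_ne_zero hx') (by simpa using h0)
  rw [e2] at k2
  rw [inv_inv, sub_sub_cancel] at k3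
  linear_combination (norm := module) - k1 - k2 - k3

theorem P_one (h : QAx e b c) : P e b 1 = 0 := by simp [P, h.zero]

theorem P_neg_one (h : QAx e b c) : P e b (-1) = 0 := by simp [P, h.one]

theorem P_inv (h : QAx e b c) {x : F} (h0 : x ≠ 0) : P e b x⁻¹ = - (e x • P e b x) := by
  have e1 : x⁻¹ - 1 = -((x - 1) / x) := by field_simp; ring
  unfold P
  rw [h.b_inv h0, e1, h.neg (_ / _), h.div, h.neg x⁻¹, h.inv, h.neg x]
  linear_combination (norm := module)
    (-(e (x-1) * e x * (e (-1) * e x - 1))) • (h.ee • b x)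

theorem P_aux (h : QAx e b c) {x y : F} (hx0 : x ≠ 0) (hx1 : x ≠ 1) (hy0 : y ≠ 0) (hy1 : y ≠ 1)
    (u w : F) (hu : u = y / x) (hw : w = (1 - x) / (1 - y)) :
    P e b (u * w) = P e b w + e w • P e b u := by
  have hx : 1 - x ≠ 0 := sub_ne_zero.mpr hx1.symm
  have hy : 1 - y ≠ 0 := sub_ne_zero.mpr hy1.symm
  have hx' : x - 1 ≠ 0 := sub_ne_zero.mpr hx1
  have hy' : y - 1 ≠ 0 := sub_ne_zero.mpr hy1
  have hu0 : u ≠ 0 := by rw [hu]; positivity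
  have hw0 : w ≠ 0 := by rw [hw]; positivity
  have s1 := h.five x y hx0 hx1 hy0 hy1
  have s2 := h.five y x hy0 hy1 hx0 hx1
  have v1 : (1 - x⁻¹) / (1 - y⁻¹) = u * w := by
    rw [hu, hw]
    have : 1 - y⁻¹ = (y - 1) / y := by field_simp
    rw [this]; field_simp; ring
  have v2 : (1 - y⁻¹) / (1 - x⁻¹) = (u * w)⁻¹ := by rw [← v1, inv_div]
  have u1 : y * x⁻¹ = u := by rw [hu, div_eq_mul_inv]
  have u2 : x * y⁻¹ = u⁻¹ := by rw [hu, inv_div, div_eq_mul_inv]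
  have w2 : (1 - y) / (1 - x) = w⁻¹ := by rw [hw, inv_div]
  have x3 : x⁻¹ - 1 = (1 - x) / x := by field_simp
  have y3 : y⁻¹ - 1 = (1 - y) / y := by field_simp
  rw [v1, u1, ← hw, x3, h.div] at s1
  rw [v2, u2, w2, y3, h.div, h.b_inv hu0, h.b_inv hw0, h.b_inv (mul_ne_zero hu0 hw0)] at s2
  have ru : u - 1 = (y - x) / x := by rw [hu]; field_simp
  have rw' : w - 1 = (y - x) / (1 - y) := by rw [hw]; field_simp; ring
  have rv : u * w - 1 = (y - x) / (x * (1 - y)) := by rw [hu, hw]; field_simp; ring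
  have eu : e u = e y * e x := by rw [hu, h.div]
  have ew : e w = e (1 - x) * e (1 - y) := by rw [hw, h.div]
  unfold P
  rw [ru, rw', rv, h.neg u, h.neg w, h.neg (u * w), h.div, h.div, h.div, h.mul, h.mul, eu, ew]
  have qx := h.sq x hx0
  have qy := h.sq y hy0
  have qx1 := h.sq _ hx
  have qy1 := h.sq _ hy
  generalize e x = X at *
  generalize e y = Y at *
  generalize e (1 - x) = X1 at *
  generalize e (1 - y) = Y1 at *
  generalize e (y - x) = Z at *
  generalize e (-1) = E at *
  have c1 : Z * (X * Y1) * (E * (Y * X * (X1 * Y1)) - 1)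
      = (Z * X1 * Y1) * (E * Y1 * Y - X1 * X) := by grind
  have c2 : Z * Y1 * (E * (X1 * Y1) - 1) = (Z * X1 * Y1) * (E * Y1 - X1) := by grind
  have c3 : X1 * Y1 * (Z * X * (E * (Y * X) - 1)) = (Z * X1 * Y1) * (E * Y - X) := by grind
  rw [smul_smul, c1, c2, c3]
  linear_combination (norm := module) (Z * X1 * Y1) • s1 + (Z * X1 * Y1) • s2

theorem P_mul (h : QAx e b c) {u w : F} (hu : u ≠ 0) (hw : w ≠ 0) :
    P e b (u * w) = P e b w + e w • P e b u := by
  by_cases u1 : u = 1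
  · subst u1; simp [h.P_one]
  by_cases w1 : w = 1
  · subst w1; simp [h.P_one, h.one]
  by_cases uw : u * w = 1
  · have : w = u⁻¹ := by rw [eq_comm]; exact inv_eq_of_mul_eq_one_right uw
    rw [uw, h.P_one, this, h.P_inv hu, h.inv]; simp
  have q : u * w - 1 ≠ 0 := sub_ne_zero.mpr uw
  have q' : w * u - 1 ≠ 0 := by rwa [mul_comm]
  have w1' : w - 1 ≠ 0 := sub_ne_zero.mpr w1
  have u1' : u - 1 ≠ 0 := sub_ne_zero.mpr u1
  have d : 1 - u * ((w - 1) / (u * w - 1)) = (u - 1) / (u * w - 1) := by field_simp; ring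
  have d' : 1 - ((w - 1) / (u * w - 1)) = w * (u - 1) / (u * w - 1) := by field_simp; ring
  refine h.P_aux (x := (w - 1) / (u * w - 1)) (y := u * ((w - 1) / (u * w - 1)))
    (by positivity) (fun hh => ?_) (by positivity) (fun hh => ?_) u w ?_ ?_
  · rw [hh] at d'
    have : w * (u - 1) / (u * w - 1) ≠ 0 := by positivity
    exact this (by rw [← d']; ring)
  · rw [hh] at d
    have : (u - 1) / (u * w - 1) ≠ 0 := by positivity
    exact this (by rw [← d]; ring)
  · field_simp
  · rw [d, d']; field_simp

theorem e_P (h : QAx e b c) {x : F} (h0 : x ≠ 0) : e (-1) • P e b x = P e b x := by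
  have k1 := h.P_mul (u := x) (w := -1) h0 (by simp)
  have k2 := h.P_mul (u := -1) (w := x) (by simp) h0
  rw [mul_comm] at k2
  rw [k2, h.P_neg_one] at k1
  simpa using k1.symm

theorem P_neg (h : QAx e b c) {x : F} (h0 : x ≠ 0) : P e b (-x) = P e b x := by
  have k2 := h.P_mul (u := -1) (w := x) (by simp) h0
  rw [h.P_neg_one] at k2
  simpa using k2

theorem P_eq (h : QAx e b c) (x : F) :
    P e b x = (e (-1) * e (1 - x) * (e (-1) * e x - 1)) • b x := by
  unfold P
  rw [h.neg x, ← neg_sub 1 x, h.neg (1 - x)]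

theorem e_sub_inv (h : QAx e b c) {x : F} (h0 : x ≠ 0) :
    e (1 - x⁻¹) = e (-1) * e (1 - x) * e x := by
  have : 1 - x⁻¹ = (-(1 - x)) / x := by field_simp; ring
  rw [this, h.div, h.neg]

theorem x_P (h : QAx e b c) {x : F} (h0 : x ≠ 0) : e x • P e b x = - P e b x := by
  have k := h.e_P h0
  rw [h.P_eq] at *
  have := h.sq x h0
  have := h.ee
  generalize e x = X at *
  generalize e (1 - x) = X1 at *
  generalize e (-1) = E at *
  have c1 : X * (E * X1 * (E * X - 1)) = - (E * (E * X1 * (E * X - 1))) := by grind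
  rw [smul_smul, c1, neg_smul, ← smul_smul, k]

/-- the relation for the rotation -/
theorem relA (h : QAx e b c) {x : F} (h0 : x ≠ 0) (h1 : x ≠ 1) :
    P e b (1 - x) = P e b x + e x • P e b (1 - x⁻¹) := by
  have hx : 1 - x ≠ 0 := sub_ne_zero.mpr h1.symm
  have e1 : 1 - x⁻¹ ≠ 0 := sub_ne_zero.mpr (by simpa [eq_comm] using h1)
  have k := h.P_mul e1 h0
  rw [← k, ← h.P_neg hx]
  congr 1; field_simp; ring

theorem P_sub (h : QAx e b c) {x : F} (h0 : x ≠ 0) (h1 : x ≠ 1) :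
    P e b (1 - x) = (e (-1) * e x * (e (-1) * e (1 - x) - 1)) • (c - e (-1) • b x) := by
  rw [h.P_eq, h.b_sub h0 h1, sub_sub_cancel]

theorem P_rot (h : QAx e b c) {x : F} (h0 : x ≠ 0) (h1 : x ≠ 1) :
    P e b (1 - x⁻¹) = (e (-1) * e x * (e (1 - x) * e x - 1)) • (c + b x) := by
  rw [h.P_eq, h.b_rot h0 h1, sub_sub_cancel, h.inv, h.e_sub_inv h0]
  congr 1
  linear_combination (e (-1) * e x * e (1 - x) * e x) * h.ee

theorem four_P (h : QAx e b c) {x : F} (h0 : x ≠ 0) (h1 : x ≠ 1) :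
    (e x - 1) • c = (4 : R) • P e b x := by
  have hx : 1 - x ≠ 0 := sub_ne_zero.mpr h1.symm
  have k := h.relA h0 h1
  have k1 := h.e_P h0
  have k2 := h.x_P h0
  have k3 := h.three_c h0 h1
  have k4 := h.e_c h0 h1
  rw [h.P_sub h0 h1, h.P_rot h0 h1] at k
  have qx := h.sq x h0
  have qx1 := h.sq _ hx
  have qE := h.ee
  have kP := h.P_eq x
  generalize P e b x = p at *
  generalize e x = X at *
  generalize e (1 - x) = X1 at *
  generalize e (-1) = E at *
  have A : -((X - 1) • c) = p + (2 * E * X * X1 - X - E) • b x := by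
    have c1 : E * X * (E * X1 - 1) = X * X1 - X * E := by grind
    have c2 : X * (E * X * (X1 * X - 1)) = E * X * X1 - E := by grind
    rw [smul_smul, c1, c2] at k
    linear_combination (norm := module) k - qE • (X • b x) + (X * X1 - 1 + X) • k4
  have E2 : -((X - 1) • c) = p + (2 * X * X1 - E * X - 1) • b x := by
    linear_combination (norm := module) E • A + (X - 1) • k4 + k1 + (2 * X * X1 - 1) • (qE • b x)
  have A3 : (X - 1) • c = - p + (2 * E * X1 - E * X - 1) • b x := by
    linear_combination (norm := module) X • A + k2 + (2 * E * X1 - 1) • (qx • b x) + qx • c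
  have kP' : p = (X * X1 - E * X1) • b x := by
    linear_combination (norm := module) kP + (X * X1) • (qE • b x)
  linear_combination (norm := module) (X - 1) • k3 - A3 + E2 - (2 : R) • kP'

section two

variable {a : F → M}

theorem d_facts (h : QAx e a 0) {x : F} (h0 : x ≠ 0) (h1 : x ≠ 1) :
    ((e (-1) - 1) * e x) • a x = - ((e (-1) - 1) • a x) ∧
    ((e (-1) - 1) * e (1 - x)) • a x = - ((e (-1) - 1) • a x) ∧
    (e x + e (-1) - 2 * e (-1) * e x * e (1 - x) - e x * e (1 - x) + e (-1) * e (1 - x)) • a x = 0 ∧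
    P e a x = (e x * e (1 - x) - e (-1) * e (1 - x)) • a x := by
  have hx : 1 - x ≠ 0 := sub_ne_zero.mpr h1.symm
  have e1 : 1 - x⁻¹ ≠ 0 := sub_ne_zero.mpr (by simpa [eq_comm] using h1)
  have k := h.relA h0 h1
  have k1 := h.e_P h0
  have k2 := h.e_P hx
  have k3 := h.e_P e1
  have qx := h.sq x h0
  have qx1 := h.sq _ hx
  have qE := h.ee
  have p1 := h.P_eq x
  have p2 := h.P_sub h0 h1
  have p3 := h.P_rot h0 h1
  generalize P e a x = p at *
  generalize P e a (1 - x) = p' at *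
  generalize P e a (1 - x⁻¹) = p'' at *
  generalize e x = X at *
  generalize e (1 - x) = X1 at *
  generalize e (-1) = E at *
  have r1 : p = (X * X1 - E * X1) • a x := by
    linear_combination (norm := module) p1 + (X * X1) • (qE • a x)
  have r2 : p' = (X - E * X * X1) • a x := by
    linear_combination (norm := module) p2 + (X - E * X * X1) • (qE • a x)
  have r3 : p'' = (E * X1 - E * X) • a x := by
    linear_combination (norm := module) p3 + (E * X1) • (qx • a x)
  have i1 : ((E - 1) * X * X1 + (E - 1) * X1) • a x = 0 := by
    linear_combination (norm := module) k1 + (1 - E) • r1 + X1 • (qE • a x)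
  have i2 : ((E - 1) * X + (E - 1) * X * X1) • a x = 0 := by
    linear_combination (norm := module) k2 + (1 - E) • r2 + (X * X1) • (qE • a x)
  have i3 : ((E - 1) * X  - (E - 1) * X1) • a x = 0 := by
    linear_combination (norm := module) k3 + (1 - E) • r3 + (X - X1) • (qE • a x)
  have f2 : ((E - 1) * X1) • a x = - ((E - 1) • a x) := by
    linear_combination (norm := module) X • i2 - ((E - 1) * (1 + X1)) • (qx • a x)
  refine ⟨?_, f2, ?_, r1⟩
  · linear_combination (norm := module) f2 + i3
  · linear_combination (norm := module) k - r2 + r1 + X • r3 - E • (qx • a x)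

theorem D_eq (h : QAx e a 0) {s : F} (h0 : s ≠ 0) (h1 : s ≠ 1) (h2 : s ≠ -1) :
    a (s * s) = (1 + e s) • a s + (e (1 - s) * (e s * e (-1) + 1)) • a (-s) := by
  have hs : 1 - s ≠ 0 := sub_ne_zero.mpr h1.symm
  have hs' : s - 1 ≠ 0 := sub_ne_zero.mpr h1
  have hs2 : 1 + s ≠ 0 := fun hh => h2 (by linear_combination hh)
  have hss : s * s - 1 ≠ 0 := by
    have : s * s - 1 = (s - 1) * (1 + s) := by ring
    rw [this]; positivity
  have hss' : 1 - s * s ≠ 0 := by rw [← neg_sub]; exact neg_ne_zero.mpr hss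
  have k := h.five s (s * s) h0 h1 (by positivity) (sub_ne_zero.mp hss)
  have v1 : s * s * s⁻¹ = s := by field_simp
  have v3 : (1 - s) / (1 - s * s) = (1 + s)⁻¹ := by
    have : 1 - s * s = (1 - s) * (1 + s) := by ring
    rw [this]; field_simp
  have v2 : (1 - s⁻¹) / (1 - (s * s)⁻¹) = 1 - (1 + s)⁻¹ := by
    have : 1 - (s * s)⁻¹ = (s - 1) * (1 + s) / (s * s) := by field_simp; ring
    rw [this]; field_simp; ring
  have w1 : s⁻¹ - 1 = (1 - s) / s := by field_simp
  have w2 := h.b_sub (x := -s) (by simpa using h0) (by rw [Ne, neg_eq_iff_eq_neg]; exact h2)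
  rw [sub_neg_eq_add] at w2
  rw [v1, v2, v3, w1, h.div, h.b_rot hs2 (by simpa using h0), h.b_inv hs2, w2] at k
  have qE := h.ee
  linear_combination (norm := module) - k + e (1 - s) • (qE • a (-s))

theorem s_D (h : QAx e a 0) {s : F} (h0 : s ≠ 0) (h1 : s ≠ 1) (h2 : s ≠ -1) :
    (e s - 1) • a (s * s) = 0 := by
  rw [h.D_eq h0 h1 h2]
  have qE := h.ee
  have qs := h.sq s h0
  obtain ⟨f, -⟩ := h.d_facts (x := -s) (by simpa using h0)
    (by rw [Ne, neg_eq_iff_eq_neg]; exact h2)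
  rw [h.neg s] at f
  linear_combination (norm := module) qs • a s + (e (1 - s) * e (-1)) • (qs • a (-s))
    + e (1 - s) • f - (e (1 - s) * e s) • (qE • a (-s))

theorem fix1 (h : QAx e a 0) {x : F} (h0 : x ≠ 0) (h1 : x ≠ 1) :
    (e x * e (1 - x) - 1) • ((1 + e (-1)) • a x) = 0 := by
  have hx : 1 - x ≠ 0 := sub_ne_zero.mpr h1.symm
  have qx := h.sq x h0
  have qx1 := h.sq _ hx
  by_cases hh : 1 - x = x
  · rw [hh, qx]; simp
  have k := h.five x (1 - x) h0 h1 hx (by simpa using h0)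
  have v1 : (1 - x⁻¹) / (1 - (1 - x)⁻¹) = (1 - x) * x⁻¹ * ((1 - x) * x⁻¹) := by
    have : 1 - (1 - x)⁻¹ = -x / (1 - x) := by field_simp; ring
    rw [this]; field_simp; ring
  have v2 : (1 - x) / (1 - (1 - x)) = (1 - x) * x⁻¹ := by rw [sub_sub_cancel, div_eq_mul_inv]
  have w1 : x⁻¹ - 1 = (1 - x) / x := by field_simp
  have z := h.s_D (s := (1 - x) * x⁻¹) (by positivity)
    (by rw [← div_eq_mul_inv, Ne, div_eq_one_iff_eq h0]; exact hh)
    (by rw [← div_eq_mul_inv, Ne, div_eq_iff h0]; intro h'; exact one_ne_zero (by linear_combination h'))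
  rw [v1, v2, w1, h.div, h.b_sub h0 h1] at k
  rw [h.mul, h.inv] at z
  generalize (1 - x) * x⁻¹ = s at *
  linear_combination (norm := module) (e x * e (1 - x) - 1) • k + (e (1 - x) * e x) • z
    - e (1 - x) • (qx • a s) - e x • (qx1 • a s)

theorem fix2 (h : QAx e a 0) {x : F} (h0 : x ≠ 0) (h1 : x ≠ 1) :
    (e x) • ((1 + e (-1)) • a x) = (1 + e (-1)) • a x ∧
    (e (1 - x)) • ((1 + e (-1)) • a x) = (1 + e (-1)) • a x := by
  have hx : 1 - x ≠ 0 := sub_ne_zero.mpr h1.symm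
  have qx := h.sq x h0
  have qx1 := h.sq _ hx
  have qE := h.ee
  have k1 := h.fix1 h0 h1
  have k2 := h.fix1 (x := x⁻¹) (by positivity) (by simpa using h1)
  rw [h.e_sub_inv h0, h.inv, h.b_inv h0] at k2
  have f : (e (1 - x)) • ((1 + e (-1)) • a x) = (1 + e (-1)) • a x := by
    linear_combination (norm := module) - k2 + (1 - e (1 - x) * e x * e x * (1 + e (-1))) • (qE • a x)
      - (e (1 - x) * (1 + e (-1))) • (qx • a x)
  refine ⟨?_, f⟩
  linear_combination (norm := module) k1 - e x • f

theorem x_a (h : QAx e a 0) {x : F} (h0 : x ≠ 0) (h1 : x ≠ 1) :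
    e x • a x = e (-1) • a x + P e a x ∧ (2 : R) • P e a x = 0 := by
  have hx : 1 - x ≠ 0 := sub_ne_zero.mpr h1.symm
  have qx := h.sq x h0
  have qE := h.ee
  obtain ⟨g1, g2⟩ := h.fix2 h0 h1
  obtain ⟨f1, f2, r, p⟩ := h.d_facts h0 h1
  generalize P e a x = p at *
  generalize e x = X at *
  generalize e (1 - x) = X1 at *
  generalize e (-1) = E at *
  have t1 : (2 * X) • a x = (2 * E) • a x := by
    linear_combination (norm := module) g1 - f1
  have t2 : (2 * X1) • a x = (2 * E) • a x := by
    linear_combination (norm := module) g2 - f2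
  constructor
  · linear_combination (norm := module) r - p + (E * X1) • t1 + t2 + (2 * X1) • (qE • a x)
  · linear_combination (norm := module) (2 : R) • p + X1 • t1

theorem y_a (h : QAx e a 0) {x : F} (h0 : x ≠ 0) (h1 : x ≠ 1) :
    e (1 - x) • a x = e (-1) • a x - P e a (1 - x) := by
  have hx : 1 - x ≠ 0 := sub_ne_zero.mpr h1.symm
  have qE := h.ee
  obtain ⟨k, -⟩ := h.x_a hx (by simpa using h0)
  have k2 := h.e_P hx
  rw [h.b_sub h0 h1] at k
  linear_combination (norm := module) - e (-1) • k - k2 - (e (1 - x) - e (-1)) • (qE • a x)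

theorem two_P (h : QAx e a 0) {x : F} (h0 : x ≠ 0) : (2 : R) • P e a x = 0 := by
  by_cases h1 : x = 1
  · subst h1; rw [h.P_one]; simp
  exact (h.x_a h0 h1).2

theorem comm (h : QAx e a 0) {x y : F} (h0 : x ≠ 0) (h1 : y ≠ 0) :
    (e x - 1) • P e a y = (e y - 1) • P e a x := by
  have k1 := h.P_mul h0 h1
  have k2 := h.P_mul h1 h0
  rw [mul_comm] at k2
  linear_combination (norm := module) k1 - k2

theorem P_mul_sq (h : QAx e a 0) {u w : F} (hu : u ≠ 0) (hw : w ≠ 0) :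
    P e a (u * u * w) = P e a w := by
  have k1 := h.P_mul (u := u * u) (by positivity) hw
  have k2 := h.P_mul hu hu
  have k3 := h.x_P hu
  rw [k1, k2, k3]; simp

theorem P_one_sub_sq (h : QAx e a 0) {s : F} (h0 : s ≠ 0) (h1 : s ≠ 1) (h2 : s ≠ -1) :
    P e a (1 - s * s) = 0 := by
  have hs : 1 - s ≠ 0 := sub_ne_zero.mpr h1.symm
  have hs2 : 1 + s ≠ 0 := fun hh => h2 (by linear_combination hh)
  have n0 : -s ≠ 0 := by simpa using h0
  have n1 : -s ≠ 1 := by rw [Ne, neg_eq_iff_eq_neg]; exact h2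
  have n2 : -s ≠ -1 := by simpa using h1
  have ef : 1 - s * s = (1 - s) * (1 + s) := by ring
  have hss : 1 - s * s ≠ 0 := by rw [ef]; positivity
  have d1 := h.D_eq h0 h1 h2
  have d2 := h.D_eq n0 n1 n2
  have x1 := (h.x_a h0 h1).1
  have x2 := (h.x_a n0 n1).1
  have p2 := h.two_P h0
  have b1 := (h.fix2 h0 h1).2
  have b2 := (h.fix2 n0 n1).2
  have z := h.s_D h0 h1 h2
  have y := h.y_a (x := s * s) (by positivity) (fun hh => hss (by rw [hh]; ring))
  have cm := h.comm h0 hss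
  have eP := h.e_P h0
  have eP2 := h.e_P hss
  have qE := h.ee
  have qb := h.sq _ hs
  have qb' := h.sq _ hs2
  rw [h.P_neg h0, h.neg s] at x2
  rw [h.neg s, neg_neg, neg_mul_neg] at d2
  rw [sub_neg_eq_add] at d2 b2
  rw [ef, h.mul, ← ef] at y cm
  generalize P e a s = p at *
  generalize P e a (1 - s * s) = q at *
  generalize a (s * s) = D at *
  generalize a s = A at *
  generalize a (-s) = A' at *
  generalize e s = X at *
  generalize e (1 - s) = B at *
  generalize e (1 + s) = B' at *
  generalize e (-1) = E at *
  have D1 : D = (1 + E) • A + B • ((1 + E) • A') + (B + 1) • p := by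
    linear_combination (norm := module) d1 + x1 + B • x2
  have D2 : D = (1 + E) • A' + B' • ((1 + E) • A) + (B' + 1) • p := by
    linear_combination (norm := module) d2 + x2 + B' • x1 + (B' * X) • (qE • A)
  have ED : E • D = D := by
    linear_combination (norm := module) (E - 1) • D1 + qE • A + B • (qE • A') + (B + 1) • eP
  have cm' : (B * B' - 1) • p = 0 := by
    linear_combination (norm := module) (X - 1) • y - (B * B' - E) • z - cm
  have BD : (B * B') • D = D := by
    linear_combination (norm := module) (B * B') • D1 - D2 + B' • b1 + b2 +
      B' • (qb • ((1 + E) • A')) + B' • (qb • p) + cm'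
  linear_combination (norm := module) y - BD + ED

theorem P_zero (h : QAx e a 0) {x : F} (h0 : x ≠ 0) : P e a x = 0 := by
  by_cases h1 : x = 1
  · subst h1; exact h.P_one
  by_cases h2 : x = -1
  · subst h2; exact h.P_neg_one
  have x1 : x - 1 ≠ 0 := sub_ne_zero.mpr h1
  have x2 : x + 1 ≠ 0 := fun hh => h2 (by linear_combination hh)
  by_cases ch : (2 : F) = 0
  · have en : (-1 : F) = 1 := by linear_combination - ch
    have key : ∀ z : F, z ≠ 0 → z ≠ 1 → P e a (1 - z⁻¹) = 0 := by
      intro x h0 h1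
      have hx : 1 - x ≠ 0 := sub_ne_zero.mpr h1.symm
      have k := h.five x (1 - x) h0 h1 hx (by simpa using h0)
      have sg : (1 - x) * x⁻¹ = 1 - x⁻¹ := by
        field_simp; linear_combination (1 - x) * ch
      have v1 : (1 - x⁻¹) / (1 - (1 - x)⁻¹) = (1 - x⁻¹) * (1 - x⁻¹) := by
        rw [← sg]
        have : 1 - (1 - x)⁻¹ = -x / (1 - x) := by field_simp; ring
        rw [this, sg]; field_simp; ring
      have v2 : (1 - x) / (1 - (1 - x)) = 1 - x⁻¹ := by
        rw [sub_sub_cancel, div_eq_mul_inv, sg]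
      have w1 : x⁻¹ - 1 = (1 - x) / x := by field_simp
      have s0 : 1 - x⁻¹ ≠ 0 := sub_ne_zero.mpr (by simpa [eq_comm] using h1)
      have s1 : 1 - x⁻¹ ≠ 1 := by simpa using h0
      have s2 : 1 - x⁻¹ ≠ -1 := by rw [en]; exact s1
      have z := h.s_D s0 s1 s2
      have d := h.D_eq s0 s1 s2
      have ng : -(1 - x⁻¹) = 1 - x⁻¹ := by linear_combination (x⁻¹ - 1) * ch
      have p := h.P_rot h0 h1
      have qx := h.sq x h0
      rw [v1, v2, w1, h.div, sg, h.b_sub h0 h1, h.b_rot h0 h1, en, h.one] at k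
      rw [ng, sub_sub_cancel, h.inv, h.e_sub_inv h0, en, h.one, h.b_rot h0 h1] at d
      rw [h.e_sub_inv h0, en, h.one] at z
      rw [en, h.one] at p
      generalize a ((1 - x⁻¹) * (1 - x⁻¹)) = D at *
      generalize a x = A at *
      generalize e x = X at *
      generalize e (1 - x) = X1 at *
      linear_combination (norm := module) p - X • k - X • z - X • d - (X * X1) • (qx • A)
    have := key (1 - x)⁻¹ (inv_ne_zero (sub_ne_zero.mpr (Ne.symm h1))) (by simpa using h0)
    simpa using this
  · have e1 : x = (1 / 2) * (1 / 2) * ((x + 1) * (x + 1) *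
        (1 - ((x - 1) / (x + 1)) * ((x - 1) / (x + 1)))) := by
      field_simp; ring
    have t0 : (x - 1) / (x + 1) ≠ 0 := by positivity
    have t1 : (x - 1) / (x + 1) ≠ 1 := by
      rw [Ne, div_eq_one_iff_eq x2]; intro hh; exact ch (by linear_combination - hh)
    have t2 : (x - 1) / (x + 1) ≠ -1 := by
      rw [Ne, div_eq_iff x2]; intro hh
      exact mul_ne_zero ch h0 (by linear_combination hh)
    have k := h.P_one_sub_sq t0 t1 t2
    have n : (1 - ((x - 1) / (x + 1)) * ((x - 1) / (x + 1))) ≠ 0 := by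
      intro hh; rw [hh] at e1; exact h0 (by rw [e1]; ring)
    rw [e1, h.P_mul_sq (by simpa using ch) (mul_ne_zero (by positivity) n),
      h.P_mul_sq x2 n, k]

end two


theorem main (h : QAx e b c) {x : F} (h0 : x ≠ 0) (h1 : x ≠ 1) :
    (e x - 1) • c = P e b x := by
  have h3 : QAx e (fun x => (3 : R) • b x) 0 :=
    { zero := h.zero
      one := h.one
      mul := h.mul
      sq := h.sq
      inv := h.inv
      five := fun x y hx hx1 hy hy1 => by
        have := h.five x y hx hx1 hy hy1
        linear_combination (norm := module) (3 : R) • this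
      psi := fun x hx => by
        have := h.psi x hx
        linear_combination (norm := module) (3 : R) • this
      cc := fun x hx hx1 => by
        have := h.cc x hx hx1
        have := h.three_c hx hx1
        linear_combination (norm := module) (3 : R) • h.cc x hx hx1 - this }
  have k := h3.P_zero h0
  have k4 := h.four_P h0 h1
  unfold P at *
  linear_combination (norm := module) k4 + k

end QAx

noncomputable def eF (F : Type) [Field F] (x : F) : RF F :=
  if h : x ≠ 0 then cls F (U F x h) else 0

noncomputable def bF (F : Type) [Field F] (x : F) : qRP F :=
  if h : x ≠ 0 then qrp F (U F x h) else 0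

theorem eF_ne {F : Type} [Field F] (x : F) (h : x ≠ 0) : eF F x = cls F (U F x h) := dif_pos h

theorem bF_ne {F : Type} [Field F] (x : F) (h : x ≠ 0) : bF F x = qrp F (U F x h) := dif_pos h

theorem cls_mul' {F : Type} [Field F] (x y : Fˣ) : cls F (x * y) = cls F x * cls F y := by
  simp [cls]

theorem cls_one' {F : Type} [Field F] : cls F (1 : Fˣ) = 1 := by
  simp only [cls, map_one]

theorem cls_sq {F : Type} [Field F] (x : Fˣ) : cls F x * cls F x = 1 := by
  rw [← cls_mul']
  have : sqc F (x * x) = 1 := by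
    refine (QuotientGroup.eq_one_iff _).mpr ⟨x, ?_⟩
    simp [pow_two]
  rw [cls, this, map_one]

theorem qrp_rel {F : Type} [Field F] (w : FreeRP F) (hw : w ∈ ftRels F ∪ psiRels F) :
    (Submodule.Quotient.mk w : FreeRP F ⧸ Submodule.span (RF F) (ftRels F ∪ psiRels F)) = 0 :=
  (Submodule.Quotient.mk_eq_zero _).mpr (Submodule.subset_span hw)

theorem qrp_psi {F : Type} [Field F] (x : Fˣ) : qrp F x + cls F (-1) • qrp F x⁻¹ = 0 :=
  qrp_rel _ (Or.inr ⟨x, rfl⟩)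

theorem qrp_five {F : Type} [Field F] (x y : Fˣ) (hx : (x : F) ≠ 1) (hy : (y : F) ≠ 1) :
    qrp F x - qrp F y + cls F x • qrp F (y * x⁻¹)
    - cls F (U F ((x : F)⁻¹ - 1) (inv_sub_one_ne hx)) •
        qrp F (U F ((1 - (x : F)⁻¹) / (1 - (y : F)⁻¹))
          (div_ne_zero (one_sub_inv_ne hx) (one_sub_inv_ne hy)))
    + cls F (U F (1 - (x : F)) (one_sub_ne hx)) •
        qrp F (U F ((1 - (x : F)) / (1 - (y : F)))
          (div_ne_zero (one_sub_ne hx) (one_sub_ne hy))) = 0 :=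
  qrp_rel _ (Or.inl ⟨x, y, hx, hy, rfl⟩)

theorem eF_unit {F : Type} [Field F] (x : Fˣ) : eF F x = cls F x := by
  rw [eF_ne _ x.ne_zero]; congr 1; ext; rfl

theorem bF_unit {F : Type} [Field F] (x : Fˣ) : bF F x = qrp F x := by
  rw [bF_ne _ x.ne_zero]; congr 1; ext; rfl

theorem eF_neg_one {F : Type} [Field F] : eF F (-1) = cls F (-1) := by
  rw [← eF_unit]; simp

theorem eF_mul {F : Type} [Field F] (x y : F) : eF F (x * y) = eF F x * eF F y := by
  by_cases hx : x = 0
  · subst hx; simp [eF]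
  by_cases hy : y = 0
  · subst hy; simp [eF]
  lift x to Fˣ using IsUnit.mk0 x hx
  lift y to Fˣ using IsUnit.mk0 y hy
  rw [← Units.val_mul, eF_unit, eF_unit, eF_unit, cls_mul']

theorem eF_sq {F : Type} [Field F] (x : F) (hx : x ≠ 0) : eF F x * eF F x = 1 := by
  rw [eF_ne x hx, cls_sq]

theorem eF_one {F : Type} [Field F] : eF F 1 = 1 := by
  have := eF_unit (1 : Fˣ)
  rwa [cls_one', Units.val_one] at this

theorem eF_inv {F : Type} [Field F] (x : F) : eF F x⁻¹ = eF F x := by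
  by_cases hx : x = 0
  · subst hx; simp
  have h1 := eF_sq x hx
  have h2 := eF_mul x x⁻¹
  rw [mul_inv_cancel₀ hx, eF_one] at h2
  calc eF F x⁻¹ = (eF F x * eF F x) * eF F x⁻¹ := by rw [h1, one_mul]
    _ = eF F x := by rw [mul_assoc, ← h2, mul_one]

theorem qax_F (F : Type) [Field F] (c : qRP F)
    (hc : ∀ (x : Fˣ) (hx : (x : F) ≠ 1),
      c = qrp F x + cls F (-1) • qrp F (U F (1 - (x : F)) (one_sub_ne hx))) :
    QAx (eF F) (bF F) c where
  zero := by simp [eF]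
  one := eF_one
  mul := eF_mul
  sq := eF_sq
  inv := eF_inv
  five := by
    intro x y hx hx1 hy hy1
    lift x to Fˣ using IsUnit.mk0 x hx
    lift y to Fˣ using IsUnit.mk0 y hy
    have k := qrp_five x y hx1 hy1
    rw [← eF_ne, ← eF_ne, ← bF_ne, ← bF_ne] at k
    rw [← Units.val_inv_eq_inv_val, ← Units.val_mul, bF_unit, bF_unit, bF_unit, eF_unit]
    simpa only [Units.val_inv_eq_inv_val] using k
  psi := by
    intro x hx
    lift x to Fˣ using IsUnit.mk0 x hx
    rw [← Units.val_inv_eq_inv_val, bF_unit, bF_unit, eF_neg_one, qrp_psi]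
  cc := by
    intro x hx hx1
    lift x to Fˣ using IsUnit.mk0 x hx
    rw [bF_unit, eF_neg_one, bF_ne _ (one_sub_ne hx1)]
    exact hc x hx1

/-- Let `F` be a field with at least 4 elements. Then in `qRP(F)`:
(i) `3·C_F = 0`, and (ii) for every `x ∈ F^× \ {1}`,
`⟨⟨x⟩⟩·C_F = ⟨x-1⟩·⟨⟨-x⟩⟩·[x]`. Here `C_F` is the common value of
`[x] + ⟨-1⟩[1-x]` over `x ∈ F^× \ {1}`. -/
theorem statement3 (F : Type) [Field F] (hcard : 4 ≤ Cardinal.mk F)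
    (c : qRP F)
    (hc : ∀ (x : Fˣ) (hx : (x : F) ≠ 1),
      c = qrp F x + cls F (-1) • qrp F (U F (1 - (x : F)) (one_sub_ne hx))) :
    (3 : ℤ) • c = 0 ∧
      ∀ (x : Fˣ) (hx : (x : F) ≠ 1),
        (cls F x - 1) • c =
          (cls F (U F ((x : F) - 1) (sub_ne_zero.mpr hx)) * (cls F (-x) - 1)) • qrp F x := by
  have h := qax_F F c hc
  constructor
  · obtain ⟨x, h0, h1⟩ : ∃ x : F, x ≠ 0 ∧ x ≠ 1 := by
      by_contra hh
      push Not at hh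
      have hs : (Set.univ : Set F) ⊆ {0, 1} := by
        intro x _
        by_cases h0 : x = 0
        · simp [h0]
        · simp [hh x h0]
      have h2 : Cardinal.mk F ≤ 2 := by
        rw [← Cardinal.mk_univ]
        refine (Cardinal.mk_le_mk_of_subset hs).trans ?_
        refine (Cardinal.mk_insert_le).trans ?_
        rw [Cardinal.mk_singleton]
        norm_num
      have h4 := hcard.trans h2
      norm_num at h4
    have k := h.three_c h0 h1
    rw [← k]
    module
  · intro x hx
    have k := h.main x.ne_zero hx
    unfold QAx.P at k
    rw [eF_unit, bF_unit, eF_ne _ (sub_ne_zero.mpr hx), ← Units.val_neg, eF_unit] at k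
    exact k
end
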